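/- Multifractal scaling: Let γ ∈ (0, √(2d)), assume g is continuous, let f : D → [0,∞) be bounded and continuous, and let M be the Gaussian multiplicative chaos measure on D. Then for every x ∈ D with f(x) > 0 and every q ∈ (−∞, 2d/γ²), there exists a constant C_x > 0 (depending on f, q and the kernel K) such that E[ M(B(x,r))^q ] / r^{ζ(q)} → C_x as r → 0⁺, where ζ(q) = (d + γ²/2) q − γ² q² / 2 is the structure function of M. -/

import Mathlib

open MeasureTheory ProbabilityTheory Filter Topology
open scoped ENNReal NNReal

noncomputable section

variable {d : ℕ}

/-- The rescaled mollifier `θ_ε(x) = ε^{-d} θ(x/ε)`. -/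
def mollifierScaled (θ : EuclideanSpace ℝ (Fin d) → ℝ) (ε : ℝ)
    (x : EuclideanSpace ℝ (Fin d)) : ℝ :=
  (ε ^ d)⁻¹ * θ (ε⁻¹ • x)

/-- A nonnegative smooth mollifier: `C^∞`, compactly supported, nonnegative, total integral 1. -/
def IsMollifier (θ : EuclideanSpace ℝ (Fin d) → ℝ) : Prop :=
  ContDiff ℝ (⊤ : ℕ∞) θ ∧ HasCompactSupport θ ∧ (∀ x, 0 ≤ θ x) ∧ (∫ x, θ x) = 1

/-- The kernel of log-type associated to `g`: `K(x,y) = ln₊(1/|x-y|) + g(x,y)` where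
`ln₊ u = max (ln u) 0`. -/
def logKernel (g : EuclideanSpace ℝ (Fin d) → EuclideanSpace ℝ (Fin d) → ℝ)
    (x y : EuclideanSpace ℝ (Fin d)) : ℝ :=
  max (Real.log (dist x y)⁻¹) 0 + g x y

/-- `g` is bounded and (jointly) measurable. -/
def IsBoundedMeasurable (g : EuclideanSpace ℝ (Fin d) → EuclideanSpace ℝ (Fin d) → ℝ) : Prop :=
  Measurable (Function.uncurry g) ∧ ∃ C, ∀ x y, |g x y| ≤ C

/-- The mollified covariance `K_{ε,ε'}(x,y) = ∫∫ θ₁_ε(u) θ₂_{ε'}(v) K(x-u, y-v) du dv`. -/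
def mollifiedCov (K : EuclideanSpace ℝ (Fin d) → EuclideanSpace ℝ (Fin d) → ℝ)
    (θ₁ θ₂ : EuclideanSpace ℝ (Fin d) → ℝ) (ε ε' : ℝ)
    (x y : EuclideanSpace ℝ (Fin d)) : ℝ :=
  ∫ u, ∫ v, mollifierScaled θ₁ ε u * mollifierScaled θ₂ ε' v * K (x - u) (y - v)

/-- `X = (X(ε,x))` is a jointly measurable family whose finite-dimensional distributions are
centered Gaussian with covariance `E[X(ε,x) X(ε',y)] = Km ε ε' x y` (expressed by requiring
every finite real linear combination to have the appropriate centered Gaussian law). -/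
def IsGaussianFamily {Ω : Type*} [MeasurableSpace Ω] (P : Measure Ω)
    (X : ℝ → EuclideanSpace ℝ (Fin d) → Ω → ℝ)
    (Km : ℝ → ℝ → EuclideanSpace ℝ (Fin d) → EuclideanSpace ℝ (Fin d) → ℝ) : Prop :=
  (Measurable fun p : ℝ × EuclideanSpace ℝ (Fin d) × Ω => X p.1 p.2.1 p.2.2) ∧
  ∀ (n : ℕ) (ε : Fin n → ℝ) (x : Fin n → EuclideanSpace ℝ (Fin d)),
    (∀ i, ε i ∈ Set.Ioc (0 : ℝ) 1) → ∀ l : Fin n → ℝ, ∃ v : ℝ≥0,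
      (v : ℝ) = ∑ i, ∑ j, l i * l j * Km (ε i) (ε j) (x i) (x j) ∧
      Measure.map (fun ω => ∑ i, l i * X (ε i) (x i) ω) P = gaussianReal 0 v

/-- The approximate Gaussian multiplicative chaos measure
`M_ε(A) = ∫_A exp(γ X(ε,x) - (γ²/2) Km ε ε x x) f(x) dx`. -/
def approxGMC {Ω : Type*} (γ : ℝ) (X : ℝ → EuclideanSpace ℝ (Fin d) → Ω → ℝ)
    (Km : ℝ → ℝ → EuclideanSpace ℝ (Fin d) → EuclideanSpace ℝ (Fin d) → ℝ)
    (f : EuclideanSpace ℝ (Fin d) → ℝ) (ε : ℝ) (ω : Ω)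
    (A : Set (EuclideanSpace ℝ (Fin d))) : ℝ :=
  ∫ x in A, Real.exp (γ * X ε x ω - γ ^ 2 / 2 * Km ε ε x x) * f x

/-- `M` is the Gaussian multiplicative chaos measure on `D`: a random Radon measure on `D`
such that `M_ε(A) → M(A)` in probability as `ε → 0` for every Borel `A` with compact closure
contained in `D`. -/
def IsGMCMeasure {Ω : Type*} [MeasurableSpace Ω] (P : Measure Ω) (γ : ℝ)
    (X : ℝ → EuclideanSpace ℝ (Fin d) → Ω → ℝ)
    (Km : ℝ → ℝ → EuclideanSpace ℝ (Fin d) → EuclideanSpace ℝ (Fin d) → ℝ)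
    (f : EuclideanSpace ℝ (Fin d) → ℝ) (D : Set (EuclideanSpace ℝ (Fin d)))
    (M : Ω → Measure (EuclideanSpace ℝ (Fin d))) : Prop :=
  (∀ A : Set (EuclideanSpace ℝ (Fin d)), MeasurableSet A → Measurable fun ω => M ω A) ∧
  (∀ ω, ∀ A : Set (EuclideanSpace ℝ (Fin d)), IsCompact (closure A) → closure A ⊆ D →
    M ω A ≠ ⊤) ∧
  (∀ A : Set (EuclideanSpace ℝ (Fin d)), MeasurableSet A → IsCompact (closure A) →
    closure A ⊆ D →
    TendstoInMeasure P (fun ε ω => approxGMC γ X Km f ε ω A) (𝓝[Set.Ioc (0 : ℝ) 1] 0)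
      fun ω => (M ω A).toReal)

/-- Finite measures on a finite product of lines are determined by their Laplace transforms. -/
lemma ext_of_lintegral_exp {ι : Type*} [Fintype ι] {μ ν : Measure (ι → ℝ)} [IsFiniteMeasure μ]
    [IsFiniteMeasure ν]
    (h : ∀ l : ι → ℝ, ∫⁻ x, ENNReal.ofReal (Real.exp (∑ i, l i * x i)) ∂μ =
      ∫⁻ x, ENNReal.ofReal (Real.exp (∑ i, l i * x i)) ∂ν)
    (hfin : ∀ l : ι → ℝ, ∫⁻ x, ENNReal.ofReal (Real.exp (∑ i, l i * x i)) ∂μ ≠ ⊤) : μ = ν := by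
  classical
  have huniv : μ Set.univ = ν Set.univ := by simpa using h 0
  have hwi : ∀ l : ι → ℝ, Integrable (fun x : ι → ℝ => Real.exp (∑ i, l i * x i)) μ := fun l =>
    ⟨(by fun_prop : Measurable _).aestronglyMeasurable, by
      rw [hasFiniteIntegral_iff_ofReal (ae_of_all _ fun _ => (Real.exp_pos _).le)]
      exact (hfin l).lt_top⟩
  apply Measure.ext_of_charFunDual
  funext L
  obtain ⟨c, hL⟩ : ∃ c : ι → ℝ, ∀ x, L x = ∑ i, c i * x i := by
    refine ⟨fun i => L (Pi.single i 1), fun x => ?_⟩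
    conv_lhs => rw [← Finset.univ_sum_single x]
    rw [map_sum]
    refine Finset.sum_congr rfl fun i _ => ?_
    have : (Pi.single i (x i) : ι → ℝ) = x i • Pi.single i 1 := by
      rw [← Pi.single_smul]; simp
    rw [this, map_smul, smul_eq_mul, mul_comm]
  have hmul : ∀ (t : ℝ) x, t * L x = ∑ i, (t * c i) * x i := fun t x => by
    rw [hL, Finset.mul_sum]; simp [mul_assoc]
  have hmgf : mgf (fun x => L x) μ = mgf (fun x => L x) ν := by
    funext t
    simp only [ProbabilityTheory.mgf, hmul]
    rw [integral_eq_lintegral_of_nonneg_ae (ae_of_all _ fun _ => (Real.exp_pos _).le)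
        (by fun_prop : Measurable _).aestronglyMeasurable,
      integral_eq_lintegral_of_nonneg_ae (ae_of_all _ fun _ => (Real.exp_pos _).le)
        (by fun_prop : Measurable _).aestronglyMeasurable,
      h]
  have key := eqOn_complexMGF_of_mgf' hmgf (by
    rw [← Measure.measure_univ_eq_zero, huniv, Measure.measure_univ_eq_zero])
  have hset : integrableExpSet (fun x => L x) μ = Set.univ := by
    ext t
    simp only [integrableExpSet, Set.mem_ofPred_eq, Set.mem_univ, iff_true, hmul]
    exact hwi _
  have := key (x := Complex.I) (by simp [hset])
  simp only [complexMGF] at this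
  simp only [charFunDual_apply]
  convert this using 4 <;> ring

/-- A centered Gaussian family indexed by `T`, jointly measurable, with covariance `C`. -/
structure IsGaussField {T Ω : Type*} [MeasurableSpace T] [MeasurableSpace Ω] (P : Measure Ω)
    (Z : T → Ω → ℝ) (C : T → T → ℝ) : Prop where
  meas : Measurable (Function.uncurry Z)
  symm : ∀ s t, C s t = C t s
  mgf : ∀ {ι : Type} [Fintype ι] (t : ι → T) (l : ι → ℝ),
    ∫⁻ ω, ENNReal.ofReal (Real.exp (∑ i, l i * Z (t i) ω)) ∂P =
      ENNReal.ofReal (Real.exp ((∑ i, ∑ j, l i * l j * C (t i) (t j)) / 2))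

namespace IsGaussField

variable {T S Ω Ω' : Type*} [MeasurableSpace T] [MeasurableSpace S] [MeasurableSpace Ω]
  [MeasurableSpace Ω'] {P : Measure Ω} {P' : Measure Ω'} {Z : T → Ω → ℝ} {Z' : T → Ω' → ℝ}
  {C C' : T → T → ℝ}

lemma isProbabilityMeasure (hZ : IsGaussField P Z C) : IsProbabilityMeasure P :=
  ⟨by simpa using hZ.mgf (ι := Empty) (fun i => i.elim) (fun i => i.elim)⟩

lemma measurable (hZ : IsGaussField P Z C) (t : T) : Measurable (Z t) :=
  hZ.meas.comp measurable_prodMk_left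

lemma lintegral_exp (hZ : IsGaussField P Z C) (t : T) (a : ℝ) :
    ∫⁻ ω, ENNReal.ofReal (Real.exp (a * Z t ω)) ∂P =
      ENNReal.ofReal (Real.exp (a ^ 2 * C t t / 2)) := by
  have := hZ.mgf (ι := Unit) (fun _ => t) (fun _ => a)
  simpa [sq] using this

lemma lintegral_exp_add (hZ : IsGaussField P Z C) (s t : T) (a b : ℝ) :
    ∫⁻ ω, ENNReal.ofReal (Real.exp (a * Z s ω + b * Z t ω)) ∂P =
      ENNReal.ofReal (Real.exp (a ^ 2 * C s s / 2 + b ^ 2 * C t t / 2 + a * b * C s t)) := by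
  have := hZ.mgf (ι := Bool) (fun i => bif i then s else t) (fun i => bif i then a else b)
  simp only [Fintype.sum_bool, cond_true, cond_false, hZ.symm t s] at this
  rw [this]; congr 2; ring

lemma measurable_cov (hZ : IsGaussField P Z C) : Measurable fun t => C t t := by
  have := hZ.isProbabilityMeasure
  have h : (fun t => C t t) = fun t =>
      2 * Real.log (∫⁻ ω, ENNReal.ofReal (Real.exp (Z t ω)) ∂P).toReal := by
    funext t
    have := hZ.lintegral_exp t 1
    simp only [one_mul, one_pow] at this
    rw [this, ENNReal.toReal_ofReal (Real.exp_pos _).le, Real.log_exp]; ring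
  rw [h]
  have : Measurable fun t => ∫⁻ ω, ENNReal.ofReal (Real.exp (Z t ω)) ∂P :=
    Measurable.lintegral_prod_right' (f := fun p : T × Ω =>
    ENNReal.ofReal (Real.exp (Z p.1 p.2)))
      (Real.measurable_exp.comp hZ.meas).ennreal_ofReal
  exact (Real.measurable_log.comp this.ennreal_toReal).const_mul 2

lemma measurable_cov_left (hZ : IsGaussField P Z C) (s : T) : Measurable fun t => C t s := by
  have := hZ.isProbabilityMeasure
  have h : (fun t => C t s) = fun t =>
      Real.log (∫⁻ ω, ENNReal.ofReal (Real.exp (Z t ω + Z s ω)) ∂P).toReal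
        - C t t / 2 - C s s / 2 := by
    funext t
    have := hZ.lintegral_exp_add t s 1 1
    simp only [one_mul, one_pow] at this
    rw [this, ENNReal.toReal_ofReal (Real.exp_pos _).le, Real.log_exp]; ring
  rw [h]
  have : Measurable fun t => ∫⁻ ω, ENNReal.ofReal (Real.exp (Z t ω + Z s ω)) ∂P :=
    Measurable.lintegral_prod_right'
      (f := fun p : T × Ω =>
    ENNReal.ofReal (Real.exp (Z p.1 p.2 + Z s p.2)))
      (Real.measurable_exp.comp
        (hZ.meas.add ((hZ.measurable s).comp measurable_snd))).ennreal_ofReal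
  exact ((Real.measurable_log.comp this.ennreal_toReal).sub (hZ.measurable_cov.div_const
    2)).sub_const _

/-- Reparametrizing and rescaling a Gaussian family. -/
lemma pull (hZ : IsGaussField P Z C) {ρ : S → T} (hρ : Measurable ρ) {a : S → ℝ}
    (ha : Measurable a) :
    IsGaussField P (fun s ω => a s * Z (ρ s) ω) (fun s t => a s * a t * C (ρ s) (ρ t)) where
  meas := (ha.comp measurable_fst).mul
    (hZ.meas.comp ((hρ.comp measurable_fst).prodMk measurable_snd))
  symm s t := by rw [hZ.symm]; ring
  mgf t l := by
    have := hZ.mgf (fun i => ρ (t i)) (fun i => l i * a (t i))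
    simp only [← mul_assoc] at this ⊢
    rw [this]
    congr! 6
    ring

/-- The sum of two independent Gaussian families. -/
lemma add (hZ : IsGaussField P Z C) (hZ' : IsGaussField P' Z' C') :
    IsGaussField (P.prod P') (fun t ω => Z t ω.1 + Z' t ω.2) (fun s t => C s t + C' s t) where
  meas := (hZ.meas.comp (measurable_fst.prodMk (measurable_fst.comp measurable_snd))).add
    (hZ'.meas.comp (measurable_fst.prodMk (measurable_snd.comp measurable_snd)))
  symm s t := by rw [hZ.symm, hZ'.symm]
  mgf t l := by
    have := hZ.isProbabilityMeasure
    have := hZ'.isProbabilityMeasure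
    have h1 := fun i => hZ.measurable (t i)
    have h2 := fun i => hZ'.measurable (t i)
    calc _ = ∫⁻ ω, ENNReal.ofReal (Real.exp (∑ i, l i * Z (t i) ω.1)) *
          ENNReal.ofReal (Real.exp (∑ i, l i * Z' (t i) ω.2)) ∂(P.prod P') := by
          refine lintegral_congr fun ω => ?_
          rw [← ENNReal.ofReal_mul (Real.exp_pos _).le, ← Real.exp_add, ← Finset.sum_add_distrib]
          simp only [mul_add]
      _ = _ := by
          rw [lintegral_prod_mul (f := fun ω => ENNReal.ofReal (Real.exp (∑ i, l i * Z (t i) ω)))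
            (g := fun ω => ENNReal.ofReal (Real.exp (∑ i, l i * Z' (t i) ω)))
            (by fun_prop) (by fun_prop), hZ.mgf, hZ'.mgf,
            ← ENNReal.ofReal_mul (Real.exp_pos _).le, ← Real.exp_add, ← add_div,
            ← Finset.sum_add_distrib]
          simp only [mul_add, Finset.sum_add_distrib]

/-- The Cameron–Martin density in the direction `s • C(·, t₀)`. -/
def tilt (Z : T → Ω → ℝ) (C : T → T → ℝ) (t₀ : T) (s : ℝ) (ω : Ω) : ℝ≥0∞ :=
  ENNReal.ofReal (Real.exp (s * Z t₀ ω - s ^ 2 * C t₀ t₀ / 2))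

lemma measurable_tilt (hZ : IsGaussField P Z C) (t₀ : T) (s : ℝ) :
    Measurable (tilt Z C t₀ s) := by
  have h0 := hZ.measurable t₀
  unfold tilt; fun_prop

lemma lintegral_tilt (hZ : IsGaussField P Z C) (t₀ : T) (s : ℝ) :
    ∫⁻ ω, tilt Z C t₀ s ω ∂P = 1 := by
  simp only [tilt, sub_eq_add_neg, Real.exp_add, ENNReal.ofReal_mul (Real.exp_pos _).le]
  rw [lintegral_mul_const' _ _ ENNReal.ofReal_ne_top, hZ.lintegral_exp,
    ← ENNReal.ofReal_mul (Real.exp_pos _).le, ← Real.exp_add]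
  simp

lemma isProbabilityMeasure_tilt (hZ : IsGaussField P Z C) (t₀ : T) (s : ℝ) :
    IsProbabilityMeasure (P.withDensity (tilt Z C t₀ s)) :=
  ⟨by rw [withDensity_apply _ .univ, Measure.restrict_univ]; exact hZ.lintegral_tilt t₀ s⟩

/-- The Cameron–Martin formula for finitely many coordinates. -/
lemma map_tilt (hZ : IsGaussField P Z C) {ι : Type} [Fintype ι] (t : ι → T) (t₀ : T) (s : ℝ) :
    (P.withDensity (tilt Z C t₀ s)).map (fun ω i => Z (t i) ω) =
      P.map (fun ω i => Z (t i) ω + s * C (t i) t₀) := by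
  have := hZ.isProbabilityMeasure
  have h1 := fun i => hZ.measurable (t i)
  have h0 := hZ.measurable t₀
  have hDm := hZ.measurable_tilt t₀ s
  have := hZ.isProbabilityMeasure_tilt t₀ s
  have hV : Measurable fun ω (i : ι) => Z (t i) ω := by fun_prop
  have hV' : Measurable fun ω (i : ι) => Z (t i) ω + s * C (t i) t₀ := by fun_prop
  have e1 : ∀ l : ι → ℝ, ∫⁻ x, ENNReal.ofReal (Real.exp (∑ i, l i * x i))
      ∂((P.withDensity (tilt Z C t₀ s)).map (fun ω i => Z (t i) ω)) =
      ENNReal.ofReal (Real.exp ((∑ i, ∑ j, l i * l j * C (t i) (t j)) / 2 +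
        ∑ i, l i * (s * C (t i) t₀))) := by
    intro l
    rw [lintegral_map (by fun_prop) hV, lintegral_withDensity_eq_lintegral_mul _ hDm
      (by fun_prop)]
    have := hZ.mgf (ι := Option ι) (fun i => i.elim t₀ t) (fun i => i.elim s l)
    simp only [Fintype.sum_option, Option.elim] at this
    calc _ = ∫⁻ ω, ENNReal.ofReal (Real.exp (s * Z t₀ ω + ∑ i, l i * Z (t i) ω)) *
          ENNReal.ofReal (Real.exp (- (s ^ 2 * C t₀ t₀ / 2))) ∂P := by
          refine lintegral_congr fun ω => ?_
          simp only [tilt, Pi.mul_apply]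
          rw [← ENNReal.ofReal_mul (Real.exp_pos _).le, ← ENNReal.ofReal_mul (Real.exp_pos _).le,
            ← Real.exp_add, ← Real.exp_add]
          congr 2; ring
      _ = _ := by
          rw [lintegral_mul_const' _ _ ENNReal.ofReal_ne_top, this,
            ← ENNReal.ofReal_mul (Real.exp_pos _).le, ← Real.exp_add]
          congr 2
          simp only [Finset.sum_add_distrib, hZ.symm t₀]
          have a1 : ∑ x, s * l x * C (t x) t₀ = ∑ i, l i * (s * C (t i) t₀) :=
            Finset.sum_congr rfl fun _ _ => by ring
          have a2 : ∑ x, l x * s * C (t x) t₀ = ∑ i, l i * (s * C (t i) t₀) :=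
            Finset.sum_congr rfl fun _ _ => by ring
          rw [a1, a2]; ring
  apply ext_of_lintegral_exp
  · intro l
    rw [e1, lintegral_map (by fun_prop) hV']
    simp only [mul_add, Finset.sum_add_distrib, Real.exp_add,
      ENNReal.ofReal_mul (Real.exp_pos _).le]
    rw [lintegral_mul_const' _ _ ENNReal.ofReal_ne_top, hZ.mgf]
  · intro l; rw [e1]; exact ENNReal.ofReal_ne_top

end IsGaussField

namespace IsGaussField

variable {T Ω : Type*} [MeasurableSpace T] [MeasurableSpace Ω] {P : Measure Ω} {Z : T → Ω → ℝ}
  {C : T → T → ℝ}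

lemma integrable_exp (hZ : IsGaussField P Z C) (t : T) (a : ℝ) :
    Integrable (fun ω => Real.exp (a * Z t ω)) P := by
  have h0 := hZ.measurable t
  refine ⟨(by fun_prop : Measurable _).aestronglyMeasurable, ?_⟩
  rw [hasFiniteIntegral_iff_ofReal (ae_of_all _ fun _ => (Real.exp_pos _).le), hZ.lintegral_exp]
  exact ENNReal.ofReal_lt_top

lemma integrable_exp_abs (hZ : IsGaussField P Z C) (t : T) (a : ℝ) :
    Integrable (fun ω => Real.exp (a * |Z t ω|)) P := by
  have h0 := hZ.measurable t
  refine ((hZ.integrable_exp t a).add (hZ.integrable_exp t (-a))).mono'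
    (by fun_prop : Measurable _).aestronglyMeasurable (ae_of_all _ fun ω => ?_)
  rw [Real.norm_of_nonneg (Real.exp_pos _).le]
  simp only [Pi.add_apply]
  rcases abs_cases (Z t ω) with h | h <;> rw [h.1]
  · linarith [Real.exp_pos (-a * Z t ω)]
  · have : a * -Z t ω = -a * Z t ω := by ring
    rw [this]; linarith [Real.exp_pos (a * Z t ω)]

lemma integrable_abs (hZ : IsGaussField P Z C) (t : T) : Integrable (fun ω => |Z t ω|) P := by
  have h0 := hZ.measurable t
  refine (hZ.integrable_exp_abs t 1).mono'
    (by fun_prop : Measurable _).aestronglyMeasurable (ae_of_all _ fun ω => ?_)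
  rw [Real.norm_of_nonneg (abs_nonneg _), one_mul]
  linarith [Real.add_one_le_exp |Z t ω|]

/-- Gaussian integration by parts. -/
lemma integral_mul_eq (hZ : IsGaussField P Z C) {ι : Type} [Fintype ι] (t : ι → T) (t₀ : T)
    {G G' : (ι → ℝ) → ℝ} (hG : Measurable G) (hG' : Measurable G') {B : ℝ}
    (hB : ∀ x, |G x| ≤ B) (hB' : ∀ x, |G' x| ≤ B)
    (hderiv : ∀ (x : ι → ℝ) (s : ℝ), HasDerivAt (fun s : ℝ => G (fun i => x i + s * C (t i) t₀))
      (G' (fun i => x i + s * C (t i) t₀)) s) :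
    ∫ ω, Z t₀ ω * G (fun i => Z (t i) ω) ∂P = ∫ ω, G' (fun i => Z (t i) ω) ∂P := by
  have := hZ.isProbabilityMeasure
  have h1 := fun i => hZ.measurable (t i)
  have h0 := hZ.measurable t₀
  have hV : Measurable fun ω (i : ι) => Z (t i) ω := by fun_prop
  set c := C t₀ t₀ with hc
  have hB0 : 0 ≤ B := (abs_nonneg _).trans (hB 0)
  have heq : ∀ s : ℝ, ∫ ω, Real.exp (s * Z t₀ ω - s ^ 2 * c / 2) * G (fun i => Z (t i) ω) ∂P =
      ∫ ω, G (fun i => Z (t i) ω + s * C (t i) t₀) ∂P := by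
    intro s
    have hVs : Measurable fun ω (i : ι) => Z (t i) ω + s * C (t i) t₀ := by fun_prop
    have key := congrArg (fun m => ∫ x, G x ∂m) (hZ.map_tilt t t₀ s)
    beta_reduce at key
    rw [integral_map hV.aemeasurable hG.aestronglyMeasurable,
      integral_map hVs.aemeasurable hG.aestronglyMeasurable,
      integral_withDensity_eq_integral_toReal_smul (hZ.measurable_tilt t₀ s)
        (ae_of_all _ fun _ => ENNReal.ofReal_lt_top)] at key
    rw [← key]
    refine integral_congr_ae (ae_of_all _ fun ω => ?_)
    simp only [tilt, smul_eq_mul]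
    rw [ENNReal.toReal_ofReal (Real.exp_pos _).le]
  have d1 : HasDerivAt (fun s : ℝ => ∫ ω, Real.exp (s * Z t₀ ω - s ^ 2 * c / 2) *
      G (fun i => Z (t i) ω) ∂P) (∫ ω, Z t₀ ω * G (fun i => Z (t i) ω) ∂P) 0 := by
    have := (hasDerivAt_integral_of_dominated_loc_of_deriv_le (μ := P) (x₀ := (0 : ℝ))
      (F := fun s ω => Real.exp (s * Z t₀ ω - s ^ 2 * c / 2) * G (fun i => Z (t i) ω))
      (F' := fun s ω => (Real.exp (s * Z t₀ ω - s ^ 2 * c / 2) * (Z t₀ ω - s * c)) *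
        G (fun i => Z (t i) ω))
      (bound := fun ω => Real.exp (2 * |c|) * B * Real.exp (2 * |Z t₀ ω|))
      (s := Metric.ball 0 1) (Metric.ball_mem_nhds _ one_pos) ?_ ?_ ?_ ?_ ?_ ?_).2
    · simpa using this
    · exact Eventually.of_forall fun s =>
        (Measurable.mul (by fun_prop) (hG.comp hV)).aestronglyMeasurable
    · refine (integrable_const B).mono'
        (Measurable.mul (by fun_prop) (hG.comp hV)).aestronglyMeasurable
        (ae_of_all _ fun ω => ?_)
      simpa using hB _
    · exact (Measurable.mul (by fun_prop) (hG.comp hV)).aestronglyMeasurable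
    · refine ae_of_all _ fun ω s hs => ?_
      have hs1 : |s| ≤ 1 := by simpa using (mem_ball_zero_iff.mp hs).le
      rw [norm_mul, norm_mul, Real.norm_of_nonneg (Real.exp_pos _).le]
      have e1 : Real.exp (s * Z t₀ ω - s ^ 2 * c / 2) ≤ Real.exp (|Z t₀ ω| + |c|) := by
        apply Real.exp_le_exp.mpr
        have a1 : s * Z t₀ ω ≤ |Z t₀ ω| := by
          calc _ ≤ |s * Z t₀ ω| := le_abs_self _
            _ = |s| * |Z t₀ ω| := abs_mul _ _
            _ ≤ 1 * |Z t₀ ω| := by gcongr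
            _ = _ := one_mul _
        have a2 : -(s ^ 2 * c / 2) ≤ |c| := by
          have : s ^ 2 ≤ 1 := by rw [← sq_abs]; exact pow_le_one₀ (abs_nonneg _) hs1
          have h3 : -(s ^ 2 * c) ≤ s ^ 2 * |c| := by
            rw [← mul_neg]; exact mul_le_mul_of_nonneg_left (neg_le_abs _) (sq_nonneg _)
          nlinarith [abs_nonneg c]
        linarith
      have e2 : ‖Z t₀ ω - s * c‖ ≤ Real.exp (|Z t₀ ω| + |c|) := by
        have : ‖Z t₀ ω - s * c‖ ≤ |Z t₀ ω| + |c| := by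
          refine (norm_sub_le _ _).trans ?_
          rw [Real.norm_eq_abs, Real.norm_eq_abs, abs_mul]
          nlinarith [abs_nonneg c]
        linarith [Real.add_one_le_exp (|Z t₀ ω| + |c|)]
      calc _ ≤ (Real.exp (|Z t₀ ω| + |c|) * Real.exp (|Z t₀ ω| + |c|)) * B := by
            gcongr; exact hB _
        _ = _ := by
            rw [← Real.exp_add]
            have : |Z t₀ ω| + |c| + (|Z t₀ ω| + |c|) = 2 * |c| + 2 * |Z t₀ ω| := by ring
            rw [this, Real.exp_add]; ring
    · exact (hZ.integrable_exp_abs t₀ 2).const_mul _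
    · refine ae_of_all _ fun ω s _ => ?_
      refine (HasDerivAt.exp ?_).mul_const _
      exact HasDerivAt.congr_deriv (((hasDerivAt_id' s).mul_const (Z t₀ ω)).fun_sub
        (((hasDerivAt_pow 2 s).mul_const c).div_const 2)) (by norm_num; ring)
  have d2 : HasDerivAt (fun s : ℝ => ∫ ω, G (fun i => Z (t i) ω + s * C (t i) t₀) ∂P)
      (∫ ω, G' (fun i => Z (t i) ω) ∂P) 0 := by
    have := (hasDerivAt_integral_of_dominated_loc_of_deriv_le (μ := P) (x₀ := (0 : ℝ))
      (F := fun s ω => G (fun i => Z (t i) ω + s * C (t i) t₀))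
      (F' := fun s ω => G' (fun i => Z (t i) ω + s * C (t i) t₀))
      (bound := fun _ => B)
      (s := Metric.ball 0 1) (Metric.ball_mem_nhds _ one_pos) ?_ ?_ ?_ ?_ ?_ ?_).2
    · simpa using this
    · exact Eventually.of_forall fun s => (hG.comp (by fun_prop)).aestronglyMeasurable
    · exact (integrable_const B).mono' (hG.comp (by fun_prop)).aestronglyMeasurable
        (ae_of_all _ fun ω => hB _)
    · exact (hG'.comp (by fun_prop)).aestronglyMeasurable
    · exact ae_of_all _ fun ω s _ => hB' _
    · exact integrable_const B
    · exact ae_of_all _ fun ω s _ => hderiv _ s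
  simp only [heq] at d1
  exact d1.unique d2

end IsGaussField

namespace IsGaussField

variable {T Ω Ω' : Type*} [MeasurableSpace T] [MeasurableSpace Ω] [MeasurableSpace Ω']
  {P : Measure Ω} {P' : Measure Ω'} {Z : T → Ω → ℝ} {Z' : T → Ω' → ℝ} {C C' : T → T → ℝ}

/-- Linear combinations of two independent Gaussian families. -/
lemma combination (hZ : IsGaussField P Z C) (hZ' : IsGaussField P' Z' C') :
    IsGaussField (P.prod P') (fun (s : ℝ × ℝ × T) ω => s.1 * Z s.2.2 ω.1 + s.2.1 * Z' s.2.2 ω.2)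
      (fun s t => s.1 * t.1 * C s.2.2 t.2.2 + s.2.1 * t.2.1 * C' s.2.2 t.2.2) :=
  (hZ.pull (ρ := fun s : ℝ × ℝ × T => s.2.2) (measurable_snd.comp measurable_snd)
    measurable_fst).add
    (hZ'.pull (ρ := fun s : ℝ × ℝ × T => s.2.2) (measurable_snd.comp measurable_snd)
      (measurable_fst.comp measurable_snd))

/-- Gaussian interpolation for discrete exponential sums: if two covariances are `δ`-close and
`w² |F''(w)| ≤ c F(w)`, then the expectations of `F` of the sums are comparable. -/
lemma integral_sum_exp_le (hZ : IsGaussField P Z C) (hZ' : IsGaussField P' Z' C')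
    {ι : Type} [Fintype ι] (t : ι → T) {p : ι → ℝ} (hp : ∀ i, 0 ≤ p i) {δ c B : ℝ}
    (hδ : ∀ i j, |C (t i) (t j) - C' (t i) (t j)| ≤ δ) {F F₁ F₂ : ℝ → ℝ}
    (hF : Measurable F) (hF₁ : Measurable F₁) (hF₂ : Measurable F₂)
    (hd₁ : ∀ w, 0 ≤ w → HasDerivAt F (F₁ w) w) (hd₂ : ∀ w, 0 ≤ w → HasDerivAt F₁ (F₂ w) w)
    (hB : ∀ w, 0 ≤ w → |F w| ≤ B) (hB₁ : ∀ w, 0 ≤ w → w * |F₁ w| ≤ B) (hδ0 : 0 ≤ δ)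
    (hc : 0 ≤ c) (hB₂ : ∀ w, 0 ≤ w → w ^ 2 * |F₂ w| ≤ c * F w) :
    ∫ ω, F (∑ i, p i * Real.exp (Z (t i) ω - C (t i) (t i) / 2)) ∂P ≤
      Real.exp (c * δ * (Real.pi / 2)) *
        ∫ ω, F (∑ i, p i * Real.exp (Z' (t i) ω - C' (t i) (t i) / 2)) ∂P' := by
  have := hZ.isProbabilityMeasure
  have := hZ'.isProbabilityMeasure
  have h1 := fun i => hZ.measurable (t i)
  have h2 := fun i => hZ'.measurable (t i)
  have hY := hZ.combination hZ'
  set K : ι → ℝ := fun i => C (t i) (t i) with hK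
  set K' : ι → ℝ := fun i => C' (t i) (t i) with hK'
  have hB0 : 0 ≤ B := (abs_nonneg _).trans (hB 0 le_rfl)
  -- the interpolating weights
  let w : ℝ → (ι → ℝ) → ι → ℝ := fun θ y i =>
    p i * Real.exp (y i - (Real.cos θ * Real.cos θ * K i + Real.sin θ * Real.sin θ * K' i) / 2)
  let W : ℝ → (ι → ℝ) → ℝ := fun θ y => ∑ i, w θ y i
  let Y : ℝ → Ω × Ω' → ι → ℝ := fun θ ω i => Real.cos θ * Z (t i) ω.1 + Real.sin θ * Z' (t i) ω.2
  let Y' : ℝ → Ω × Ω' → ι → ℝ := fun θ ω i =>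
    -Real.sin θ * Z (t i) ω.1 + Real.cos θ * Z' (t i) ω.2
  let v' : ℝ → ι → ℝ := fun θ i => Real.sin θ * Real.cos θ * (K' i - K i)
  have hw0 : ∀ θ y i, 0 ≤ w θ y i := fun θ y i => mul_nonneg (hp i) (Real.exp_pos _).le
  have hW0 : ∀ θ y, 0 ≤ W θ y := fun θ y => Finset.sum_nonneg fun i _ => hw0 θ y i
  have hwW : ∀ θ y i, w θ y i ≤ W θ y := fun θ y i =>
    Finset.single_le_sum (f := fun i => w θ y i) (fun i _ => hw0 θ y i) (Finset.mem_univ i)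
  have hwm : ∀ θ i, Measurable fun y => w θ y i := fun θ i => by
    show Measurable fun y : ι → ℝ => p i * Real.exp (y i - _)
    fun_prop
  have hWm : ∀ θ, Measurable (W θ) := fun θ => Finset.measurable_fun_sum _ fun i _ => hwm θ i
  have hYm : ∀ θ, Measurable (Y θ) := fun θ => by
    show Measurable fun (ω : Ω × Ω') i => _ * Z (t i) ω.1 + _ * Z' (t i) ω.2
    fun_prop
  have hY'm : ∀ θ i, Measurable fun ω => Y' θ ω i := fun θ i => by
    show Measurable fun (ω : Ω × Ω') => _ * Z (t i) ω.1 + _ * Z' (t i) ω.2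
    fun_prop
  set Q := P.prod P' with hQ
  set φ : ℝ → ℝ := fun θ => ∫ ω, F (W θ (Y θ ω)) ∂Q with hφ
  have hFi : ∀ θ, Integrable (fun ω => F (W θ (Y θ ω))) Q := fun θ =>
    (integrable_const B).mono' (hF.comp ((hWm θ).comp (hYm θ))).aestronglyMeasurable
      (ae_of_all _ fun ω => hB _ (hW0 _ _))
  -- integrability of the linear factor
  let lin : Ω × Ω' → ℝ := fun ω => ∑ i, (|Z (t i) ω.1| + |Z' (t i) ω.2| + (|K i| + |K' i|))
  have hlin : Integrable lin Q := by
    refine integrable_finsetSum _ fun i _ => Integrable.add (Integrable.add ?_ ?_)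
      (integrable_const _)
    · exact (hZ.integrable_abs (t i)).comp_fst P'
    · exact (hZ'.integrable_abs (t i)).comp_snd P
  have hlin1 : ∀ θ ω i, |Y' θ ω i - v' θ i| ≤ lin ω := by
    intro θ ω i
    refine le_trans ?_ (Finset.single_le_sum (f := fun i => |Z (t i) ω.1| + |Z' (t i) ω.2| +
      (|K i| + |K' i|)) (fun i _ => by positivity) (Finset.mem_univ i))
    have e1 : |(-Real.sin θ) * Z (t i) ω.1| ≤ |Z (t i) ω.1| := by
      rw [abs_mul, abs_neg]
      exact mul_le_of_le_one_left (abs_nonneg _) (Real.abs_sin_le_one θ)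
    have e2 : |Real.cos θ * Z' (t i) ω.2| ≤ |Z' (t i) ω.2| := by
      rw [abs_mul]
      exact mul_le_of_le_one_left (abs_nonneg _) (Real.abs_cos_le_one θ)
    have e3 : |v' θ i| ≤ |K i| + |K' i| := by
      show |Real.sin θ * Real.cos θ * (K' i - K i)| ≤ _
      rw [abs_mul, abs_mul]
      calc _ ≤ 1 * 1 * |K' i - K i| := by
            gcongr
            · exact Real.abs_sin_le_one θ
            · exact Real.abs_cos_le_one θ
        _ ≤ _ := by rw [one_mul, one_mul, add_comm]; exact abs_sub _ _
    calc _ ≤ |Y' θ ω i| + |v' θ i| := abs_sub _ _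
      _ ≤ (|(-Real.sin θ) * Z (t i) ω.1| + |Real.cos θ * Z' (t i) ω.2|) + |v' θ i| := by
          gcongr; exact abs_add_le _ _
      _ ≤ _ := by gcongr
  let dF : ℝ → Ω × Ω' → ℝ := fun θ ω =>
    F₁ (W θ (Y θ ω)) * ∑ i, w θ (Y θ ω) i * (Y' θ ω i - v' θ i)
  have hterm : ∀ θ ω i, |F₁ (W θ (Y θ ω)) * (w θ (Y θ ω) i * (Y' θ ω i - v' θ i))| ≤
      B * lin ω := by
    intro θ ω i
    rw [abs_mul, abs_mul, abs_of_nonneg (hw0 _ _ _), ← mul_assoc]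
    gcongr
    · calc _ ≤ |F₁ (W θ (Y θ ω))| * W θ (Y θ ω) := by gcongr; exact hwW _ _ _
        _ ≤ B := by rw [mul_comm]; exact hB₁ _ (hW0 _ _)
    · exact hlin1 θ ω i
  have hdFb : ∀ θ ω, |dF θ ω| ≤ B * lin ω := by
    intro θ ω
    have hl0 : 0 ≤ lin ω := Finset.sum_nonneg fun i _ => by positivity
    calc |dF θ ω| = |F₁ (W θ (Y θ ω))| * |∑ i, w θ (Y θ ω) i * (Y' θ ω i - v' θ i)| := abs_mul _ _
      _ ≤ |F₁ (W θ (Y θ ω))| * ∑ i, w θ (Y θ ω) i * lin ω := by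
          gcongr
          refine (Finset.abs_sum_le_sum_abs _ _).trans (Finset.sum_le_sum fun i _ => ?_)
          rw [abs_mul, abs_of_nonneg (hw0 _ _ _)]
          exact mul_le_mul_of_nonneg_left (hlin1 θ ω i) (hw0 _ _ _)
      _ = (W θ (Y θ ω) * |F₁ (W θ (Y θ ω))|) * lin ω := by rw [← Finset.sum_mul]; ring
      _ ≤ B * lin ω := by gcongr; exact hB₁ _ (hW0 _ _)
  have hderivY : ∀ θ ω i, HasDerivAt (fun θ => w θ (Y θ ω) i)
      (w θ (Y θ ω) i * (Y' θ ω i - v' θ i)) θ := by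
    intro θ ω i
    have a1 : HasDerivAt (fun θ => Y θ ω i) (Y' θ ω i) θ :=
      ((Real.hasDerivAt_cos θ).mul_const _).fun_add ((Real.hasDerivAt_sin θ).mul_const _)
    have a2 : HasDerivAt (fun θ => (Real.cos θ * Real.cos θ * K i +
        Real.sin θ * Real.sin θ * K' i) / 2) (v' θ i) θ :=
      HasDerivAt.congr_deriv ((((Real.hasDerivAt_cos θ).fun_mul (Real.hasDerivAt_cos θ)).mul_const
        (K i)).fun_add (((Real.hasDerivAt_sin θ).fun_mul (Real.hasDerivAt_sin θ)).mul_const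
        (K' i)) |>.div_const 2) (by simp only [v']; ring)
    exact HasDerivAt.congr_deriv ((a1.fun_sub a2).exp.const_mul (p i)) (by simp only [w]; ring)
  have hφ' : ∀ θ, HasDerivAt φ (∫ ω, dF θ ω ∂Q) θ := by
    intro θ
    refine (hasDerivAt_integral_of_dominated_loc_of_deriv_le (μ := Q) (x₀ := θ)
      (F := fun θ ω => F (W θ (Y θ ω))) (F' := dF) (bound := fun ω => B * lin ω)
      (s := Set.univ) Filter.univ_mem ?_ (hFi θ) ?_ ?_ (hlin.const_mul B) ?_).2
    · exact Eventually.of_forall fun θ => (hFi θ).1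
    · exact ((hF₁.comp ((hWm θ).comp (hYm θ))).mul (Finset.measurable_fun_sum _ fun i _ =>
        ((hwm θ i).comp (hYm θ)).mul ((hY'm θ i).sub_const _))).aestronglyMeasurable
    · exact ae_of_all _ fun ω θ _ => hdFb θ ω
    · exact ae_of_all _ fun ω θ _ => (hd₁ _ (hW0 _ _)).comp θ
        (HasDerivAt.fun_sum fun i _ => hderivY θ ω i)
  -- Gaussian integration by parts
  let κ : ℝ → ι → ι → ℝ := fun θ j i =>
    Real.sin θ * Real.cos θ * (C' (t j) (t i) - C (t j) (t i))
  have hκ : ∀ θ j i, |κ θ j i| ≤ δ := fun θ j i => by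
    show |Real.sin θ * Real.cos θ * _| ≤ _
    rw [abs_mul, abs_mul]
    calc _ ≤ 1 * 1 * δ := by
          gcongr
          · exact Real.abs_sin_le_one θ
          · exact Real.abs_cos_le_one θ
          · rw [abs_sub_comm]; exact hδ j i
      _ = δ := by ring
  have hsq : ∀ θ y, W θ y ^ 2 * |F₂ (W θ y)| ≤ c * B := fun θ y =>
    (hB₂ _ (hW0 _ _)).trans (mul_le_mul_of_nonneg_left ((le_abs_self _).trans (hB _ (hW0 _ _))) hc)
  have hibp : ∀ θ i, ∫ ω, Y' θ ω i * (F₁ (W θ (Y θ ω)) * w θ (Y θ ω) i) ∂Q =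
      ∫ ω, (F₂ (W θ (Y θ ω)) * (∑ j, w θ (Y θ ω) j * κ θ j i) * w θ (Y θ ω) i +
        F₁ (W θ (Y θ ω)) * (w θ (Y θ ω) i * κ θ i i)) ∂Q := by
    intro θ i
    have hcov : ∀ j, Real.cos θ * -Real.sin θ * C (t j) (t i) +
        Real.sin θ * Real.cos θ * C' (t j) (t i) = κ θ j i := fun j => by
      simp only [κ]; ring
    have hb1 : ∀ y, |F₂ (W θ y) * (∑ j, w θ y j * κ θ j i) * w θ y i| ≤ c * B * δ := fun y => by
      have : |∑ j, w θ y j * κ θ j i| ≤ W θ y * δ := by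
        refine (Finset.abs_sum_le_sum_abs _ _).trans ?_
        simp only [W]
        rw [Finset.sum_mul]
        refine Finset.sum_le_sum fun j _ => ?_
        rw [abs_mul, abs_of_nonneg (hw0 _ _ _)]
        exact mul_le_mul_of_nonneg_left (hκ _ _ _) (hw0 _ _ _)
      rw [abs_mul, abs_mul, abs_of_nonneg (hw0 _ _ _)]
      calc _ ≤ |F₂ (W θ y)| * (W θ y * δ) * W θ y := by
            gcongr
            · exact hw0 _ _ _
            · exact mul_nonneg (abs_nonneg _) (mul_nonneg (hW0 _ _) hδ0)
            · exact hwW _ _ _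
        _ = W θ y ^ 2 * |F₂ (W θ y)| * δ := by ring
        _ ≤ _ := mul_le_mul_of_nonneg_right (hsq θ y) hδ0
    have hb0 : ∀ y, |F₁ (W θ y) * w θ y i| ≤ B := fun y => by
      rw [abs_mul, abs_of_nonneg (hw0 _ _ _)]
      calc _ ≤ |F₁ (W θ y)| * W θ y := by gcongr; exact hwW _ _ _
        _ ≤ B := by rw [mul_comm]; exact hB₁ _ (hW0 _ _)
    have hb2 : ∀ y, |F₁ (W θ y) * (w θ y i * κ θ i i)| ≤ B * δ := fun y => by
      rw [← mul_assoc, abs_mul]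
      exact mul_le_mul (hb0 y) (hκ _ _ _) (abs_nonneg _) hB0
    have := hY.integral_mul_eq (fun j => (Real.cos θ, Real.sin θ, t j))
      (-Real.sin θ, Real.cos θ, t i)
      (G := fun y => F₁ (W θ y) * w θ y i)
      (G' := fun y => F₂ (W θ y) * (∑ j, w θ y j * κ θ j i) * w θ y i +
        F₁ (W θ y) * (w θ y i * κ θ i i))
      (B := B + c * B * δ + B * δ)
      ((hF₁.comp (hWm θ)).mul (hwm θ i))
      ((((hF₂.comp (hWm θ)).mul (Finset.measurable_fun_sum _ fun j _ =>
        (hwm θ j).mul_const _)).mul (hwm θ i)).add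
        ((hF₁.comp (hWm θ)).mul ((hwm θ i).mul_const _)))
      (fun y => by
        have := hb0 y
        have h3 : 0 ≤ c * B * δ := by positivity
        have h4 : 0 ≤ B * δ := by positivity
        linarith)
      (fun y => by
        refine (abs_add_le _ _).trans ?_
        linarith [hb1 y, hb2 y])
      (fun y s => by
        simp only [hcov]
        have hwd : ∀ j, HasDerivAt (fun s => w θ (fun i' => y i' + s * κ θ i' i) j)
            (w θ (fun i' => y i' + s * κ θ i' i) j * κ θ j i) s := fun j =>
          HasDerivAt.congr_deriv (((((hasDerivAt_id' s).mul_const (κ θ j i)).const_add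
            (y j)).sub_const _).exp.const_mul (p j)) (by simp only [w]; ring)
        have hWd := HasDerivAt.fun_sum (u := Finset.univ) fun j _ => hwd j
        exact ((hd₂ _ (hW0 _ _)).comp s hWd).fun_mul (hwd i))
    exact this
  have hI1 : ∀ θ i, Integrable (fun ω => F₁ (W θ (Y θ ω)) * (w θ (Y θ ω) i *
      (Y' θ ω i - v' θ i))) Q := fun θ i =>
    (hlin.const_mul B).mono' ((hF₁.comp ((hWm θ).comp (hYm θ))).mul
      (((hwm θ i).comp (hYm θ)).mul ((hY'm θ i).sub_const _))).aestronglyMeasurable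
      (ae_of_all _ fun ω => hterm θ ω i)
  have hI2 : ∀ θ i, Integrable (fun ω => F₁ (W θ (Y θ ω)) * w θ (Y θ ω) i) Q := fun θ i =>
    (integrable_const B).mono' ((hF₁.comp ((hWm θ).comp (hYm θ))).mul
      ((hwm θ i).comp (hYm θ))).aestronglyMeasurable
      (ae_of_all _ fun ω => by
        rw [Real.norm_eq_abs, abs_mul, abs_of_nonneg (hw0 _ _ _)]
        calc _ ≤ |F₁ (W θ (Y θ ω))| * W θ (Y θ ω) := by gcongr; exact hwW _ _ _
          _ ≤ B := by rw [mul_comm]; exact hB₁ _ (hW0 _ _))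
  have hI3 : ∀ θ i, Integrable (fun ω => F₂ (W θ (Y θ ω)) * (∑ j, w θ (Y θ ω) j * κ θ j i) *
      w θ (Y θ ω) i) Q := fun θ i =>
    (integrable_const (c * B * δ)).mono' (((hF₂.comp ((hWm θ).comp (hYm θ))).mul
      (Finset.measurable_fun_sum _ fun j _ => ((hwm θ j).comp (hYm θ)).mul_const _)).mul
      ((hwm θ i).comp (hYm θ))).aestronglyMeasurable
      (ae_of_all _ fun ω => by
        have : |∑ j, w θ (Y θ ω) j * κ θ j i| ≤ W θ (Y θ ω) * δ := by
          refine (Finset.abs_sum_le_sum_abs _ _).trans ?_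
          simp only [W]
          rw [Finset.sum_mul]
          refine Finset.sum_le_sum fun j _ => ?_
          rw [abs_mul, abs_of_nonneg (hw0 _ _ _)]
          exact mul_le_mul_of_nonneg_left (hκ _ _ _) (hw0 _ _ _)
        rw [Real.norm_eq_abs, abs_mul, abs_mul, abs_of_nonneg (hw0 _ _ _)]
        calc _ ≤ |F₂ (W θ (Y θ ω))| * (W θ (Y θ ω) * δ) * W θ (Y θ ω) := by
              gcongr
              · exact hw0 _ _ _
              · exact mul_nonneg (abs_nonneg _) (mul_nonneg (hW0 _ _) hδ0)
              · exact hwW _ _ _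
          _ = W θ (Y θ ω) ^ 2 * |F₂ (W θ (Y θ ω))| * δ := by ring
          _ ≤ _ := mul_le_mul_of_nonneg_right (hsq θ _) hδ0)
  have hval : ∀ θ, ∫ ω, dF θ ω ∂Q = ∫ ω, F₂ (W θ (Y θ ω)) *
      ∑ i, (∑ j, w θ (Y θ ω) j * κ θ j i) * w θ (Y θ ω) i ∂Q := by
    intro θ
    have hs : ∀ ω, dF θ ω = ∑ i, F₁ (W θ (Y θ ω)) * (w θ (Y θ ω) i * (Y' θ ω i - v' θ i)) :=
      fun ω => Finset.mul_sum _ _ _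
    simp only [hs]
    rw [integral_finsetSum _ fun i _ => hI1 θ i]
    have e : ∀ i, ∫ ω, F₁ (W θ (Y θ ω)) * (w θ (Y θ ω) i * (Y' θ ω i - v' θ i)) ∂Q =
        ∫ ω, F₂ (W θ (Y θ ω)) * (∑ j, w θ (Y θ ω) j * κ θ j i) * w θ (Y θ ω) i ∂Q := by
      intro i
      have hI4 : Integrable (fun ω => Y' θ ω i * (F₁ (W θ (Y θ ω)) * w θ (Y θ ω) i)) Q := by
        have := (hI1 θ i).add ((hI2 θ i).mul_const (v' θ i))
        refine this.congr (ae_of_all _ fun ω => ?_)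
        simp only [Pi.add_apply]; ring
      have e1 : ∫ ω, F₁ (W θ (Y θ ω)) * (w θ (Y θ ω) i * (Y' θ ω i - v' θ i)) ∂Q =
          ∫ ω, Y' θ ω i * (F₁ (W θ (Y θ ω)) * w θ (Y θ ω) i) ∂Q -
            ∫ ω, F₁ (W θ (Y θ ω)) * w θ (Y θ ω) i * v' θ i ∂Q := by
        rw [← integral_sub hI4 ((hI2 θ i).mul_const _)]
        refine integral_congr_ae (ae_of_all _ fun ω => ?_)
        simp only []; ring
      rw [e1, hibp, integral_add (hI3 θ i)
        (by simpa only [mul_assoc] using (hI2 θ i).mul_const (κ θ i i))]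
      simp only [← mul_assoc]
      simp only [κ, v', hK, hK', add_sub_cancel_right]
    simp only [e]
    rw [← integral_finsetSum _ fun i _ => hI3 θ i]
    refine integral_congr_ae (ae_of_all _ fun ω => ?_)
    beta_reduce
    rw [Finset.mul_sum]
    exact Finset.sum_congr rfl fun _ _ => mul_assoc _ _ _
  have hφb : ∀ θ, |∫ ω, dF θ ω ∂Q| ≤ c * δ * φ θ := by
    intro θ
    rw [hval, ← Real.norm_eq_abs, hφ, ← integral_const_mul]
    refine norm_integral_le_of_norm_le ((hFi θ).const_mul _) (ae_of_all _ fun ω => ?_)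
    have : |∑ i, (∑ j, w θ (Y θ ω) j * κ θ j i) * w θ (Y θ ω) i| ≤
        W θ (Y θ ω) * δ * W θ (Y θ ω) := by
      refine (Finset.abs_sum_le_sum_abs _ _).trans ?_
      conv_rhs => rw [show W θ (Y θ ω) * δ * W θ (Y θ ω) =
        ∑ i, W θ (Y θ ω) * δ * w θ (Y θ ω) i by rw [← Finset.mul_sum]]
      refine Finset.sum_le_sum fun i _ => ?_
      rw [abs_mul, abs_of_nonneg (hw0 _ _ _)]
      refine mul_le_mul_of_nonneg_right ?_ (hw0 _ _ _)
      refine (Finset.abs_sum_le_sum_abs _ _).trans ?_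
      simp only [W]
      rw [Finset.sum_mul]
      refine Finset.sum_le_sum fun j _ => ?_
      rw [abs_mul, abs_of_nonneg (hw0 _ _ _)]
      exact mul_le_mul_of_nonneg_left (hκ _ _ _) (hw0 _ _ _)
    rw [Real.norm_eq_abs, abs_mul]
    calc _ ≤ |F₂ (W θ (Y θ ω))| * (W θ (Y θ ω) * δ * W θ (Y θ ω)) := by gcongr
      _ = W θ (Y θ ω) ^ 2 * |F₂ (W θ (Y θ ω))| * δ := by ring
      _ ≤ c * F (W θ (Y θ ω)) * δ := mul_le_mul_of_nonneg_right (hB₂ _ (hW0 _ _)) hδ0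
      _ = _ := by ring
  have hψ : ∀ θ, HasDerivAt (fun θ => Real.exp (c * δ * θ) * φ θ)
      (Real.exp (c * δ * θ) * (c * δ * φ θ + ∫ ω, dF θ ω ∂Q)) θ := fun θ =>
    HasDerivAt.congr_deriv ((((hasDerivAt_id' θ).const_mul (c * δ)).exp).fun_mul (hφ' θ)) (by ring)
  have hmono : Monotone fun θ => Real.exp (c * δ * θ) * φ θ :=
    monotone_of_deriv_nonneg (fun θ => (hψ θ).differentiableAt) fun θ => by
      rw [(hψ θ).deriv]
      have := neg_abs_le (∫ ω, dF θ ω ∂Q)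
      exact mul_nonneg (Real.exp_pos _).le (by linarith [hφb θ])
  have key := hmono (show (0 : ℝ) ≤ Real.pi / 2 by positivity)
  have z0 : φ 0 = ∫ ω, F (∑ i, p i * Real.exp (Z (t i) ω - K i / 2)) ∂P := by
    simp only [hφ, W, w, Y, Real.cos_zero, Real.sin_zero, one_mul, zero_mul, add_zero]
    exact (integral_fun_fst (μ := P) (ν := P')
      fun ω => F (∑ i, p i * Real.exp (Z (t i) ω - K i / 2))).trans (by simp)
  have z1 : φ (Real.pi / 2) = ∫ ω, F (∑ i, p i * Real.exp (Z' (t i) ω - K' i / 2)) ∂P' := by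
    simp only [hφ, W, w, Y, Real.cos_pi_div_two, Real.sin_pi_div_two, one_mul, zero_mul, zero_add]
    exact (integral_fun_snd (μ := P) (ν := P')
      fun ω => F (∑ i, p i * Real.exp (Z' (t i) ω - K' i / 2))).trans (by simp)
  simpa [z0, z1] using key

end IsGaussField

lemma rpow_one_add_of_pos {x : ℝ} (hx : 0 < x) (y : ℝ) : x ^ (1 + y) = x * x ^ y := by
  rw [Real.rpow_add hx, Real.rpow_one]

lemma ennreal_rpow_le_rpow_of_nonpos {x y : ℝ≥0∞} {q : ℝ} (hq : q ≤ 0) (h : x ≤ y) :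
    y ^ q ≤ x ^ q := by
  obtain ⟨p, rfl⟩ : ∃ p, q = -p := ⟨-q, by simp⟩
  rw [ENNReal.rpow_neg, ENNReal.rpow_neg]
  exact ENNReal.inv_le_inv.2 (ENNReal.rpow_le_rpow h (by linarith))

/-- A Lipschitz truncation of the identity of `[0, ∞)` to a compact subset of `(0, ∞)`. -/
def squeeze (a w : ℝ) : ℝ := (w + a) / (1 + a * w)

/-- The smooth bounded regularization `squeeze a w ^ q` of `w ^ q`. -/
def reg (a q w : ℝ) : ℝ := squeeze a w ^ q

section Reg

variable {a q w : ℝ}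

lemma squeeze_pos (ha : 0 < a) (hw : 0 ≤ w) : 0 < squeeze a w := by
  unfold squeeze; positivity

lemma le_squeeze (ha : 0 < a) (ha1 : a < 1) (hw : 0 ≤ w) : a ≤ squeeze a w := by
  unfold squeeze
  rw [le_div_iff₀ (by positivity)]
  nlinarith [mul_nonneg hw (by nlinarith : 0 ≤ 1 - a ^ 2)]

lemma squeeze_le (ha : 0 < a) (ha1 : a < 1) (hw : 0 ≤ w) : squeeze a w ≤ a⁻¹ := by
  unfold squeeze
  rw [div_le_iff₀ (by positivity), mul_add, inv_mul_cancel_left₀ ha.ne', mul_one, add_comm]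
  have : 1 ≤ a⁻¹ := (one_le_inv₀ ha).mpr ha1.le
  linarith

lemma hasDerivAt_squeeze (ha : 0 < a) (hw : 0 ≤ w) :
    HasDerivAt (squeeze a) ((1 - a ^ 2) / (1 + a * w) ^ 2) w := by
  have h : 1 + a * w ≠ 0 := by positivity
  refine HasDerivAt.congr_deriv (((hasDerivAt_id' w).add_const a).fun_div
    (((hasDerivAt_id' w).const_mul a).const_add 1) h) ?_
  field_simp; ring

/-- The derivative of `reg`. -/
def regDeriv (a q w : ℝ) : ℝ := (1 - a ^ 2) / (1 + a * w) ^ 2 * q * squeeze a w ^ (q - 1)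

/-- The second derivative of `reg`. -/
def regDeriv₂ (a q w : ℝ) : ℝ :=
  -(2 * a * (1 - a ^ 2)) / (1 + a * w) ^ 3 * q * squeeze a w ^ (q - 1) +
    (1 - a ^ 2) / (1 + a * w) ^ 2 * q *
      ((1 - a ^ 2) / (1 + a * w) ^ 2 * (q - 1) * squeeze a w ^ (q - 2))

lemma measurable_squeeze : Measurable (squeeze a) := by unfold squeeze; fun_prop

lemma measurable_reg : Measurable (reg a q) := measurable_squeeze.pow_const q

lemma measurable_regDeriv : Measurable (regDeriv a q) := by
  have := measurable_squeeze (a := a); unfold regDeriv; fun_prop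

lemma measurable_regDeriv₂ : Measurable (regDeriv₂ a q) := by
  have := measurable_squeeze (a := a); unfold regDeriv₂; fun_prop

lemma hasDerivAt_reg (ha : 0 < a) (hw : 0 ≤ w) : HasDerivAt (reg a q) (regDeriv a q w) w :=
  (hasDerivAt_squeeze ha hw).rpow_const (Or.inl (squeeze_pos ha hw).ne')

lemma hasDerivAt_regDeriv (ha : 0 < a) (hw : 0 ≤ w) :
    HasDerivAt (regDeriv a q) (regDeriv₂ a q w) w := by
  have h : 1 + a * w ≠ 0 := by positivity
  have h1 : HasDerivAt (fun w => (1 - a ^ 2) / (1 + a * w) ^ 2)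
      (-(2 * a * (1 - a ^ 2)) / (1 + a * w) ^ 3) w := by
    refine HasDerivAt.congr_deriv ((hasDerivAt_const w (1 - a ^ 2)).fun_div
      ((((hasDerivAt_id' w).const_mul a).const_add 1).fun_pow 2) (pow_ne_zero 2 h)) ?_
    field_simp; norm_num; ring
  have h2 := (hasDerivAt_squeeze ha hw).rpow_const (p := q - 1) (Or.inl (squeeze_pos ha hw).ne')
  refine HasDerivAt.congr_deriv ((h1.mul_const q).fun_mul h2) ?_
  rw [show q - 1 - 1 = q - 2 by ring]; rfl

lemma reg_pos (ha : 0 < a) (hw : 0 ≤ w) : 0 < reg a q w :=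
  Real.rpow_pos_of_pos (squeeze_pos ha hw) q

lemma abs_reg_le (ha : 0 < a) (ha1 : a < 1) (hw : 0 ≤ w) : |reg a q w| ≤ a⁻¹ ^ |q| := by
  rw [abs_of_pos (reg_pos ha hw)]
  rcases le_total 0 q with hq | hq
  · rw [abs_of_nonneg hq]
    exact Real.rpow_le_rpow (squeeze_pos ha hw).le (squeeze_le ha ha1 hw) hq
  · rw [abs_of_nonpos hq, Real.inv_rpow ha.le, Real.rpow_neg ha.le, inv_inv]
    exact Real.rpow_le_rpow_of_nonpos ha (le_squeeze ha ha1 hw) hq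

/-- The logarithmic derivative of `squeeze` is at most `1 / w`. -/
lemma log_deriv_squeeze_le (ha : 0 < a) (ha1 : a < 1) (hw : 0 ≤ w) :
    0 ≤ w * ((1 - a ^ 2) / (1 + a * w) ^ 2) ∧
      w * ((1 - a ^ 2) / (1 + a * w) ^ 2) ≤ squeeze a w := by
  have h1 : 0 ≤ 1 - a ^ 2 := by nlinarith
  refine ⟨by positivity, ?_⟩
  unfold squeeze
  rw [mul_div_assoc', div_le_div_iff₀ (by positivity) (by positivity)]
  have : w * (1 - a ^ 2) ≤ (w + a) * (1 + a * w) := by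
    nlinarith [mul_nonneg hw (sq_nonneg a), mul_nonneg hw hw,
      mul_nonneg ha.le (mul_nonneg hw hw)]
  have h3 : 0 ≤ 1 + a * w := by positivity
  calc _ ≤ (w + a) * (1 + a * w) * (1 + a * w) := mul_le_mul_of_nonneg_right this h3
    _ = _ := by ring

lemma mul_abs_regDeriv_le (ha : 0 < a) (ha1 : a < 1) (hw : 0 ≤ w) :
    w * |regDeriv a q w| ≤ |q| * reg a q w := by
  obtain ⟨h1, h2⟩ := log_deriv_squeeze_le ha ha1 hw
  have hs := squeeze_pos ha hw
  have hp : 0 ≤ squeeze a w ^ (q - 1) := (Real.rpow_pos_of_pos hs _).le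
  have e : reg a q w = squeeze a w * squeeze a w ^ (q - 1) := by
    rw [reg, ← rpow_one_add_of_pos hs, add_sub_cancel]
  unfold regDeriv
  rw [abs_mul, abs_mul, abs_of_nonneg hp, abs_of_nonneg (div_nonneg (by nlinarith) (sq_nonneg _)),
    e]
  calc _ = (w * ((1 - a ^ 2) / (1 + a * w) ^ 2)) * |q| * squeeze a w ^ (q - 1) := by ring
    _ ≤ squeeze a w * |q| * squeeze a w ^ (q - 1) := by gcongr
    _ = _ := by ring

lemma sq_mul_abs_regDeriv₂_le (ha : 0 < a) (ha1 : a < 1) (hw : 0 ≤ w) :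
    w ^ 2 * |regDeriv₂ a q w| ≤ (q ^ 2 + 3 * |q|) * reg a q w := by
  obtain ⟨h1, h2⟩ := log_deriv_squeeze_le ha ha1 hw
  have hs := squeeze_pos ha hw
  set D := (1 - a ^ 2) / (1 + a * w) ^ 2 with hD
  have hD0 : 0 ≤ D := div_nonneg (by nlinarith) (sq_nonneg _)
  have hp : 0 < squeeze a w ^ (q - 2) := Real.rpow_pos_of_pos hs _
  have e1 : squeeze a w ^ (q - 1) = squeeze a w * squeeze a w ^ (q - 2) := by
    rw [← rpow_one_add_of_pos hs, show 1 + (q - 2) = q - 1 by ring]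
  have e : reg a q w = squeeze a w * (squeeze a w * squeeze a w ^ (q - 2)) := by
    rw [← e1, ← rpow_one_add_of_pos hs, add_sub_cancel, reg]
  have hr : 0 ≤ a * w / (1 + a * w) ∧ a * w / (1 + a * w) ≤ 1 :=
    ⟨by positivity, by rw [div_le_one (by positivity)]; linarith⟩
  have e3 : -(2 * a * (1 - a ^ 2)) / (1 + a * w) ^ 3 * w = -(2 * D * (a * w / (1 + a * w))) := by
    rw [hD]
    have : 1 + a * w ≠ 0 := by positivity
    field_simp
  have hq1 : |q - 1| ≤ |q| + 1 := by simpa using abs_sub q 1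
  have e4 : w ^ 2 * regDeriv₂ a q w = squeeze a w ^ (q - 2) *
      (-(2 * (w * D) * (a * w / (1 + a * w))) * q * squeeze a w + (w * D) ^ 2 * (q * (q - 1))) := by
    rw [regDeriv₂, e1, ← hD]
    linear_combination w * q * squeeze a w * squeeze a w ^ (q - 2) * e3
  rw [← abs_of_nonneg (sq_nonneg w), ← abs_mul, e4, abs_mul,
    abs_of_pos hp, e]
  have hx : |-(2 * (w * D) * (a * w / (1 + a * w))) * q * squeeze a w| ≤
      2 * squeeze a w * 1 * |q| * squeeze a w := by
    rw [abs_mul, abs_mul, abs_neg, abs_of_pos hs, abs_of_nonneg (mul_nonneg (by positivity) hr.1)]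
    gcongr
    exact hr.2
  have hy : |(w * D) ^ 2 * (q * (q - 1))| ≤ squeeze a w ^ 2 * (|q| * (|q| + 1)) := by
    rw [abs_mul, abs_mul, abs_of_nonneg (sq_nonneg _)]
    gcongr
  calc _ ≤ squeeze a w ^ (q - 2) * (2 * squeeze a w * 1 * |q| * squeeze a w +
        squeeze a w ^ 2 * (|q| * (|q| + 1))) := by
        gcongr
        exact (abs_add_le _ _).trans (add_le_add hx hy)
    _ = (|q| ^ 2 + 3 * |q|) * (squeeze a w * (squeeze a w * squeeze a w ^ (q - 2))) := by ring
    _ = _ := by rw [sq_abs]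

lemma ofReal_reg (ha : 0 < a) (hw : 0 ≤ w) :
    ENNReal.ofReal (reg a q w) = ENNReal.ofReal (squeeze a w) ^ q :=
  (ENNReal.ofReal_rpow_of_pos (squeeze_pos ha hw)).symm

lemma ofReal_reg_le (ha : 0 < a) (ha1 : a < 1) (hw : 0 ≤ w) :
    ENNReal.ofReal (reg a q w) ≤ 1 + ENNReal.ofReal w ^ q := by
  rw [ofReal_reg ha hw]
  have hpos : 0 < 1 + a * w := by positivity
  have key : (squeeze a w ≤ 1 ∧ w ≤ squeeze a w) ∨ (1 ≤ squeeze a w ∧ squeeze a w ≤ w) := by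
    unfold squeeze
    rw [div_le_one hpos, one_le_div hpos, le_div_iff₀ hpos, div_le_iff₀ hpos]
    rcases le_total w 1 with h | h
    · left; constructor <;> nlinarith [mul_nonneg ha.le (mul_nonneg hw (sub_nonneg.2 h)),
        mul_nonneg (sub_nonneg.2 ha1.le) (sub_nonneg.2 h)]
    · right; constructor <;> nlinarith [mul_nonneg ha.le (mul_nonneg hw (sub_nonneg.2 h)),
        mul_nonneg (sub_nonneg.2 ha1.le) (sub_nonneg.2 h)]
  rcases le_total 0 q with hq | hq <;> rcases key with ⟨h1, h2⟩ | ⟨h1, h2⟩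
  · exact (ENNReal.rpow_le_one (by simpa using h1) hq).trans le_self_add
  · exact (ENNReal.rpow_le_rpow (ENNReal.ofReal_le_ofReal h2) hq).trans le_add_self
  · exact (ennreal_rpow_le_rpow_of_nonpos hq (ENNReal.ofReal_le_ofReal h2)).trans le_add_self
  · refine le_trans ?_ (le_self_add (a := 1))
    simpa using ennreal_rpow_le_rpow_of_nonpos hq (ENNReal.ofReal_le_ofReal h1)

lemma tendsto_ofReal_reg (hw : 0 ≤ w) :
    Tendsto (fun a => ENNReal.ofReal (reg a q w)) (𝓝[>] 0) (𝓝 (ENNReal.ofReal w ^ q)) := by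
  have h1 : Tendsto (fun a => squeeze a w) (𝓝[>] 0) (𝓝 w) := by
    have : ContinuousAt (fun a => squeeze a w) 0 := by
      unfold squeeze
      exact ContinuousAt.div (by fun_prop) (by fun_prop) (by simp)
    have h0 : squeeze 0 w = w := by simp [squeeze]
    exact (h0 ▸ this.tendsto).mono_left nhdsWithin_le_nhds
  refine ((ENNReal.continuous_rpow_const.tendsto _).comp
    ((ENNReal.continuous_ofReal.tendsto _).comp h1)).congr' ?_
  filter_upwards [self_mem_nhdsWithin] with a ha
  exact (ofReal_reg ha hw).symm

lemma squeeze_le_mul {w' η : ℝ} (ha : 0 < a) (hw : 0 ≤ w) (hw' : 0 ≤ w') (ha1 : a < 1)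
    (hη : 1 ≤ η) (h : w' ≤ η * w) : squeeze a w' ≤ η * squeeze a w := by
  unfold squeeze
  rw [mul_div_assoc', div_le_div_iff₀ (by positivity) (by positivity)]
  have h0 : 0 < 1 - a ^ 2 := by nlinarith
  have h1 : a ≤ η * a := le_mul_of_one_le_left ha.le hη
  have h2 : w * w' ≤ η * (w * w') := le_mul_of_one_le_left (by positivity) hη
  have h3 : a ^ 2 * w' ≤ a ^ 2 * w' * η := le_mul_of_one_le_right (by positivity) hη
  have h4 : a ^ 2 * w ≤ a ^ 2 * w * η := le_mul_of_one_le_right (by positivity) hη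
  have h5 := mul_nonneg (sub_nonneg.2 h) h0.le
  have h6 : 0 ≤ a * (η * (w * w') - w * w') := by
    apply mul_nonneg ha.le; linarith
  nlinarith [mul_nonneg (sub_nonneg.2 hη) (mul_nonneg (sq_nonneg a)
    (mul_nonneg hw (by linarith : 0 ≤ 1 + η)))]

lemma reg_le_mul {w' η : ℝ} (ha : 0 < a) (ha1 : a < 1) (hw : 0 ≤ w) (hw' : 0 ≤ w')
    (hη : 1 ≤ η) (h : w' ≤ η * w) (h' : w ≤ η * w') : reg a q w' ≤ η ^ |q| * reg a q w := by
  have hs := squeeze_pos ha hw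
  have hs' := squeeze_pos ha hw'
  have hη0 : 0 < η := by linarith
  unfold reg
  rcases le_total 0 q with hq | hq
  · rw [abs_of_nonneg hq, ← Real.mul_rpow hη0.le hs.le]
    exact Real.rpow_le_rpow hs'.le (squeeze_le_mul ha hw hw' ha1 hη h) hq
  · have := squeeze_le_mul ha hw' hw ha1 hη h'
    rw [abs_of_nonpos hq, Real.rpow_neg hη0.le, ← Real.inv_rpow hη0.le,
      ← Real.mul_rpow (inv_pos.2 hη0).le hs.le]
    refine Real.rpow_le_rpow_of_nonpos (by positivity) ?_ hq
    rwa [inv_mul_le_iff₀ hη0]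

end Reg

section MonteCarlo

variable {T Ω Ω' : Type*} [MeasurableSpace T] [MeasurableSpace Ω] [MeasurableSpace Ω']

/-- Monte Carlo approximation of a random integral by empirical averages. -/
lemma tendsto_integral_average (μ : Measure T) [IsProbabilityMeasure μ] (P : Measure Ω)
    [IsProbabilityMeasure P] {w : T → Ω → ℝ} (hw : Measurable (Function.uncurry w))
    (hw0 : ∀ t ω, 0 ≤ w t ω) (hwi : ∀ᵐ ω ∂P, Integrable (fun t => w t ω) μ) {F : ℝ → ℝ}
    (hF : Measurable F) (hFc : ∀ x, 0 ≤ x → ContinuousAt F x) {B : ℝ}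
    (hB : ∀ x, 0 ≤ x → |F x| ≤ B) :
    Tendsto (fun n : ℕ => ∫ U, ∫ ω, F ((∑ i ∈ Finset.range n, w (U i) ω) / n) ∂P
      ∂(Measure.infinitePi fun _ : ℕ => μ)) atTop (𝓝 (∫ ω, F (∫ t, w t ω ∂μ) ∂P)) := by
  set Q := Measure.infinitePi fun _ : ℕ => μ
  have hB0 : 0 ≤ B := (abs_nonneg _).trans (hB 0 le_rfl)
  have hm : ∀ n : ℕ, Measurable fun p : (ℕ → T) × Ω =>
      F ((∑ i ∈ Finset.range n, w (p.1 i) p.2) / n) := fun n => by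
    refine hF.comp (Measurable.div_const (Finset.measurable_fun_sum _ fun i _ => ?_) _)
    exact hw.comp (by fun_prop : Measurable fun p : (ℕ → T) × Ω => (p.1 i, p.2))
  have hpos : ∀ (n : ℕ) (U : ℕ → T) ω, 0 ≤ (∑ i ∈ Finset.range n, w (U i) ω) / n := fun n U ω =>
    div_nonneg (Finset.sum_nonneg fun i _ => hw0 _ _) n.cast_nonneg
  have hswap : ∀ n : ℕ, ∫ U, ∫ ω, F ((∑ i ∈ Finset.range n, w (U i) ω) / n) ∂P ∂Q =
      ∫ ω, ∫ U, F ((∑ i ∈ Finset.range n, w (U i) ω) / n) ∂Q ∂P := fun n =>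
    integral_integral_swap ((integrable_const B).mono' (hm n).aestronglyMeasurable
      (ae_of_all _ fun p => hB _ (hpos _ _ _)))
  simp only [hswap]
  refine tendsto_integral_of_dominated_convergence (fun _ => B) (fun n => ?_)
    (integrable_const B) (fun n => ae_of_all _ fun ω => ?_) ?_
  · exact ((hm n).comp measurable_swap).stronglyMeasurable.integral_prod_right'.aestronglyMeasurable
  · refine (norm_integral_le_of_norm_le_const (μ := Q) (C := B)
      (ae_of_all _ fun U => hB _ (hpos _ _ _))).trans ?_
    simp
  · filter_upwards [hwi] with ω hω
    have hwm : Measurable fun t => w t ω := hw.comp measurable_prodMk_right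
    have hslln := strong_law_ae_real (μ := Q) (fun i U => w (U i) ω)
      ((measurePreserving_eval_infinitePi (fun _ : ℕ => μ) 0).integrable_comp_of_integrable hω)
      (fun i j hij => (iIndepFun_infinitePi (P := fun _ : ℕ => μ)
        (X := fun _ t => w t ω) fun _ => hwm).indepFun hij)
      (fun i => by
        refine ⟨(hwm.comp (measurable_pi_apply i)).aemeasurable,
          (hwm.comp (measurable_pi_apply 0)).aemeasurable, ?_⟩
        rw [show (fun U : ℕ → T => w (U i) ω) = (fun t => w t ω) ∘ Function.eval i from rfl,
          show (fun U : ℕ → T => w (U 0) ω) = (fun t => w t ω) ∘ Function.eval 0 from rfl,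
          ← Measure.map_map hwm (measurable_pi_apply i), ← Measure.map_map hwm
            (measurable_pi_apply 0), (measurePreserving_eval_infinitePi (fun _ : ℕ => μ) i).map_eq,
          (measurePreserving_eval_infinitePi (fun _ : ℕ => μ) 0).map_eq])
    have hmean : ∫ U, w (U 0) ω ∂Q = ∫ t, w t ω ∂μ := by
      have h := (measurePreserving_eval_infinitePi (fun _ : ℕ => μ) 0).map_eq
      calc _ = ∫ t, w t ω ∂(Q.map (Function.eval 0)) :=
            (integral_map (μ := Q) (φ := fun U : ℕ → T => U 0) (f := fun t => w t ω)
              (measurable_pi_apply 0).aemeasurable hwm.aestronglyMeasurable).symm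
        _ = _ := by rw [h]
    have h0 : 0 ≤ ∫ t, w t ω ∂μ := integral_nonneg fun t => hw0 t ω
    have key : Tendsto (fun n : ℕ => ∫ U, F ((∑ i ∈ Finset.range n, w (U i) ω) / n) ∂Q) atTop
        (𝓝 (∫ _, F (∫ t, w t ω ∂μ) ∂Q)) := by
      refine tendsto_integral_of_dominated_convergence (fun _ => B) (fun n => ?_)
        (integrable_const B) (fun n => ae_of_all _ fun U => hB _ (hpos _ _ _)) ?_
      · exact ((hm n).comp measurable_prodMk_right).aestronglyMeasurable
      · filter_upwards [hslln] with U hU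
        rw [hmean] at hU
        exact (hFc _ h0).tendsto.comp hU
    simpa using key

/-- Passing from the regularized powers to the powers. -/
lemma lintegral_rpow_le_of_reg {P : Measure Ω} {P' : Measure Ω'} [IsFiniteMeasure P']
    {x : Ω → ℝ≥0∞} {y : Ω' → ℝ≥0∞} (hx : Measurable x) (hy : Measurable y)
    (hx' : ∀ᵐ ω ∂P, x ω ≠ ⊤) (hy' : ∀ᵐ ω ∂P', y ω ≠ ⊤) {K : ℝ≥0∞} (hK0 : K ≠ 0) (hK : K ≠ ⊤) {q : ℝ}
    (h : ∀ a ∈ Set.Ioo (0 : ℝ) 1, ∫⁻ ω, ENNReal.ofReal (reg a q (x ω).toReal) ∂P ≤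
      K * ∫⁻ ω, ENNReal.ofReal (reg a q (y ω).toReal) ∂P') :
    ∫⁻ ω, x ω ^ q ∂P ≤ K * ∫⁻ ω, y ω ^ q ∂P' := by
  by_cases hfin : ∫⁻ ω, y ω ^ q ∂P' = ⊤
  · rw [hfin, ENNReal.mul_top hK0]; exact le_top
  set u : ℕ → ℝ := fun n => 1 / ((n : ℝ) + 2) with hu
  have hu0 : ∀ n, u n ∈ Set.Ioo (0 : ℝ) 1 := fun n => by
    have : (0 : ℝ) ≤ n := n.cast_nonneg
    constructor
    · simp only [hu]; positivity
    · simp only [hu]; rw [div_lt_one (by positivity)]; linarith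
  have hulim : Tendsto u atTop (𝓝[>] 0) := by
    refine tendsto_nhdsWithin_iff.2 ⟨?_, Eventually.of_forall fun n => (hu0 n).1⟩
    have := (tendsto_const_div_atTop_nhds_zero_nat (1 : ℝ)).comp (tendsto_add_atTop_nat 2)
    refine this.congr fun n => ?_
    simp [hu]
  have hlx : ∀ᵐ ω ∂P, Tendsto (fun n => ENNReal.ofReal (reg (u n) q (x ω).toReal)) atTop
      (𝓝 (x ω ^ q)) := by
    filter_upwards [hx'] with ω hω
    have := (tendsto_ofReal_reg (q := q) (x ω).toReal_nonneg).comp hulim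
    rwa [ENNReal.ofReal_toReal hω] at this
  have hly : ∀ᵐ ω ∂P', Tendsto (fun n => ENNReal.ofReal (reg (u n) q (y ω).toReal)) atTop
      (𝓝 (y ω ^ q)) := by
    filter_upwards [hy'] with ω hω
    have := (tendsto_ofReal_reg (q := q) (y ω).toReal_nonneg).comp hulim
    rwa [ENNReal.ofReal_toReal hω] at this
  have hdom : Tendsto (fun n => ∫⁻ ω, ENNReal.ofReal (reg (u n) q (y ω).toReal) ∂P') atTop
      (𝓝 (∫⁻ ω, y ω ^ q ∂P')) := by
    refine tendsto_lintegral_of_dominated_convergence (fun ω => 1 + y ω ^ q)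
      (fun n => (measurable_reg.comp hy.ennreal_toReal).ennreal_ofReal) (fun n => ?_) ?_ hly
    · filter_upwards [hy'] with ω hω
      have := ofReal_reg_le (q := q) (hu0 n).1 (hu0 n).2 (y ω).toReal_nonneg
      rwa [ENNReal.ofReal_toReal hω] at this
    · rw [lintegral_add_left measurable_const]
      exact ENNReal.add_ne_top.2 ⟨by simp, hfin⟩
  calc ∫⁻ ω, x ω ^ q ∂P
      = ∫⁻ ω, liminf (fun n => ENNReal.ofReal (reg (u n) q (x ω).toReal)) atTop ∂P :=
        lintegral_congr_ae (hlx.mono fun ω hω => hω.liminf_eq.symm)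
    _ ≤ liminf (fun n => ∫⁻ ω, ENNReal.ofReal (reg (u n) q (x ω).toReal) ∂P) atTop :=
        lintegral_liminf_le fun n => (measurable_reg.comp hx.ennreal_toReal).ennreal_ofReal
    _ ≤ liminf (fun n => K * ∫⁻ ω, ENNReal.ofReal (reg (u n) q (y ω).toReal) ∂P') atTop :=
        liminf_le_liminf (Eventually.of_forall fun n => h _ (hu0 n))
    _ = _ := (ENNReal.Tendsto.const_mul hdom (Or.inr hK)).liminf_eq

end MonteCarlo

section Mass

variable {T Ω Ω' : Type*} [MeasurableSpace T] [MeasurableSpace Ω] [MeasurableSpace Ω']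

/-- A domination between finite sums of two random weights passes to their integrals. -/
lemma lintegral_reg_le_of_sum (μ : Measure T) [IsFiniteMeasure μ] {P : Measure Ω}
    [IsProbabilityMeasure P] {P' : Measure Ω'} [IsProbabilityMeasure P'] {w : T → Ω → ℝ}
    {w' : T → Ω' → ℝ} (hw : Measurable (Function.uncurry w))
    (hw' : Measurable (Function.uncurry w')) (hw0 : ∀ t ω, 0 ≤ w t ω) (hw0' : ∀ t ω, 0 ≤ w' t ω)
    (hwi : ∀ᵐ ω ∂P, Integrable (fun t => w t ω) μ)
    (hwi' : ∀ᵐ ω ∂P', Integrable (fun t => w' t ω) μ) {S : Set T} (hS : μ Sᶜ = 0) {a q K : ℝ}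
    (ha : 0 < a) (ha1 : a < 1) (hK : 1 ≤ K)
    (h : ∀ (n : ℕ) (U : Fin n → T), (∀ i, U i ∈ S) → ∀ p : ℝ, 0 ≤ p →
      ∫ ω, reg a q (∑ i, p * w (U i) ω) ∂P ≤ K * ∫ ω, reg a q (∑ i, p * w' (U i) ω) ∂P') :
    ∫⁻ ω, ENNReal.ofReal (reg a q (∫⁻ t, ENNReal.ofReal (w t ω) ∂μ).toReal) ∂P ≤
      ENNReal.ofReal K *
        ∫⁻ ω, ENNReal.ofReal (reg a q (∫⁻ t, ENNReal.ofReal (w' t ω) ∂μ).toReal) ∂P' := by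
  have hK0 : 0 ≤ K := by linarith
  rcases eq_or_ne μ 0 with rfl | hμ
  · simp only [lintegral_zero_measure, ENNReal.toReal_zero, lintegral_const, measure_univ, mul_one]
    refine le_mul_of_one_le_left (by positivity) ?_
    rwa [ENNReal.one_le_ofReal]
  have e : ∀ (ω), (∫⁻ t, ENNReal.ofReal (w t ω) ∂μ).toReal = ∫ t, w t ω ∂μ := fun ω =>
    (integral_eq_lintegral_of_nonneg_ae (ae_of_all _ fun t => hw0 t ω)
      (hw.comp measurable_prodMk_right).aestronglyMeasurable).symm
  have e' : ∀ (ω), (∫⁻ t, ENNReal.ofReal (w' t ω) ∂μ).toReal = ∫ t, w' t ω ∂μ := fun ω =>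
    (integral_eq_lintegral_of_nonneg_ae (ae_of_all _ fun t => hw0' t ω)
      (hw'.comp measurable_prodMk_right).aestronglyMeasurable).symm
  have hi0 : ∀ ω, 0 ≤ ∫ t, w t ω ∂μ := fun ω => integral_nonneg fun t => hw0 t ω
  have hi0' : ∀ ω, 0 ≤ ∫ t, w' t ω ∂μ := fun ω => integral_nonneg fun t => hw0' t ω
  have hb : ∀ x, 0 ≤ x → |reg a q x| ≤ a⁻¹ ^ |q| := fun x hx => abs_reg_le ha ha1 hx
  have hc : ∀ x, 0 ≤ x → ContinuousAt (reg a q) x := fun x hx => (hasDerivAt_reg ha hx).continuousAt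
  have hI : Integrable (fun ω => reg a q (∫ t, w t ω ∂μ)) P :=
    (integrable_const (a⁻¹ ^ |q|)).mono' (measurable_reg.comp
      (hw.comp measurable_swap).stronglyMeasurable.integral_prod_right'.measurable
      ).aestronglyMeasurable (ae_of_all _ fun ω => hb _ (hi0 ω))
  have hI' : Integrable (fun ω => reg a q (∫ t, w' t ω ∂μ)) P' :=
    (integrable_const (a⁻¹ ^ |q|)).mono' (measurable_reg.comp
      (hw'.comp measurable_swap).stronglyMeasurable.integral_prod_right'.measurable
      ).aestronglyMeasurable (ae_of_all _ fun ω => hb _ (hi0' ω))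
  simp only [e, e']
  rw [← ofReal_integral_eq_lintegral_ofReal hI (ae_of_all _ fun ω => (reg_pos ha (hi0 ω)).le),
    ← ofReal_integral_eq_lintegral_ofReal hI' (ae_of_all _ fun ω => (reg_pos ha (hi0' ω)).le),
    ← ENNReal.ofReal_mul hK0]
  refine ENNReal.ofReal_le_ofReal ?_
  set m := (μ Set.univ).toReal with hm
  have hm0 : 0 < m := ENNReal.toReal_pos (by simpa using hμ) (measure_ne_top _ _)
  let ν : Measure T := (μ Set.univ)⁻¹ • μ
  have hν : IsProbabilityMeasure ν := by
    have : NeZero μ := ⟨hμ⟩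
    exact isProbabilityMeasureSMul
  have hac : ν ≪ μ := Measure.smul_absolutelyContinuous
  have hνint : ∀ f : T → ℝ, ∫ t, m * f t ∂ν = ∫ t, f t ∂μ := fun f => by
    rw [integral_const_mul, integral_smul_measure, ENNReal.toReal_inv, smul_eq_mul,
      mul_inv_cancel_left₀ hm0.ne']
  have hνi : ∀ f : T → ℝ, Integrable f μ → Integrable (fun t => m * f t) ν := fun f hf =>
    (hf.smul_measure (ENNReal.inv_ne_top.2 (by simpa using hμ))).const_mul m
  have l1 := tendsto_integral_average ν P (w := fun t ω => m * w t ω) (hw.const_mul m)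
    (fun t ω => mul_nonneg hm0.le (hw0 t ω)) (hwi.mono fun ω hω => hνi _ hω)
    (measurable_reg (a := a) (q := q)) hc hb
  have l2 := tendsto_integral_average ν P' (w := fun t ω => m * w' t ω) (hw'.const_mul m)
    (fun t ω => mul_nonneg hm0.le (hw0' t ω)) (hwi'.mono fun ω hω => hνi _ hω)
    (measurable_reg (a := a) (q := q)) hc hb
  simp only [hνint] at l1 l2
  refine le_of_tendsto_of_tendsto' l1 (l2.const_mul K) fun n => ?_
  have hUS : ∀ᵐ U ∂(Measure.infinitePi fun _ : ℕ => ν), ∀ i, U i ∈ S := by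
    rw [ae_all_iff]
    intro i
    have : ∀ᵐ t ∂ν, t ∈ S := hac.ae_le (mem_ae_iff.2 hS)
    exact (measurePreserving_eval_infinitePi (fun _ : ℕ => ν) i).quasiMeasurePreserving.ae this
  have hpos : ∀ (n : ℕ) (U : ℕ → T) ω, 0 ≤ (∑ i ∈ Finset.range n, m * w (U i) ω) / n :=
    fun n U ω => div_nonneg (Finset.sum_nonneg fun i _ => mul_nonneg hm0.le (hw0 _ _)) n.cast_nonneg
  have hpos' : ∀ (n : ℕ) (U : ℕ → T) ω, 0 ≤ (∑ i ∈ Finset.range n, m * w' (U i) ω) / n :=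
    fun n U ω => div_nonneg (Finset.sum_nonneg fun i _ => mul_nonneg hm0.le (hw0' _ _))
      n.cast_nonneg
  have hmm : Measurable fun p : (ℕ → T) × Ω =>
      reg a q ((∑ i ∈ Finset.range n, m * w (p.1 i) p.2) / n) :=
    measurable_reg.comp (Measurable.div_const (Finset.measurable_fun_sum _ fun i _ =>
      (hw.comp (by fun_prop : Measurable fun p : (ℕ → T) × Ω => (p.1 i, p.2))).const_mul m) _)
  have hmm' : Measurable fun p : (ℕ → T) × Ω' =>
      reg a q ((∑ i ∈ Finset.range n, m * w' (p.1 i) p.2) / n) :=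
    measurable_reg.comp (Measurable.div_const (Finset.measurable_fun_sum _ fun i _ =>
      (hw'.comp (by fun_prop : Measurable fun p : (ℕ → T) × Ω' => (p.1 i, p.2))).const_mul m) _)
  rw [← integral_const_mul]
  refine integral_mono_ae ?_ ?_ ?_
  · exact ((integrable_const (a⁻¹ ^ |q|)).mono' hmm.aestronglyMeasurable (ae_of_all
      ((Measure.infinitePi fun _ : ℕ => ν).prod P) fun p => hb _ (hpos _ _ _))).integral_prod_left
  · exact (((integrable_const (a⁻¹ ^ |q|)).mono' hmm'.aestronglyMeasurable (ae_of_all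
      ((Measure.infinitePi fun _ : ℕ => ν).prod P') fun p =>
        hb _ (hpos' _ _ _))).integral_prod_left).const_mul K
  · filter_upwards [hUS] with U hU
    have := h n (fun i => U i) (fun i => hU i) (m / n) (by positivity)
    have r : ∀ x : ℕ → ℝ, (∑ i ∈ Finset.range n, m * x i) / n = ∑ i : Fin n, m / n * x i :=
        fun x => by
      rw [Finset.sum_div, Finset.sum_range]
      exact Finset.sum_congr rfl fun i _ => by ring
    simpa only [r fun i => w (U i) _, r fun i => w' (U i) _] using this

end Mass

/-- The mass of the (Wick) exponential of the field `Z` with respect to `μ`. -/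
def expMass {T Ω : Type*} [MeasurableSpace T] (μ : Measure T) (Z : T → Ω → ℝ) (C : T → T → ℝ)
    (ω : Ω) : ℝ≥0∞ :=
  ∫⁻ t, ENNReal.ofReal (Real.exp (Z t ω - C t t / 2)) ∂μ

namespace IsGaussField

variable {T Ω Ω' : Type*} [MeasurableSpace T] [MeasurableSpace Ω] [MeasurableSpace Ω']
  {P : Measure Ω} {P' : Measure Ω'} {Z : T → Ω → ℝ} {Z' : T → Ω' → ℝ} {C C' : T → T → ℝ}

lemma measurable_wick (hZ : IsGaussField P Z C) :
    Measurable (Function.uncurry fun t ω => Real.exp (Z t ω - C t t / 2)) :=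
  Real.measurable_exp.comp (hZ.meas.sub ((hZ.measurable_cov.comp measurable_fst).div_const 2))

lemma measurable_expMass (hZ : IsGaussField P Z C) (μ : Measure T) [SFinite μ] :
    Measurable (expMass μ Z C) :=
  Measurable.lintegral_prod_left' (f := fun p : T × Ω =>
    ENNReal.ofReal (Real.exp (Z p.1 p.2 - C p.1 p.1 / 2)))
    hZ.measurable_wick.ennreal_ofReal

lemma lintegral_wick (hZ : IsGaussField P Z C) (t : T) :
    ∫⁻ ω, ENNReal.ofReal (Real.exp (Z t ω - C t t / 2)) ∂P = 1 := by
  simpa [tilt] using hZ.lintegral_tilt t 1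

lemma lintegral_expMass (hZ : IsGaussField P Z C) (μ : Measure T) [SFinite μ] :
    ∫⁻ ω, expMass μ Z C ω ∂P = μ Set.univ := by
  have := hZ.isProbabilityMeasure
  unfold expMass
  rw [lintegral_lintegral_swap
    (hZ.measurable_wick.comp measurable_swap).ennreal_ofReal.aemeasurable]
  simp [hZ.lintegral_wick]

lemma ae_expMass_ne_top (hZ : IsGaussField P Z C) (μ : Measure T) [IsFiniteMeasure μ] :
    ∀ᵐ ω ∂P, expMass μ Z C ω ≠ ⊤ := by
  have h := hZ.lintegral_expMass μ
  filter_upwards [ae_lt_top (hZ.measurable_expMass μ) (by rw [h]; exact measure_ne_top _ _)]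
    with ω hω using hω.ne

lemma ae_integrable_wick (hZ : IsGaussField P Z C) (μ : Measure T) [IsFiniteMeasure μ] :
    ∀ᵐ ω ∂P, Integrable (fun t => Real.exp (Z t ω - C t t / 2)) μ := by
  filter_upwards [hZ.ae_expMass_ne_top μ] with ω hω
  refine ⟨(hZ.measurable_wick.comp measurable_prodMk_right).aestronglyMeasurable, ?_⟩
  rw [hasFiniteIntegral_iff_ofReal (ae_of_all _ fun _ => (Real.exp_pos _).le)]
  exact hω.lt_top

/-- Comparison of regularized moments of the masses of two fields with close covariances. -/
lemma lintegral_reg_expMass_le (hZ : IsGaussField P Z C) (hZ' : IsGaussField P' Z' C')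
    (μ : Measure T) [IsFiniteMeasure μ] {S : Set T} (hS : μ Sᶜ = 0) {δ : ℝ} (hδ0 : 0 ≤ δ)
    (hδ : ∀ s ∈ S, ∀ t ∈ S, |C s t - C' s t| ≤ δ) {a : ℝ} (ha : 0 < a) (ha1 : a < 1) (q : ℝ) :
    ∫⁻ ω, ENNReal.ofReal (reg a q (expMass μ Z C ω).toReal) ∂P ≤
      ENNReal.ofReal (Real.exp ((q ^ 2 + 3 * |q|) * δ * (Real.pi / 2))) *
        ∫⁻ ω, ENNReal.ofReal (reg a q (expMass μ Z' C' ω).toReal) ∂P' := by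
  have := hZ.isProbabilityMeasure
  have := hZ'.isProbabilityMeasure
  refine lintegral_reg_le_of_sum μ hZ.measurable_wick hZ'.measurable_wick
    (fun _ _ => (Real.exp_pos _).le) (fun _ _ => (Real.exp_pos _).le) (hZ.ae_integrable_wick μ)
    (hZ'.ae_integrable_wick μ) hS ha ha1 (Real.one_le_exp (by positivity)) fun n U hU p hp => ?_
  have hB : 0 ≤ a⁻¹ ^ |q| := by positivity
  refine hZ.integral_sum_exp_le hZ' (p := fun _ => p) U (fun _ => hp)
    (B := (|q| + 1) * a⁻¹ ^ |q|) (c := q ^ 2 + 3 * |q|)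
    (fun i j => hδ _ (hU i) _ (hU j)) measurable_reg measurable_regDeriv measurable_regDeriv₂
    (fun w hw => hasDerivAt_reg ha hw) (fun w hw => hasDerivAt_regDeriv ha hw)
    (fun w hw => ?_) (fun w hw => ?_) hδ0 (by positivity)
    (fun w hw => sq_mul_abs_regDeriv₂_le ha ha1 hw)
  · have := abs_reg_le (q := q) ha ha1 hw
    nlinarith [abs_nonneg q]
  · have h1 := abs_reg_le (q := q) ha ha1 hw
    have h2 := mul_abs_regDeriv_le (q := q) ha ha1 hw
    have h3 := le_abs_self (reg a q w)
    nlinarith [abs_nonneg q]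

/-- Comparison of moments of the masses of two fields with close covariances. -/
lemma lintegral_expMass_rpow_le (hZ : IsGaussField P Z C) (hZ' : IsGaussField P' Z' C')
    (μ : Measure T) [IsFiniteMeasure μ] {S : Set T} (hS : μ Sᶜ = 0) {δ : ℝ} (hδ0 : 0 ≤ δ)
    (hδ : ∀ s ∈ S, ∀ t ∈ S, |C s t - C' s t| ≤ δ) (q : ℝ) :
    ∫⁻ ω, expMass μ Z C ω ^ q ∂P ≤
      ENNReal.ofReal (Real.exp ((q ^ 2 + 3 * |q|) * δ * (Real.pi / 2))) *
        ∫⁻ ω, expMass μ Z' C' ω ^ q ∂P' := by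
  have := hZ'.isProbabilityMeasure
  exact lintegral_rpow_le_of_reg (hZ.measurable_expMass μ) (hZ'.measurable_expMass μ)
    (hZ.ae_expMass_ne_top μ) (hZ'.ae_expMass_ne_top μ) (by simp [Real.exp_pos])
    ENNReal.ofReal_ne_top fun a ha =>
      hZ.lintegral_reg_expMass_le hZ' μ hS hδ0 hδ ha.1 ha.2 q

/-- The Cameron–Martin formula for the mass of a Gaussian field. -/
lemma lintegral_tilt_mul_expMass_rpow (hZ : IsGaussField P Z C) (μ : Measure T)
    [IsFiniteMeasure μ] (t₀ : T) {B : ℝ} (hB : ∀ᵐ t ∂μ, C t t₀ ≤ B) (q : ℝ) :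
    ∫⁻ ω, tilt Z C t₀ 1 ω * expMass μ Z C ω ^ q ∂P =
      ∫⁻ ω, (∫⁻ t, ENNReal.ofReal (Real.exp (Z t ω - C t t / 2 + C t t₀)) ∂μ) ^ q ∂P := by
  have := hZ.isProbabilityMeasure
  have := hZ.isProbabilityMeasure_tilt t₀ 1
  have hwm : Measurable (Function.uncurry fun t ω => Real.exp (Z t ω - C t t / 2 + C t t₀)) :=
    Real.measurable_exp.comp ((hZ.meas.sub ((hZ.measurable_cov.comp measurable_fst).div_const
      2)).add ((hZ.measurable_cov_left t₀).comp measurable_fst))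
  have hm := hZ.measurable_expMass μ
  have hm' : Measurable fun ω => ∫⁻ t, ENNReal.ofReal (Real.exp (Z t ω - C t t / 2 + C t t₀)) ∂μ :=
    Measurable.lintegral_prod_left' (f := fun p : T × Ω =>
      ENNReal.ofReal (Real.exp (Z p.1 p.2 - C p.1 p.1 / 2 + C p.1 t₀))) hwm.ennreal_ofReal
  have hac : P.withDensity (tilt Z C t₀ 1) ≪ P := withDensity_absolutelyContinuous _ _
  have i1 := hac.ae_le (hZ.ae_integrable_wick μ)
  have i2 : ∀ᵐ ω ∂P, Integrable (fun t => Real.exp (Z t ω - C t t / 2 + C t t₀)) μ := by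
    filter_upwards [hZ.ae_integrable_wick μ] with ω hω
    refine (hω.mul_const (Real.exp B)).mono'
      (hwm.comp measurable_prodMk_right).aestronglyMeasurable (hB.mono fun t ht => ?_)
    rw [Real.norm_of_nonneg (Real.exp_pos _).le, Real.exp_add]
    gcongr
  have f1 := hac.ae_le (hZ.ae_expMass_ne_top μ)
  have f2 : ∀ᵐ ω ∂P, ∫⁻ t, ENNReal.ofReal (Real.exp (Z t ω - C t t / 2 + C t t₀)) ∂μ ≠ ⊤ := by
    filter_upwards [i2] with ω hω
    rw [← ofReal_integral_eq_lintegral_ofReal hω (ae_of_all _ fun _ => (Real.exp_pos _).le)]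
    exact ENNReal.ofReal_ne_top
  have fin : ∀ (a : ℝ) (n : ℕ) (U : Fin n → T) (p : ℝ),
      ∫ ω, reg a q (∑ i, p * Real.exp (Z (U i) ω - C (U i) (U i) / 2))
        ∂(P.withDensity (tilt Z C t₀ 1)) =
      ∫ ω, reg a q (∑ i, p * Real.exp (Z (U i) ω - C (U i) (U i) / 2 + C (U i) t₀)) ∂P := by
    intro a n U p
    have h1 := fun i => hZ.measurable (U i)
    have hG : Measurable fun y : Fin n → ℝ =>
        reg a q (∑ i, p * Real.exp (y i - C (U i) (U i) / 2)) :=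
      measurable_reg.comp (by fun_prop)
    have := congrArg (fun m => ∫ y, reg a q (∑ i, p * Real.exp (y i - C (U i) (U i) / 2)) ∂m)
      (hZ.map_tilt U t₀ 1)
    beta_reduce at this
    rw [integral_map (by fun_prop) hG.aestronglyMeasurable,
      integral_map (by fun_prop) hG.aestronglyMeasurable] at this
    rw [this]
    simp only [one_mul, add_sub_right_comm]
  have e : ∫⁻ ω, tilt Z C t₀ 1 ω * expMass μ Z C ω ^ q ∂P =
      ∫⁻ ω, expMass μ Z C ω ^ q ∂(P.withDensity (tilt Z C t₀ 1)) := by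
    rw [lintegral_withDensity_eq_lintegral_mul _ (hZ.measurable_tilt t₀ 1) (hm.pow_const q)]
    rfl
  rw [e]
  refine le_antisymm ?_ ?_
  · have := lintegral_rpow_le_of_reg (q := q) hm hm' f1 f2 one_ne_zero ENNReal.one_ne_top
      fun a ha => by
        rw [← ENNReal.ofReal_one]
        exact lintegral_reg_le_of_sum μ hZ.measurable_wick hwm
          (fun _ _ => (Real.exp_pos _).le) (fun _ _ => (Real.exp_pos _).le) i1 i2
          (S := Set.univ) (by simp) (q := q) ha.1 ha.2 le_rfl fun n U _ p _ => by
            rw [one_mul, fin]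
    simpa using this
  · have := lintegral_rpow_le_of_reg (q := q) hm' hm f2 f1 one_ne_zero ENNReal.one_ne_top
      fun a ha => by
        rw [← ENNReal.ofReal_one]
        exact lintegral_reg_le_of_sum μ hwm hZ.measurable_wick
          (fun _ _ => (Real.exp_pos _).le) (fun _ _ => (Real.exp_pos _).le) i2 i1
          (S := Set.univ) (by simp) (q := q) ha.1 ha.2 le_rfl fun n U _ p _ => by
            rw [one_mul, fin]
    simpa using this

end IsGaussField

/-- The positive part of the logarithmic kernel. -/
def logPlus (a : EuclideanSpace ℝ (Fin d)) : ℝ := max (Real.log ‖a‖⁻¹) 0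

lemma logPlus_nonneg (a : EuclideanSpace ℝ (Fin d)) : 0 ≤ logPlus a := le_max_right _ _

lemma measurable_logPlus : Measurable (logPlus (d := d)) := by unfold logPlus; fun_prop

lemma abs_logPlus_smul_sub_le {ρ : ℝ} (hρ : 0 < ρ) (w : EuclideanSpace ℝ (Fin d)) :
    |logPlus (ρ • w) - logPlus w| ≤ |Real.log ρ| := by
  rcases eq_or_ne w 0 with rfl | hw
  · simp
  · refine (abs_max_sub_max_le_abs _ _ _).trans ?_
    rw [norm_smul, Real.norm_of_nonneg hρ.le, mul_inv,
      Real.log_mul (by positivity) (by simpa using hw), add_sub_cancel_right, Real.log_inv, abs_neg]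

lemma logPlus_smul_le {ρ : ℝ} (hρ : 0 < ρ) (w : EuclideanSpace ℝ (Fin d)) :
    logPlus (ρ • w) ≤ logPlus w + max (Real.log ρ⁻¹) 0 := by
  rcases eq_or_ne w 0 with rfl | hw
  · simp [logPlus]
  · unfold logPlus
    rw [norm_smul, Real.norm_of_nonneg hρ.le, mul_inv,
      Real.log_mul (by positivity) (by simpa using hw)]
    refine max_le ?_ (add_nonneg (le_max_right _ _) (le_max_right _ _))
    linarith [le_max_left (Real.log ‖w‖⁻¹) 0, le_max_left (Real.log ρ⁻¹) 0]

lemma logPlus_le_of_le {ρ : ℝ} (hρ : 0 < ρ) {w : EuclideanSpace ℝ (Fin d)} (h : ρ ≤ ‖w‖) :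
    logPlus w ≤ max (Real.log ρ⁻¹) 0 :=
  max_le_max_right _ (Real.log_le_log (inv_pos.2 (hρ.trans_le h)) (inv_anti₀ hρ h))

lemma log_inv_le_logPlus {ρ : ℝ} {w : EuclideanSpace ℝ (Fin d)} (hw : w ≠ 0) (h : ‖w‖ ≤ ρ) :
    Real.log ρ⁻¹ ≤ logPlus w := by
  have := norm_pos_iff.2 hw
  exact (Real.log_le_log (inv_pos.2 (this.trans_le h)) (inv_anti₀ this h)).trans (le_max_left _ _)

lemma integrable_logPlus (hd : 1 ≤ d) : Integrable (logPlus (d := d)) := by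
  have hfr : Module.finrank ℝ (EuclideanSpace ℝ (Fin d)) = d := by simp
  have h1 : IntegrableOn (logPlus (d := d)) (Metric.ball 0 1) := by
    refine integrableOn_ball_of_norm_le_rpow (by rwa [hfr]) (C := 2) (α := 1 / 2) ?_ ?_
      measurable_logPlus.aestronglyMeasurable
    · rw [hfr]
      have : (1 : ℝ) ≤ d := by exact_mod_cast hd
      linarith
    · refine ae_of_all _ fun x => ?_
      rw [Real.norm_of_nonneg (logPlus_nonneg x)]
      refine max_le ?_ (by positivity)
      have := Real.log_le_rpow_div (inv_nonneg.2 (norm_nonneg x)) (show (0 : ℝ) < 1 / 2 by norm_num)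
      rw [Real.inv_rpow (norm_nonneg x), ← Real.rpow_neg (norm_nonneg x)] at this
      linarith
  refine integrableOn_univ.1 ((integrableOn_iff_integrable_of_support_subset ?_).1 h1).integrableOn
  intro x hx
  by_contra hx'
  simp only [Metric.mem_ball, dist_zero_right, not_lt] at hx'
  refine hx (max_eq_right (Real.log_nonpos (by positivity) (inv_le_one_of_one_le₀ hx')))

/-- A boundedly supported probability measure with uniformly bounded logarithmic potentials. -/
structure IsLogMollifier (ν : Measure (EuclideanSpace ℝ (Fin d))) (R c₀ : ℝ) : Prop where
  prob : IsProbabilityMeasure ν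
  noAtoms : NullSingletonClass ν
  one_le : 1 ≤ R
  supp : ∀ᵐ u ∂ν, ‖u‖ ≤ R
  nonneg : 0 ≤ c₀
  pot : ∀ b, ∫⁻ u, ENNReal.ofReal (logPlus (b - u)) ∂ν ≤ ENNReal.ofReal c₀

/-- The probability measure with density `θ`. -/
def mollifierMeasure (θ : EuclideanSpace ℝ (Fin d) → ℝ) : Measure (EuclideanSpace ℝ (Fin d)) :=
  volume.withDensity fun x => ENNReal.ofReal (θ x)

lemma IsMollifier.exists_isLogMollifier (hd : 1 ≤ d) {θ : EuclideanSpace ℝ (Fin d) → ℝ}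
    (hθ : IsMollifier θ) : ∃ R c₀, IsLogMollifier (mollifierMeasure θ) R c₀ := by
  obtain ⟨hc, hs, h0, h1⟩ := hθ
  have hcont := hc.continuous
  have hm : Measurable fun x => ENNReal.ofReal (θ x) := hcont.measurable.ennreal_ofReal
  obtain ⟨B, hB⟩ := hcont.bounded_above_of_compact_support hs
  obtain ⟨R, hR⟩ := hs.isCompact.isBounded.subset_closedBall 0
  have : Nonempty (Fin d) := ⟨⟨0, hd⟩⟩
  have hB0 : 0 ≤ B := (norm_nonneg _).trans (hB 0)
  refine ⟨max R 1, B * ∫ x, logPlus (d := d) x, ⟨⟨?_⟩, ?_, le_max_right _ _, ?_,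
    mul_nonneg hB0 (integral_nonneg logPlus_nonneg), fun b => ?_⟩⟩
  · have hi : Integrable θ := by
      by_contra h
      rw [integral_undef h] at h1
      norm_num at h1
    rw [mollifierMeasure, withDensity_apply _ MeasurableSet.univ, Measure.restrict_univ,
      ← ofReal_integral_eq_lintegral_ofReal hi (ae_of_all _ h0), h1, ENNReal.ofReal_one]
  · unfold mollifierMeasure
    exact ⟨fun x => withDensity_absolutelyContinuous _ _ (measure_singleton x)⟩
  · rw [mollifierMeasure, ae_withDensity_iff hm]
    refine ae_of_all _ fun x hx => ?_
    have : x ∈ tsupport θ := subset_tsupport _ (by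
      intro h
      simp [h] at hx)
    exact (mem_closedBall_zero_iff.1 (hR this)).trans (le_max_left _ _)
  · rw [mollifierMeasure, lintegral_withDensity_eq_lintegral_mul volume hm
      (g := fun u => ENNReal.ofReal (logPlus (b - u)))
      (measurable_logPlus.comp (by fun_prop : Measurable fun u => b - u)).ennreal_ofReal,
      ENNReal.ofReal_mul hB0,
      ofReal_integral_eq_lintegral_ofReal (integrable_logPlus hd) (ae_of_all _ logPlus_nonneg),
      ← lintegral_const_mul _ measurable_logPlus.ennreal_ofReal,
      ← lintegral_sub_left_eq_self
        (fun x => ENNReal.ofReal B * ENNReal.ofReal (logPlus x)) b]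
    refine lintegral_mono fun x => ?_
    simp only [Pi.mul_apply]
    gcongr
    exact (le_abs_self _).trans (hB x)

lemma integral_mollifierScaled {θ : EuclideanSpace ℝ (Fin d) → ℝ} (hθ : IsMollifier θ) {ε : ℝ}
    (hε : 0 < ε) (F : EuclideanSpace ℝ (Fin d) → ℝ) :
    ∫ u, mollifierScaled θ ε u * F u = ∫ u, F (ε • u) ∂(mollifierMeasure θ) := by
  have hm : Measurable fun x => ENNReal.ofReal (θ x) := hθ.1.continuous.measurable.ennreal_ofReal
  rw [mollifierMeasure, integral_withDensity_eq_integral_toReal_smul hm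
    (ae_of_all _ fun _ => ENNReal.ofReal_lt_top)]
  have := Measure.integral_comp_inv_smul_of_nonneg (volume : Measure (EuclideanSpace ℝ (Fin d)))
    (fun u => θ u * F (ε • u)) hε.le
  simp only [smul_inv_smul₀ hε.ne', finrank_euclideanSpace, Fintype.card_fin, smul_eq_mul] at this
  simp only [mollifierScaled, mul_assoc, integral_const_mul, this, smul_eq_mul,
    ENNReal.toReal_ofReal (hθ.2.2.1 _)]
  field_simp

lemma mollifiedCov_eq {θ : EuclideanSpace ℝ (Fin d) → ℝ} (hθ : IsMollifier θ) {ε ε' : ℝ}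
    (hε : 0 < ε) (hε' : 0 < ε') (K : EuclideanSpace ℝ (Fin d) → EuclideanSpace ℝ (Fin d) → ℝ)
    (x y : EuclideanSpace ℝ (Fin d)) :
    mollifiedCov K θ θ ε ε' x y = ∫ u, ∫ v, K (x - ε • u) (y - ε' • v) ∂(mollifierMeasure θ)
      ∂(mollifierMeasure θ) := by
  unfold mollifiedCov
  simp only [mul_assoc, integral_const_mul]
  rw [integral_mollifierScaled hθ hε fun u => ∫ v, mollifierScaled θ ε' v * K (x - u) (y - v)]
  simp only [integral_mollifierScaled hθ hε' fun v => K _ (y - v)]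

/-- The logarithmic potential between two mollified points at relative position `a`. -/
def logPot (ν : Measure (EuclideanSpace ℝ (Fin d))) (ε ε' : ℝ) (a : EuclideanSpace ℝ (Fin d)) : ℝ :=
  ∫ p, logPlus (a - ε • p.1 + ε' • p.2) ∂(ν.prod ν)

/-- The average of `g` against two mollified points. -/
def avgPot (ν : Measure (EuclideanSpace ℝ (Fin d)))
    (g : EuclideanSpace ℝ (Fin d) → EuclideanSpace ℝ (Fin d) → ℝ) (ε ε' : ℝ)
    (x y : EuclideanSpace ℝ (Fin d)) : ℝ :=
  ∫ p, g (x - ε • p.1) (y - ε' • p.2) ∂(ν.prod ν)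

namespace IsLogMollifier

variable {ν : Measure (EuclideanSpace ℝ (Fin d))} {R c₀ ε ε' ρ : ℝ} {a : EuclideanSpace ℝ (Fin d)}

lemma lintegral_logPlus_sub_le (hν : IsLogMollifier ν R c₀)
    {b : EuclideanSpace ℝ (Fin d) → EuclideanSpace ℝ (Fin d)} (hb : Measurable b) :
    ∫⁻ p, ENNReal.ofReal (logPlus (b p.2 - p.1)) ∂(ν.prod ν) ≤ ENNReal.ofReal c₀ := by
  have := hν.prob
  have hm : Measurable fun p : EuclideanSpace ℝ (Fin d) × EuclideanSpace ℝ (Fin d) =>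
      ENNReal.ofReal (logPlus (b p.2 - p.1)) := (measurable_logPlus.comp
    (by fun_prop : Measurable fun p : _ × _ => b p.2 - p.1)).ennreal_ofReal
  rw [lintegral_prod_symm _ hm.aemeasurable]
  calc _ ≤ ∫⁻ _, ENNReal.ofReal c₀ ∂ν := lintegral_mono fun v => hν.pot (b v)
    _ = _ := by simp

lemma integrable_logPlus_sub (hν : IsLogMollifier ν R c₀)
    {b : EuclideanSpace ℝ (Fin d) → EuclideanSpace ℝ (Fin d)} (hb : Measurable b) :
    Integrable (fun p : _ × _ => logPlus (b p.2 - p.1)) (ν.prod ν) := by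
  refine ⟨(measurable_logPlus.comp
    (by fun_prop : Measurable fun p : _ × _ => b p.2 - p.1)).aestronglyMeasurable, ?_⟩
  rw [hasFiniteIntegral_iff_ofReal (ae_of_all _ fun _ => logPlus_nonneg _)]
  exact (hν.lintegral_logPlus_sub_le hb).trans_lt ENNReal.ofReal_lt_top

lemma integral_logPlus_sub_le (hν : IsLogMollifier ν R c₀)
    {b : EuclideanSpace ℝ (Fin d) → EuclideanSpace ℝ (Fin d)} (hb : Measurable b) :
    ∫ p, logPlus (b p.2 - p.1) ∂(ν.prod ν) ≤ c₀ := by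
  have := hν.lintegral_logPlus_sub_le hb
  rw [← ofReal_integral_eq_lintegral_ofReal (hν.integrable_logPlus_sub hb)
    (ae_of_all _ fun _ => logPlus_nonneg _)] at this
  exact (ENNReal.ofReal_le_ofReal_iff hν.nonneg).1 this

lemma logPlus_le (hε : 0 < ε) (a u w : EuclideanSpace ℝ (Fin d)) :
    logPlus (a - ε • u + w) ≤ logPlus (ε⁻¹ • (a + w) - u) + max (Real.log ε⁻¹) 0 := by
  have : a - ε • u + w = ε • (ε⁻¹ • (a + w) - u) := by
    rw [smul_sub, smul_inv_smul₀ hε.ne']; abel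
  rw [this]
  exact logPlus_smul_le hε _

lemma integrable (hν : IsLogMollifier ν R c₀) (hε : 0 < ε) (ε' : ℝ)
    (a : EuclideanSpace ℝ (Fin d)) :
    Integrable (fun p : _ × _ => logPlus (a - ε • p.1 + ε' • p.2)) (ν.prod ν) := by
  have := hν.prob
  refine ((hν.integrable_logPlus_sub (b := fun v => ε⁻¹ • (a + ε' • v)) (by fun_prop)).add
    (integrable_const (max (Real.log ε⁻¹) 0))).mono' (measurable_logPlus.comp
      (by fun_prop : Measurable fun p : EuclideanSpace ℝ (Fin d) × EuclideanSpace ℝ (Fin d) =>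
        a - ε • p.1 + ε' • p.2)).aestronglyMeasurable
    (ae_of_all _ fun p => ?_)
  rw [Real.norm_of_nonneg (logPlus_nonneg _)]
  exact logPlus_le hε _ _ _

lemma ae_norm_le (hν : IsLogMollifier ν R c₀) : ∀ᵐ p ∂(ν.prod ν), ‖p.1‖ ≤ R ∧ ‖p.2‖ ≤ R := by
  have := hν.prob
  exact (Measure.quasiMeasurePreserving_fst.ae hν.supp).and
    (Measure.quasiMeasurePreserving_snd.ae hν.supp)

lemma ae_ne_zero (hν : IsLogMollifier ν R c₀) (ε : ℝ) (hε' : 0 < ε')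
    (a : EuclideanSpace ℝ (Fin d)) : ∀ᵐ p ∂(ν.prod ν), a - ε • p.1 + ε' • p.2 ≠ 0 := by
  have := hν.prob
  have := hν.noAtoms
  have hm : MeasurableSet {p : EuclideanSpace ℝ (Fin d) × EuclideanSpace ℝ (Fin d) |
      a - ε • p.1 + ε' • p.2 ≠ 0} :=
    (measurableSet_eq_fun (by fun_prop) measurable_const).compl
  refine (Measure.ae_prod_iff_ae_ae hm).2 (ae_of_all _ fun u => ?_)
  filter_upwards [(measure_eq_zero_iff_ae_notMem (μ := ν)).1
    (measure_singleton (ε'⁻¹ • (ε • u - a)))] with v hv h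
  refine hv ?_
  have : ε' • v = ε • u - a := by
    rw [← sub_eq_zero, ← h]; abel
  rw [Set.mem_singleton_iff, ← this, inv_smul_smul₀ hε'.ne']

lemma logPot_nonneg : 0 ≤ logPot ν ε ε' a := integral_nonneg fun _ => logPlus_nonneg _

lemma logPot_le (hν : IsLogMollifier ν R c₀) (hε : 0 < ε) (hρ : 0 < ρ) (h : ρ ≤ max ‖a‖ ε) :
    logPot ν ε ε a ≤ max (Real.log ρ⁻¹) 0 + (Real.log (4 * R) + c₀) := by
  have := hν.prob
  have hR := hν.one_le
  have hR4 : 0 ≤ Real.log (4 * R) := Real.log_nonneg (by linarith)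
  have key : Real.log (4 * R / ρ) = Real.log ρ⁻¹ + Real.log (4 * R) := by
    rw [div_eq_mul_inv, Real.log_mul (by positivity) (by positivity), add_comm]
  have hb : Measurable fun v : EuclideanSpace ℝ (Fin d) => ε⁻¹ • (a + ε • v) := by fun_prop
  have hi := hν.integrable_logPlus_sub hb
  calc logPot ν ε ε a ≤ ∫ p, (logPlus (ε⁻¹ • (a + ε • p.2) - p.1) +
        (max (Real.log ρ⁻¹) 0 + Real.log (4 * R))) ∂(ν.prod ν) := by
        refine integral_mono_ae (hν.integrable hε ε a) (hi.add (integrable_const _)) ?_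
        filter_upwards [hν.ae_norm_le] with p hp
        rcases le_or_gt ρ (4 * R * ε) with h1 | h1
        · refine (logPlus_le hε _ _ _).trans ?_
          gcongr
          refine max_le ?_ (by positivity)
          have : Real.log ε⁻¹ ≤ Real.log (4 * R / ρ) := by
            apply Real.log_le_log (by positivity)
            rw [inv_eq_one_div, div_le_div_iff₀ hε hρ]
            linarith
          linarith [le_max_left (Real.log ρ⁻¹) 0]
        · have hερ : ε < ρ := by nlinarith
          have ha : ρ ≤ ‖a‖ := (le_max_iff.1 h).resolve_right (by linarith)
          have n1 : ‖ε • p.1‖ ≤ ε * R := by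
            rw [norm_smul, Real.norm_of_nonneg hε.le]; gcongr; exact hp.1
          have n2 : ‖ε • p.2‖ ≤ ε * R := by
            rw [norm_smul, Real.norm_of_nonneg hε.le]; gcongr; exact hp.2
          have n3 : ‖a‖ ≤ ‖a - ε • p.1 + ε • p.2‖ + ‖ε • p.1‖ + ‖ε • p.2‖ := by
            calc ‖a‖ = ‖(a - ε • p.1 + ε • p.2) + ε • p.1 - ε • p.2‖ := by congr 1; abel
              _ ≤ _ := (norm_sub_le _ _).trans (by gcongr; exact norm_add_le _ _)
          have n4 : ρ / (4 * R) ≤ ‖a - ε • p.1 + ε • p.2‖ := by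
            have : ρ / (4 * R) ≤ ρ / 4 := by
              rw [div_le_div_iff₀ (by positivity) (by positivity)]; nlinarith
            nlinarith
          have := logPlus_le_of_le (by positivity) n4
          rw [inv_div, key] at this
          refine this.trans (le_add_of_nonneg_of_le (logPlus_nonneg _) (max_le ?_ ?_))
          · linarith [le_max_left (Real.log ρ⁻¹) 0]
          · linarith [le_max_right (Real.log ρ⁻¹) 0]
    _ ≤ _ := by
        rw [integral_add hi (integrable_const _), integral_const]
        simp only [probReal_univ, one_smul]
        linarith [hν.integral_logPlus_sub_le hb]

lemma le_logPot (hν : IsLogMollifier ν R c₀) (hε : 0 < ε) (hε' : 0 < ε') (h : ε ≤ ρ)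
    (h' : ε' ≤ ρ) (ha : ‖a‖ ≤ ρ) :
    Real.log ρ⁻¹ - Real.log (1 + 2 * R) ≤ logPot ν ε ε' a := by
  have := hν.prob
  have hR := hν.one_le
  have hρ : 0 < ρ := hε.trans_le h
  calc _ = ∫ p, (Real.log ρ⁻¹ - Real.log (1 + 2 * R)) ∂(ν.prod ν) := by simp
    _ ≤ _ := by
        refine integral_mono_ae (integrable_const _) (hν.integrable hε ε' a) ?_
        filter_upwards [hν.ae_norm_le, hν.ae_ne_zero ε hε' a] with p hp hp0
        have n1 : ‖ε • p.1‖ ≤ ρ * R := by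
          rw [norm_smul, Real.norm_of_nonneg hε.le]; gcongr; exact hp.1
        have n2 : ‖ε' • p.2‖ ≤ ρ * R := by
          rw [norm_smul, Real.norm_of_nonneg hε'.le]; gcongr; exact hp.2
        have n3 : ‖a - ε • p.1 + ε' • p.2‖ ≤ ρ * (1 + 2 * R) := by
          refine (norm_add_le _ _).trans ?_
          linarith [norm_sub_le a (ε • p.1)]
        have := log_inv_le_logPlus hp0 n3
        rwa [mul_inv, Real.log_mul (by positivity) (by positivity), Real.log_inv (1 + 2 * R),
          ← sub_eq_add_neg] at this

lemma abs_logPot_smul_sub_le (hν : IsLogMollifier ν R c₀) (hε : 0 < ε) (ε' : ℝ) (hρ : 0 < ρ)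
    (a : EuclideanSpace ℝ (Fin d)) :
    |logPot ν (ρ * ε) (ρ * ε') (ρ • a) - logPot ν ε ε' a| ≤ |Real.log ρ| := by
  have := hν.prob
  unfold logPot
  rw [← integral_sub (hν.integrable (by positivity) _ _) (hν.integrable hε _ _)]
  refine (abs_integral_le_integral_abs).trans ?_
  calc _ ≤ ∫ p, |Real.log ρ| ∂(ν.prod ν) := by
        refine integral_mono_of_nonneg (ae_of_all _ fun _ => abs_nonneg _) (integrable_const _)
          (ae_of_all _ fun p => ?_)
        have : ρ • a - (ρ * ε) • p.1 + (ρ * ε') • p.2 = ρ • (a - ε • p.1 + ε' • p.2) := by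
          simp only [smul_add, smul_sub, mul_smul]
        beta_reduce
        rw [this]
        exact abs_logPlus_smul_sub_le hρ _
    _ = _ := by simp

lemma logPot_smul_eq (hν : IsLogMollifier ν R c₀) (hε : 0 < ε) (hε1 : ε ≤ 1) (hε' : 0 < ε')
    (hε1' : ε' ≤ 1) (hρ : 0 < ρ) (hρ1 : ρ * (2 + 2 * R) ≤ 1) (ha : ‖a‖ ≤ 2) :
    logPot ν (ρ * ε) (ρ * ε') (ρ • a) =
      Real.log ρ⁻¹ + ((∫ p, (logPlus ((2 + 2 * R)⁻¹ • (a - ε • p.1 + ε' • p.2))) ∂(ν.prod ν)) -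
        Real.log (2 + 2 * R)) := by
  have := hν.prob
  have hR := hν.one_le
  have e : ∀ (σ : ℝ) (p : EuclideanSpace ℝ (Fin d) × EuclideanSpace ℝ (Fin d)),
      σ • a - (σ * ε) • p.1 + (σ * ε') • p.2 = σ • (a - ε • p.1 + ε' • p.2) := fun σ p => by
    simp only [smul_add, smul_sub, mul_smul]
  have hi := hν.integrable (ε := (2 + 2 * R)⁻¹ * ε) (by positivity) ((2 + 2 * R)⁻¹ * ε')
    ((2 + 2 * R)⁻¹ • a)
  simp only [e] at hi
  have : logPot ν (ρ * ε) (ρ * ε') (ρ • a) = ∫ p, (Real.log ρ⁻¹ - Real.log (2 + 2 * R) +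
      logPlus ((2 + 2 * R)⁻¹ • (a - ε • p.1 + ε' • p.2))) ∂(ν.prod ν) := by
    unfold logPot
    refine integral_congr_ae ?_
    filter_upwards [hν.ae_norm_le, hν.ae_ne_zero ε hε' a] with p hp hp0
    have n1 : ‖ε • p.1‖ ≤ 1 * R := by
      rw [norm_smul, Real.norm_of_nonneg hε.le]; gcongr; exact hp.1
    have n2 : ‖ε' • p.2‖ ≤ 1 * R := by
      rw [norm_smul, Real.norm_of_nonneg hε'.le]; gcongr; exact hp.2
    have n3 : ‖a - ε • p.1 + ε' • p.2‖ ≤ 2 + 2 * R := by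
      refine (norm_add_le _ _).trans ?_
      linarith [norm_sub_le a (ε • p.1)]
    have hn := norm_pos_iff.2 hp0
    have key : ∀ σ : ℝ, 0 < σ → σ * (2 + 2 * R) ≤ 1 →
        logPlus (σ • (a - ε • p.1 + ε' • p.2)) =
          Real.log σ⁻¹ + Real.log ‖a - ε • p.1 + ε' • p.2‖⁻¹ := by
      intro σ hσ hσ1
      unfold logPlus
      rw [norm_smul, Real.norm_of_nonneg hσ.le, max_eq_left, mul_inv,
        Real.log_mul (by positivity) (by positivity)]
      refine Real.log_nonneg ((one_le_inv₀ (by positivity)).2 (le_trans ?_ hσ1))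
      gcongr
    rw [e, key ρ hρ hρ1, key _ (by positivity) (inv_mul_cancel₀ (by positivity)).le, inv_inv]
    ring
  rw [this, integral_add (integrable_const _) hi, integral_const]
  simp only [probReal_univ, one_smul]
  ring

end IsLogMollifier

namespace IsLogMollifier

variable {ν : Measure (EuclideanSpace ℝ (Fin d))} {R c₀ ε ε' η B : ℝ}
  {g : EuclideanSpace ℝ (Fin d) → EuclideanSpace ℝ (Fin d) → ℝ}

lemma integrable_avg (hν : IsLogMollifier ν R c₀) (hgm : Measurable (Function.uncurry g))
    (hgb : ∀ x y, |g x y| ≤ B) (ε ε' : ℝ) (x y : EuclideanSpace ℝ (Fin d)) :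
    Integrable (fun p : _ × _ => g (x - ε • p.1) (y - ε' • p.2)) (ν.prod ν) := by
  have := hν.prob
  exact (integrable_const B).mono' (hgm.comp (by fun_prop :
    Measurable fun p : EuclideanSpace ℝ (Fin d) × EuclideanSpace ℝ (Fin d) =>
      (x - ε • p.1, y - ε' • p.2))).aestronglyMeasurable (ae_of_all _ fun p => hgb _ _)

lemma abs_avgPot_le (hν : IsLogMollifier ν R c₀) (hgb : ∀ x y, |g x y| ≤ B) (ε ε' : ℝ)
    (x y : EuclideanSpace ℝ (Fin d)) : |avgPot ν g ε ε' x y| ≤ B := by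
  have := hν.prob
  refine (abs_integral_le_integral_abs).trans ?_
  calc _ ≤ ∫ p, B ∂(ν.prod ν) := integral_mono_of_nonneg (ae_of_all _ fun _ => abs_nonneg _)
        (integrable_const _) (ae_of_all _ fun p => hgb _ _)
    _ = _ := by simp

lemma abs_avgPot_sub_le (hν : IsLogMollifier ν R c₀) (hgm : Measurable (Function.uncurry g))
    (hgb : ∀ x y, |g x y| ≤ B) {x y z : EuclideanSpace ℝ (Fin d)} {s : ℝ}
    (hη : ∀ y z, dist y x ≤ s → dist z x ≤ s → |g y z - g x x| ≤ η) (hε : 0 ≤ ε) (hε' : 0 ≤ ε')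
    (hy : dist y x + ε * R ≤ s) (hz : dist z x + ε' * R ≤ s) :
    |avgPot ν g ε ε' y z - g x x| ≤ η := by
  have := hν.prob
  have e : avgPot ν g ε ε' y z - g x x =
      ∫ p, (g (y - ε • p.1) (z - ε' • p.2) - g x x) ∂(ν.prod ν) := by
    rw [integral_sub (hν.integrable_avg hgm hgb _ _ _ _) (integrable_const _)]
    simp [avgPot]
  rw [e]
  refine (abs_integral_le_integral_abs).trans ?_
  calc _ ≤ ∫ p, η ∂(ν.prod ν) := by
        refine integral_mono_of_nonneg (ae_of_all _ fun _ => abs_nonneg _) (integrable_const _) ?_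
        filter_upwards [hν.ae_norm_le] with p hp
        have n : ∀ (ε : ℝ) (u w : EuclideanSpace ℝ (Fin d)), 0 ≤ ε → ‖u‖ ≤ R →
            dist w x + ε * R ≤ s → dist (w - ε • u) x ≤ s := fun ε u w hε hu hw => by
          refine (dist_triangle _ w _).trans ?_
          rw [dist_eq_norm, sub_sub_cancel_left, norm_neg, norm_smul, Real.norm_of_nonneg hε]
          nlinarith
        exact hη _ _ (n ε p.1 y hε hp.1 hy) (n ε' p.2 z hε' hp.2 hz)
    _ = _ := by simp

end IsLogMollifier

/-- The symmetrized covariance of the mollified field. -/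
def fieldCov (g : EuclideanSpace ℝ (Fin d) → EuclideanSpace ℝ (Fin d) → ℝ)
    (θ : EuclideanSpace ℝ (Fin d) → ℝ) (ε ε' : ℝ) (x y : EuclideanSpace ℝ (Fin d)) : ℝ :=
  (mollifiedCov (logKernel g) θ θ ε ε' x y + mollifiedCov (logKernel g) θ θ ε' ε y x) / 2

lemma fieldCov_self (g : EuclideanSpace ℝ (Fin d) → EuclideanSpace ℝ (Fin d) → ℝ)
    (θ : EuclideanSpace ℝ (Fin d) → ℝ) (ε : ℝ) (x : EuclideanSpace ℝ (Fin d)) :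
    fieldCov g θ ε ε x x = mollifiedCov (logKernel g) θ θ ε ε x x := by
  unfold fieldCov; ring

lemma fieldCov_symm (g : EuclideanSpace ℝ (Fin d) → EuclideanSpace ℝ (Fin d) → ℝ)
    (θ : EuclideanSpace ℝ (Fin d) → ℝ) (ε ε' : ℝ) (x y : EuclideanSpace ℝ (Fin d)) :
    fieldCov g θ ε ε' x y = fieldCov g θ ε' ε y x := by
  unfold fieldCov; ring

section FieldCov

variable {g : EuclideanSpace ℝ (Fin d) → EuclideanSpace ℝ (Fin d) → ℝ}
  {θ : EuclideanSpace ℝ (Fin d) → ℝ} {ε ε' R c₀ : ℝ}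

lemma mollifiedCov_logKernel (hg : IsBoundedMeasurable g) (hθ : IsMollifier θ)
    (hν : IsLogMollifier (mollifierMeasure θ) R c₀) (hε : 0 < ε) (hε' : 0 < ε')
    (x y : EuclideanSpace ℝ (Fin d)) :
    mollifiedCov (logKernel g) θ θ ε ε' x y =
      logPot (mollifierMeasure θ) ε ε' (x - y) + avgPot (mollifierMeasure θ) g ε ε' x y := by
  obtain ⟨hgm, B, hgb⟩ := hg
  have := hν.prob
  rw [mollifiedCov_eq hθ hε hε']
  have e : ∀ u v, logKernel g (x - ε • u) (y - ε' • v) =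
      logPlus (x - y - ε • u + ε' • v) + g (x - ε • u) (y - ε' • v) := fun u v => by
    rw [logKernel, logPlus, dist_eq_norm]
    congr 4
    abel_nf
  simp only [e]
  have hi := (hν.integrable hε ε' (x - y)).add (hν.integrable_avg hgm hgb ε ε' x y)
  rw [integral_integral (f := fun u v => logPlus (x - y - ε • u + ε' • v) +
    g (x - ε • u) (y - ε' • v)) hi,
    integral_add (hν.integrable hε ε' (x - y)) (hν.integrable_avg hgm hgb ε ε' x y)]
  rfl

lemma fieldCov_eq (hg : IsBoundedMeasurable g) (hθ : IsMollifier θ)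
    (hν : IsLogMollifier (mollifierMeasure θ) R c₀) (hε : 0 < ε) (hε' : 0 < ε')
    (x y : EuclideanSpace ℝ (Fin d)) :
    fieldCov g θ ε ε' x y =
      (logPot (mollifierMeasure θ) ε ε' (x - y) + logPot (mollifierMeasure θ) ε' ε (y - x)) / 2 +
      (avgPot (mollifierMeasure θ) g ε ε' x y + avgPot (mollifierMeasure θ) g ε' ε y x) / 2 := by
  rw [fieldCov, mollifiedCov_logKernel hg hθ hν hε hε', mollifiedCov_logKernel hg hθ hν hε' hε]
  ring

/-- Uniform logarithmic bounds for a family of covariances, up to the constant `c`. -/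
structure HasLogBounds (k : ℝ → ℝ → EuclideanSpace ℝ (Fin d) → EuclideanSpace ℝ (Fin d) → ℝ)
    (c : ℝ) : Prop where
  nonneg : 0 ≤ c
  symm : ∀ ε ε' y z, k ε ε' y z = k ε' ε z y
  le : ∀ {ε ρ : ℝ} {y z}, 0 < ε → 0 < ρ → ρ ≤ max (dist y z) ε →
    k ε ε y z ≤ max (Real.log ρ⁻¹) 0 + c
  neg_le : ∀ {ε : ℝ} {y z}, 0 < ε → -c ≤ k ε ε y z
  log_le : ∀ {ε ε' ρ : ℝ} {y z}, 0 < ε → 0 < ε' → ε ≤ ρ → ε' ≤ ρ → dist y z ≤ ρ →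
    Real.log ρ⁻¹ - c ≤ k ε ε' y z
  scale : ∀ {ε ρ : ℝ} (x x' z z'), 0 < ε → 0 < ρ →
    |k (ρ * ε) (ρ * ε) (x + ρ • z) (x + ρ • z') - k ε ε (x' + z) (x' + z')| ≤ |Real.log ρ| + c

lemma exists_hasLogBounds (hg : IsBoundedMeasurable g) (hθ : IsMollifier θ)
    (hν : IsLogMollifier (mollifierMeasure θ) R c₀) : ∃ c, HasLogBounds (fieldCov g θ) c := by
  obtain ⟨B, hgb⟩ := hg.2
  have hR := hν.one_le
  have hB : 0 ≤ B := (abs_nonneg _).trans (hgb 0 0)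
  have h0 := hν.nonneg
  have h4 : 0 ≤ Real.log (4 * R) := Real.log_nonneg (by linarith)
  have h2 : 0 ≤ Real.log (1 + 2 * R) := Real.log_nonneg (by linarith)
  have hG := fun ε ε' x y => abs_le.1 (hν.abs_avgPot_le hgb ε ε' x y)
  refine ⟨Real.log (4 * R) + c₀ + Real.log (1 + 2 * R) + 2 * B, by positivity,
    fieldCov_symm g θ, ?_, ?_, ?_, ?_⟩
  · intro ε ρ y z hε hρ h
    rw [fieldCov_eq hg hθ hν hε hε]
    have l1 := hν.logPot_le (a := y - z) hε hρ (by rwa [← dist_eq_norm])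
    have l2 := hν.logPot_le (a := z - y) hε hρ (by rwa [← dist_eq_norm, dist_comm])
    linarith [(hG ε ε y z).2, (hG ε ε z y).2]
  · intro ε y z hε
    rw [fieldCov_eq hg hθ hν hε hε]
    have l1 := IsLogMollifier.logPot_nonneg (ν := mollifierMeasure θ) (ε := ε) (ε' := ε)
      (a := y - z)
    have l2 := IsLogMollifier.logPot_nonneg (ν := mollifierMeasure θ) (ε := ε) (ε' := ε)
      (a := z - y)
    linarith [(hG ε ε y z).1, (hG ε ε z y).1]
  · intro ε ε' ρ y z hε hε' h h' hd
    rw [fieldCov_eq hg hθ hν hε hε']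
    have l1 := hν.le_logPot (a := y - z) hε hε' h h' (by rwa [← dist_eq_norm])
    have l2 := hν.le_logPot (a := z - y) hε' hε h' h (by rwa [← dist_eq_norm, dist_comm])
    linarith [(hG ε ε' y z).1, (hG ε' ε z y).1]
  · intro ε ρ x x' z z' hε hρ
    rw [fieldCov_eq hg hθ hν hε hε, fieldCov_eq hg hθ hν (mul_pos hρ hε) (mul_pos hρ hε),
      add_sub_add_left_eq_sub, add_sub_add_left_eq_sub, add_sub_add_left_eq_sub,
      add_sub_add_left_eq_sub, ← smul_sub, ← smul_sub]
    have l1 := abs_le.1 (hν.abs_logPot_smul_sub_le hε ε hρ (z - z'))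
    have l2 := abs_le.1 (hν.abs_logPot_smul_sub_le hε ε hρ (z' - z))
    have g1 := hG ε ε (x' + z) (x' + z')
    have g2 := hG ε ε (x' + z') (x' + z)
    have g3 := hG (ρ * ε) (ρ * ε) (x + ρ • z) (x + ρ • z')
    have g4 := hG (ρ * ε) (ρ * ε) (x + ρ • z') (x + ρ • z)
    rw [abs_le]
    constructor <;> linarith [g1.1, g1.2, g2.1, g2.2, g3.1, g3.2, g4.1, g4.2, l1.1, l1.2, l2.1,
      l2.2]

/-- Near a point the covariance is exactly scale invariant, up to a small error. -/
lemma exists_fieldCov_scaling (hg : IsBoundedMeasurable g) (hgc : Continuous (Function.uncurry g))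
    (hθ : IsMollifier θ) (hν : IsLogMollifier (mollifierMeasure θ) R c₀)
    (x : EuclideanSpace ℝ (Fin d)) {δ : ℝ} (hδ : 0 < δ) :
    ∃ r₀ ∈ Set.Ioc (0 : ℝ) 1, ∀ r ∈ Set.Ioc 0 r₀, ∀ r' ∈ Set.Ioc 0 r₀, ∀ ε ∈ Set.Ioc (0 : ℝ) 1,
      ∀ z ∈ Metric.ball (0 : EuclideanSpace ℝ (Fin d)) 1, ∀ z' ∈ Metric.ball 0 1,
      |fieldCov g θ (r * ε) (r * ε) (x + r • z) (x + r • z') + Real.log (r / r') -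
        fieldCov g θ (r' * ε) (r' * ε) (x + r' • z) (x + r' • z')| ≤ δ := by
  obtain ⟨B, hgb⟩ := hg.2
  have hR := hν.one_le
  obtain ⟨s, hs, h⟩ := Metric.continuousAt_iff.1 (hgc.continuousAt (x := (x, x))) (δ / 2)
    (by positivity)
  have hη : ∀ y z, dist y x ≤ s / 2 → dist z x ≤ s / 2 → |g y z - g x x| ≤ δ / 2 :=
    fun y z hy hz => by
      have := @h (y, z) (by
        rw [Prod.dist_eq]; exact max_lt (by linarith) (by linarith))
      exact this.le
  refine ⟨min (2 + 2 * R)⁻¹ (s / 2 * (1 + R)⁻¹), ⟨by positivity, (min_le_left _ _).trans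
    (inv_le_one_of_one_le₀ (by linarith))⟩, ?_⟩
  intro r hr r' hr' ε hε z hz z' hz'
  have hz1 := (mem_ball_zero_iff.1 hz).le
  have hz1' := (mem_ball_zero_iff.1 hz').le
  have key : ∀ r ∈ Set.Ioc 0 (min (2 + 2 * R)⁻¹ (s / 2 * (1 + R)⁻¹)),
      |fieldCov g θ (r * ε) (r * ε) (x + r • z) (x + r • z') - Real.log r⁻¹ -
      (((∫ p, (logPlus ((2 + 2 * R)⁻¹ • ((z - z') - ε • p.1 + ε • p.2)))
        ∂((mollifierMeasure θ).prod (mollifierMeasure θ))) - Real.log (2 + 2 * R)) +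
      ((∫ p, (logPlus ((2 + 2 * R)⁻¹ • ((z' - z) - ε • p.1 + ε • p.2)))
        ∂((mollifierMeasure θ).prod (mollifierMeasure θ))) - Real.log (2 + 2 * R))) / 2 - g x x|
        ≤ δ / 2 := by
    intro r hr
    have hr0 : 0 < r := hr.1
    have hr1 : r * (2 + 2 * R) ≤ 1 := by
      have := hr.2.trans (min_le_left _ _)
      rwa [← one_div, le_div_iff₀ (by positivity)] at this
    have hr2 : r * (1 + R) ≤ s / 2 := by
      have := hr.2.trans (min_le_right _ _)
      rwa [← div_eq_mul_inv, le_div_iff₀ (by positivity)] at this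
    have hd : ∀ w : EuclideanSpace ℝ (Fin d), ‖w‖ ≤ 1 →
        dist (x + r • w) x + r * ε * R ≤ s / 2 := fun w hw => by
      rw [dist_eq_norm, add_sub_cancel_left, norm_smul, Real.norm_of_nonneg hr0.le]
      have : r * ‖w‖ ≤ r * 1 := by gcongr
      have : r * ε * R ≤ r * 1 * R := by gcongr; exact hε.2
      linarith
    have hre := mul_pos hr0 hε.1
    rw [fieldCov_eq hg hθ hν hre hre, add_sub_add_left_eq_sub, add_sub_add_left_eq_sub,
      ← smul_sub, ← smul_sub,
      hν.logPot_smul_eq hε.1 hε.2 hε.1 hε.2 hr0 hr1 ((norm_sub_le _ _).trans (by linarith)),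
      hν.logPot_smul_eq hε.1 hε.2 hε.1 hε.2 hr0 hr1 ((norm_sub_le _ _).trans (by linarith))]
    have a1 := abs_le.1 (hν.abs_avgPot_sub_le hg.1 hgb hη hre.le hre.le (hd z hz1) (hd z' hz1'))
    have a2 := abs_le.1 (hν.abs_avgPot_sub_le hg.1 hgb hη hre.le hre.le (hd z' hz1') (hd z hz1))
    rw [abs_le]
    constructor <;> linarith [a1.1, a1.2, a2.1, a2.2]
  have k1 := abs_le.1 (key r hr)
  have k2 := abs_le.1 (key r' hr')
  rw [Real.log_div hr.1.ne' hr'.1.ne']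
  rw [Real.log_inv] at k1 k2
  rw [abs_le]
  constructor <;> linarith [k1.1, k1.2, k2.1, k2.2]

end FieldCov

lemma lintegral_exp_gaussianReal (v : ℝ≥0) :
    ∫⁻ y, ENNReal.ofReal (Real.exp y) ∂(gaussianReal 0 v) = ENNReal.ofReal (Real.exp (v / 2)) := by
  have hi := integrable_exp_mul_gaussianReal (μ := 0) (v := v) 1
  simp only [one_mul] at hi
  rw [← ofReal_integral_eq_lintegral_ofReal hi (ae_of_all _ fun _ => (Real.exp_pos _).le)]
  have := congrFun (mgf_fun_id_gaussianReal (μ := 0) (v := v)) 1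
  simp only [ProbabilityTheory.mgf, one_mul, zero_add, one_pow, mul_one] at this
  rw [this]

lemma IsGaussianFamily.isGaussField {Ω : Type*} [MeasurableSpace Ω] {P : Measure Ω}
    {X : ℝ → EuclideanSpace ℝ (Fin d) → Ω → ℝ}
    {Km : ℝ → ℝ → EuclideanSpace ℝ (Fin d) → EuclideanSpace ℝ (Fin d) → ℝ}
    (hX : IsGaussianFamily P X Km) :
    IsGaussField P (fun (t : Set.Ioc (0 : ℝ) 1 × EuclideanSpace ℝ (Fin d)) ω => X t.1 t.2 ω)
      (fun s t => (Km s.1 t.1 s.2 t.2 + Km t.1 s.1 t.2 s.2) / 2) where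
  meas := hX.1.comp (by fun_prop :
    Measurable fun p : (Set.Ioc (0 : ℝ) 1 × EuclideanSpace ℝ (Fin d)) × Ω =>
      ((p.1.1 : ℝ), p.1.2, p.2))
  symm s t := by rw [add_comm]
  mgf {ι} _ t l := by
    let e := (Fintype.equivFin ι).symm
    obtain ⟨v, hv, hmap⟩ := hX.2 (Fintype.card ι) (fun i => (t (e i)).1) (fun i => (t (e i)).2)
      (fun i => (t (e i)).1.2) (fun i => l (e i))
    have hXm : ∀ i, Measurable fun ω => X (t i).1 (t i).2 ω := fun i =>
      hX.1.comp (by fun_prop : Measurable fun ω : Ω => (((t i).1 : ℝ), (t i).2, ω))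
    have hm : Measurable fun ω => ∑ i, l (e i) * X (t (e i)).1 (t (e i)).2 ω :=
      Finset.measurable_fun_sum _ fun i _ => (hXm (e i)).const_mul _
    have h1 : ∀ ω, ∑ i, l i * X (t i).1 (t i).2 ω = ∑ i, l (e i) * X (t (e i)).1 (t (e i)).2 ω :=
      fun ω => (Equiv.sum_comp e fun i => l i * X (t i).1 (t i).2 ω).symm
    have h2 : ∑ i, ∑ j, l i * l j * ((Km (t i).1 (t j).1 (t i).2 (t j).2 +
        Km (t j).1 (t i).1 (t j).2 (t i).2) / 2) = v := by
      have e1 : ∑ i, ∑ j, l i * l j * Km (t i).1 (t j).1 (t i).2 (t j).2 = v := by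
        rw [hv, ← Equiv.sum_comp e]
        refine Finset.sum_congr rfl fun i _ => ?_
        rw [← Equiv.sum_comp e]
      have e2 : ∑ i, ∑ j, l i * l j * Km (t j).1 (t i).1 (t j).2 (t i).2 = v := by
        rw [Finset.sum_comm, ← e1]
        exact Finset.sum_congr rfl fun i _ => Finset.sum_congr rfl fun j _ => by ring
      calc _ = ∑ i, ∑ j, (l i * l j * Km (t i).1 (t j).1 (t i).2 (t j).2 / 2 +
            l i * l j * Km (t j).1 (t i).1 (t j).2 (t i).2 / 2) :=
            Finset.sum_congr rfl fun i _ => Finset.sum_congr rfl fun j _ => by ring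
        _ = (v : ℝ) := by
            simp only [Finset.sum_add_distrib, ← Finset.sum_div, e1, e2, add_halves]
    rw [h2, ← lintegral_exp_gaussianReal, ← hmap,
      lintegral_map (Real.measurable_exp.ennreal_ofReal) hm]
    simp only [h1]

/-- A mollified Gaussian field with uniform logarithmic covariance bounds. -/
structure IsLogField {Ω : Type*} [MeasurableSpace Ω] (P : Measure Ω)
    (X : ℝ → EuclideanSpace ℝ (Fin d) → Ω → ℝ)
    (k : ℝ → ℝ → EuclideanSpace ℝ (Fin d) → EuclideanSpace ℝ (Fin d) → ℝ) (c : ℝ) : Prop where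
  field : IsGaussField P (fun (t : Set.Ioc (0 : ℝ) 1 × EuclideanSpace ℝ (Fin d)) ω => X t.1 t.2 ω)
    (fun s t => k s.1 t.1 s.2 t.2)
  bounds : HasLogBounds k c

/-- The approximate chaos mass of a set, with unit weight. -/
def chaos {Ω : Type*} (γ : ℝ) (X : ℝ → EuclideanSpace ℝ (Fin d) → Ω → ℝ)
    (k : ℝ → ℝ → EuclideanSpace ℝ (Fin d) → EuclideanSpace ℝ (Fin d) → ℝ) (ε : ℝ)
    (A : Set (EuclideanSpace ℝ (Fin d))) (ω : Ω) : ℝ≥0∞ :=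
  expMass (volume.restrict A) (fun y ω => γ * X ε y ω) (fun y z => γ * γ * k ε ε y z) ω

lemma chaos_mono {Ω : Type*} {γ : ℝ} {X : ℝ → EuclideanSpace ℝ (Fin d) → Ω → ℝ}
    {k : ℝ → ℝ → EuclideanSpace ℝ (Fin d) → EuclideanSpace ℝ (Fin d) → ℝ} {ε : ℝ}
    {A B : Set (EuclideanSpace ℝ (Fin d))} (hAB : A ⊆ B) (ω : Ω) :
    chaos γ X k ε A ω ≤ chaos γ X k ε B ω :=
  lintegral_mono' (Measure.restrict_mono_set volume hAB) le_rfl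

/-- The structure function. -/
def structExp (d : ℕ) (γ q : ℝ) : ℝ := (d + γ ^ 2 / 2) * q - γ ^ 2 * q ^ 2 / 2

namespace IsLogField

variable {Ω : Type*} [MeasurableSpace Ω] {P : Measure Ω}
  {X : ℝ → EuclideanSpace ℝ (Fin d) → Ω → ℝ}
  {k : ℝ → ℝ → EuclideanSpace ℝ (Fin d) → EuclideanSpace ℝ (Fin d) → ℝ} {c γ ε r s : ℝ}

lemma field_comp (h : IsLogField P X k c) (γ : ℝ) (hε : ε ∈ Set.Ioc (0 : ℝ) 1) {S : Type*}
    [MeasurableSpace S] {φ : S → EuclideanSpace ℝ (Fin d)} (hφ : Measurable φ) :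
    IsGaussField P (fun z ω => γ * X ε (φ z) ω) (fun z z' => γ * γ * k ε ε (φ z) (φ z')) :=
  h.field.pull (ρ := fun z => (⟨ε, hε⟩, φ z)) (by fun_prop) (a := fun _ => γ) measurable_const

lemma field_eps (h : IsLogField P X k c) (γ : ℝ) (hε : ε ∈ Set.Ioc (0 : ℝ) 1) :
    IsGaussField P (fun y ω => γ * X ε y ω) (fun y z => γ * γ * k ε ε y z) :=
  h.field_comp γ hε measurable_id

lemma measurable_chaos (h : IsLogField P X k c) (γ : ℝ) (hε : ε ∈ Set.Ioc (0 : ℝ) 1)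
    (A : Set (EuclideanSpace ℝ (Fin d))) : Measurable (chaos γ X k ε A) :=
  (h.field_eps γ hε).measurable_expMass _

lemma lintegral_chaos (h : IsLogField P X k c) (γ : ℝ) (hε : ε ∈ Set.Ioc (0 : ℝ) 1)
    (A : Set (EuclideanSpace ℝ (Fin d))) : ∫⁻ ω, chaos γ X k ε A ω ∂P = volume A := by
  simpa [chaos] using (h.field_eps γ hε).lintegral_expMass (volume.restrict A)

lemma lintegral_exp_mul_chaos_le (h : IsLogField P X k c) (hγ : 0 ≤ γ) (hε : 0 < ε) (hεr : ε ≤ r)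
    (hr : r ≤ 1) {b : ℝ} (hb : 0 ≤ b) (x : EuclideanSpace ℝ (Fin d)) :
    ∫⁻ ω, ENNReal.ofReal (Real.exp (-b * X r x ω)) * chaos γ X k ε (Metric.ball x r) ω ∂P ≤
      volume (Metric.ball x r) * ENNReal.ofReal (Real.exp (b ^ 2 * (Real.log r⁻¹ + c) / 2 -
        b * γ * (Real.log r⁻¹ - c))) := by
  have hr0 : 0 < r := hε.trans_le hεr
  have hεI : ε ∈ Set.Ioc (0 : ℝ) 1 := ⟨hε, hεr.trans hr⟩
  have := h.field.isProbabilityMeasure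
  have hw := (h.field_eps γ hεI).measurable_wick
  have hm : Measurable fun ω => ENNReal.ofReal (Real.exp (-b * X r x ω)) :=
    (Real.measurable_exp.comp ((h.field.measurable (⟨r, hr0, hr⟩, x)).const_mul
      (-b))).ennreal_ofReal
  calc _ = ∫⁻ ω, (∫⁻ y in Metric.ball x r, ENNReal.ofReal (Real.exp (-b * X r x ω)) *
        ENNReal.ofReal (Real.exp (γ * X ε y ω - γ * γ * k ε ε y y / 2))) ∂P := by
        refine lintegral_congr fun ω => ?_
        rw [lintegral_const_mul' _ _ ENNReal.ofReal_ne_top]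
        rfl
    _ = ∫⁻ y in Metric.ball x r, ∫⁻ ω, ENNReal.ofReal (Real.exp (-b * X r x ω)) *
        ENNReal.ofReal (Real.exp (γ * X ε y ω - γ * γ * k ε ε y y / 2)) ∂P :=
        lintegral_lintegral_swap ((hm.comp measurable_fst).mul
          (hw.comp measurable_swap).ennreal_ofReal).aemeasurable
    _ ≤ ∫⁻ y in Metric.ball x r, ENNReal.ofReal (Real.exp (b ^ 2 * (Real.log r⁻¹ + c) / 2 -
        b * γ * (Real.log r⁻¹ - c))) := by
        refine setLIntegral_mono' measurableSet_ball fun y hy => ?_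
        have e : ∀ ω, ENNReal.ofReal (Real.exp (-b * X r x ω)) *
            ENNReal.ofReal (Real.exp (γ * X ε y ω - γ * γ * k ε ε y y / 2)) =
            ENNReal.ofReal (Real.exp (-(γ * γ * k ε ε y y / 2))) *
            ENNReal.ofReal (Real.exp (-b * X r x ω + γ * X ε y ω)) := fun ω => by
          rw [← ENNReal.ofReal_mul (Real.exp_pos _).le, ← ENNReal.ofReal_mul (Real.exp_pos _).le,
            ← Real.exp_add, ← Real.exp_add]
          ring_nf
        simp only [e]
        rw [lintegral_const_mul' _ _ ENNReal.ofReal_ne_top,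
          h.field.lintegral_exp_add (⟨r, hr0, hr⟩, x) (⟨ε, hεI⟩, y) (-b) γ,
          ← ENNReal.ofReal_mul (Real.exp_pos _).le, ← Real.exp_add]
        apply ENNReal.ofReal_le_ofReal
        apply Real.exp_le_exp.2
        have h1 := h.bounds.le (y := x) (z := x) hr0 hr0 (le_max_right _ _)
        rw [max_eq_left (Real.log_nonneg ((one_le_inv₀ hr0).2 hr))] at h1
        have h2 := h.bounds.log_le (ε := r) (ε' := ε) (y := x) (z := y) hr0 hε le_rfl hεr
          (by rw [dist_comm]; exact (Metric.mem_ball.1 hy).le)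
        have h3 := mul_le_mul_of_nonneg_left h1 (sq_nonneg b)
        have h4 := mul_le_mul_of_nonneg_left h2 (mul_nonneg hb hγ)
        dsimp only
        nlinarith
    _ = _ := by rw [lintegral_const, Measure.restrict_apply_univ, mul_comm]

end IsLogField

/-- The volume of the unit ball. -/
def unitVol (d : ℕ) : ℝ := (volume (Metric.ball (0 : EuclideanSpace ℝ (Fin d)) 1)).toReal

lemma unitVol_pos : 0 < unitVol d :=
  ENNReal.toReal_pos (Metric.measure_ball_pos volume _ one_pos).ne' measure_ball_lt_top.ne

lemma volume_ball_eq {r : ℝ} (hr : 0 < r) (x : EuclideanSpace ℝ (Fin d)) :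
    volume (Metric.ball x r) = ENNReal.ofReal (r ^ (d : ℝ) * unitVol d) := by
  rw [Measure.addHaar_ball_of_pos _ _ hr, finrank_euclideanSpace, Fintype.card_fin,
    ENNReal.ofReal_mul (by positivity), Real.rpow_natCast, unitVol,
    ENNReal.ofReal_toReal measure_ball_lt_top.ne]

/-- Multifractal upper bounds on the moments of order `s` up to the scale `R`. -/
def HasMomentBound {Ω : Type*} [MeasurableSpace Ω] (P : Measure Ω) (γ : ℝ)
    (X : ℝ → EuclideanSpace ℝ (Fin d) → Ω → ℝ)
    (k : ℝ → ℝ → EuclideanSpace ℝ (Fin d) → EuclideanSpace ℝ (Fin d) → ℝ) (s R : ℝ) : Prop :=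
  ∃ C : ℝ, 0 ≤ C ∧ ∀ (ε r : ℝ) (x : EuclideanSpace ℝ (Fin d)), 0 < ε → ε ≤ r → r ≤ R →
    ∫⁻ ω, chaos γ X k ε (Metric.ball x r) ω ^ s ∂P ≤ ENNReal.ofReal (C * r ^ structExp d γ s)

namespace IsLogField

variable {Ω : Type*} [MeasurableSpace Ω] {P : Measure Ω}
  {X : ℝ → EuclideanSpace ℝ (Fin d) → Ω → ℝ}
  {k : ℝ → ℝ → EuclideanSpace ℝ (Fin d) → EuclideanSpace ℝ (Fin d) → ℝ} {c γ ε r s R : ℝ}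

lemma hasMomentBound_of_le_one (h : IsLogField P X k c) (hγ : 0 ≤ γ) (hs : 0 < s) (hs1 : s ≤ 1) :
    HasMomentBound P γ X k s 1 := by
  set b := γ * (1 - s) with hb
  have hb0 : 0 ≤ b := mul_nonneg hγ (by linarith)
  have hV := unitVol_pos (d := d)
  refine ⟨unitVol d ^ s * Real.exp (s * (b ^ 2 * c / 2 + b * γ * c) +
    (1 - s) * ((s * γ) ^ 2 * c / 2)), by positivity, fun ε r x hε hεr hr => ?_⟩
  have hr0 : 0 < r := hε.trans_le hεr
  have hεI : ε ∈ Set.Ioc (0 : ℝ) 1 := ⟨hε, hεr.trans hr⟩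
  have hN : Measurable (X r x) := h.field.measurable (⟨r, hr0, hr⟩, x)
  have hM := h.measurable_chaos γ hεI (Metric.ball x r)
  have e : ∀ ω, chaos γ X k ε (Metric.ball x r) ω ^ s =
      (ENNReal.ofReal (Real.exp (-b * X r x ω)) * chaos γ X k ε (Metric.ball x r) ω) ^ s *
        ENNReal.ofReal (Real.exp (s * γ * X r x ω)) ^ (1 - s) := fun ω => by
    rw [ENNReal.mul_rpow_of_nonneg _ _ hs.le, mul_right_comm,
      ENNReal.ofReal_rpow_of_pos (Real.exp_pos _), ENNReal.ofReal_rpow_of_pos (Real.exp_pos _),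
      ← ENNReal.ofReal_mul (by positivity), ← Real.exp_mul, ← Real.exp_mul, ← Real.exp_add]
    have : -b * X r x ω * s + s * γ * X r x ω * (1 - s) = 0 := by rw [hb]; ring
    rw [this, Real.exp_zero, ENNReal.ofReal_one, one_mul]
  have h1 := h.lintegral_exp_mul_chaos_le hγ hε hεr hr hb0 x
  have h2 : ∫⁻ ω, ENNReal.ofReal (Real.exp (s * γ * X r x ω)) ∂P ≤
      ENNReal.ofReal (Real.exp ((s * γ) ^ 2 * (Real.log r⁻¹ + c) / 2)) := by
    rw [h.field.lintegral_exp (⟨r, hr0, hr⟩, x) (s * γ)]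
    apply ENNReal.ofReal_le_ofReal
    gcongr
    have := h.bounds.le (y := x) (z := x) hr0 hr0 (le_max_right _ _)
    rwa [max_eq_left (Real.log_nonneg ((one_le_inv₀ hr0).2 hr))] at this
  calc _ = ∫⁻ ω, (ENNReal.ofReal (Real.exp (-b * X r x ω)) *
        chaos γ X k ε (Metric.ball x r) ω) ^ s *
        ENNReal.ofReal (Real.exp (s * γ * X r x ω)) ^ (1 - s) ∂P := lintegral_congr e
    _ ≤ _ := ENNReal.lintegral_mul_norm_pow_le
        (((Real.measurable_exp.comp (hN.const_mul (-b))).ennreal_ofReal.mul hM).aemeasurable)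
        (Real.measurable_exp.comp (hN.const_mul (s * γ))).ennreal_ofReal.aemeasurable hs.le
        (by linarith) (by ring)
    _ ≤ (volume (Metric.ball x r) * ENNReal.ofReal (Real.exp (b ^ 2 * (Real.log r⁻¹ + c) / 2 -
        b * γ * (Real.log r⁻¹ - c)))) ^ s *
        ENNReal.ofReal (Real.exp ((s * γ) ^ 2 * (Real.log r⁻¹ + c) / 2)) ^ (1 - s) :=
        mul_le_mul' (ENNReal.rpow_le_rpow h1 hs.le) (ENNReal.rpow_le_rpow h2 (by linarith))
    _ = _ := by
        rw [volume_ball_eq hr0, ← ENNReal.ofReal_mul (by positivity),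
          ENNReal.ofReal_rpow_of_pos (by positivity), ENNReal.ofReal_rpow_of_pos (by positivity),
          ← ENNReal.ofReal_mul (by positivity)]
        congr 1
        rw [Real.mul_rpow (by positivity) (by positivity),
          Real.mul_rpow (by positivity) (by positivity), ← Real.exp_mul, ← Real.exp_mul,
          ← Real.rpow_mul hr0.le, Real.log_inv, Real.rpow_def_of_pos hr0,
          Real.rpow_def_of_pos hr0 (structExp d γ s), mul_comm (Real.exp _) (unitVol d ^ s), hb,
          structExp]
        simp only [mul_assoc, ← Real.exp_add]
        congr 2
        ring

end IsLogField

/-- A weighted power-mean bound for finite sums. -/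
lemma sum_rpow_le_geometric {s : ℝ} (hs : 0 < s) {t : ℝ≥0} (ht : t ≠ 0) (a : ℕ → ℝ≥0∞)
    (N : ℕ) : (∑ n ∈ Finset.range N, a n) ^ s ≤
      ((1 - (t : ℝ≥0∞))⁻¹) ^ s * ∑ n ∈ Finset.range N, (((t : ℝ≥0∞) ^ n)⁻¹ * a n) ^ s := by
  set S := ∑ n ∈ Finset.range N, (((t : ℝ≥0∞) ^ n)⁻¹ * a n) ^ s with hS
  have h : ∀ n ∈ Finset.range N, a n ≤ (t : ℝ≥0∞) ^ n * S ^ s⁻¹ := fun n hn => by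
    have h1 : (((t : ℝ≥0∞) ^ n)⁻¹ * a n) ^ s ≤ S :=
      Finset.single_le_sum (f := fun n => (((t : ℝ≥0∞) ^ n)⁻¹ * a n) ^ s) (fun _ _ => bot_le) hn
    have h2 := ENNReal.rpow_le_rpow h1 (inv_nonneg.2 hs.le)
    rw [ENNReal.rpow_rpow_inv hs.ne'] at h2
    have t0 : (t : ℝ≥0∞) ^ n ≠ 0 := pow_ne_zero _ (by simpa using ht)
    have t1 : (t : ℝ≥0∞) ^ n ≠ ⊤ := ENNReal.pow_ne_top ENNReal.coe_ne_top
    calc a n = (t : ℝ≥0∞) ^ n * (((t : ℝ≥0∞) ^ n)⁻¹ * a n) := by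
          rw [← mul_assoc, ENNReal.mul_inv_cancel t0 t1, one_mul]
      _ ≤ _ := by gcongr
  calc _ ≤ ((1 - (t : ℝ≥0∞))⁻¹ * S ^ s⁻¹) ^ s := by
        refine ENNReal.rpow_le_rpow ((Finset.sum_le_sum h).trans ?_) hs.le
        rw [← Finset.sum_mul]
        gcongr
        rw [← ENNReal.tsum_geometric]
        exact ENNReal.sum_le_tsum _
    _ = _ := by
        rw [ENNReal.mul_rpow_of_nonneg _ _ hs.le, ENNReal.rpow_inv_rpow hs.ne']

/-- Moments of order `s + 1` of the mass through the Cameron–Martin formula. -/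
lemma IsGaussField.lintegral_expMass_rpow_add_one {T Ω : Type*} [MeasurableSpace T]
    [MeasurableSpace Ω] {P : Measure Ω} {Z : T → Ω → ℝ} {C : T → T → ℝ}
    (hZ : IsGaussField P Z C) (μ : Measure T) [IsFiniteMeasure μ] {B : ℝ} (hB : ∀ s t, C s t ≤ B)
    {s : ℝ} (hs : 0 ≤ s) :
    ∫⁻ ω, expMass μ Z C ω ^ (s + 1) ∂P = ∫⁻ t, (∫⁻ ω,
      (∫⁻ u, ENNReal.ofReal (Real.exp (Z u ω - C u u / 2 + C u t)) ∂μ) ^ s ∂P) ∂μ := by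
  have := hZ.isProbabilityMeasure
  have hm := hZ.measurable_expMass μ
  have hw := hZ.measurable_wick
  calc _ = ∫⁻ ω, (∫⁻ t, tilt Z C t 1 ω * expMass μ Z C ω ^ s ∂μ) ∂P := by
        refine lintegral_congr fun ω => ?_
        have : Measurable fun t => tilt Z C t 1 ω := by
          unfold tilt
          simpa using (hw.comp (measurable_prodMk_right (y := ω))).ennreal_ofReal
        rw [lintegral_mul_const _ this, ENNReal.rpow_add_of_nonneg _ _ hs zero_le_one,
          ENNReal.rpow_one, mul_comm]
        congr 1
        refine lintegral_congr fun t => ?_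
        simp [tilt]
    _ = ∫⁻ t, (∫⁻ ω, tilt Z C t 1 ω * expMass μ Z C ω ^ s ∂P) ∂μ := by
        refine lintegral_lintegral_swap (Measurable.aemeasurable (.mul ?_
          ((hm.pow_const s).comp measurable_fst)))
        unfold tilt
        simp only [one_mul, one_pow]
        exact (hw.comp measurable_swap).ennreal_ofReal
    _ = _ := lintegral_congr fun t =>
        hZ.lintegral_tilt_mul_expMass_rpow μ t (ae_of_all _ fun u => hB u t) s

namespace IsLogField

variable {Ω : Type*} [MeasurableSpace Ω] {P : Measure Ω}
  {X : ℝ → EuclideanSpace ℝ (Fin d) → Ω → ℝ}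
  {k : ℝ → ℝ → EuclideanSpace ℝ (Fin d) → EuclideanSpace ℝ (Fin d) → ℝ} {c γ ε r s R : ℝ}

/-- Decomposition into dyadic annuli of the mass seen from a typical point. -/
lemma lintegral_wick_mul_le_sum (h : IsLogField P X k c) (hε : 0 < ε) (hεr : ε ≤ r)
    (hr : 2 * r ≤ 1) {x y : EuclideanSpace ℝ (Fin d)} (hy : y ∈ Metric.ball x r) {N : ℕ}
    (hN : 2 * r * (1 / 2) ^ (N + 1) ≤ ε) (ω : Ω) :
    ∫⁻ z in Metric.ball x r, ENNReal.ofReal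
        (Real.exp (γ * X ε z ω - γ * γ * k ε ε z z / 2 + γ * γ * k ε ε z y)) ≤
      ∑ n ∈ Finset.range (N + 1),
        ENNReal.ofReal (Real.exp (γ * γ * (Real.log (2 * r * (1 / 2) ^ (n + 1))⁻¹ + c))) *
          chaos γ X k ε (Metric.ball y (2 * r * (1 / 2) ^ n)) ω := by
  have hr0 : 0 < r := hε.trans_le hεr
  have hεI : ε ∈ Set.Ioc (0 : ℝ) 1 := ⟨hε, by linarith⟩
  set w : EuclideanSpace ℝ (Fin d) → ℝ≥0∞ := fun z =>
    ENNReal.ofReal (Real.exp (γ * X ε z ω - γ * γ * k ε ε z z / 2)) with hw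
  have hwm : Measurable w :=
    ((h.field_eps γ hεI).measurable_wick.comp (measurable_prodMk_right (y := ω))).ennreal_ofReal
  have hρ : ∀ n : ℕ, 0 < 2 * r * (1 / 2) ^ n := fun n => by positivity
  have hρ1 : ∀ n : ℕ, 2 * r * (1 / 2) ^ n ≤ 1 := fun n =>
    mul_le_one₀ hr (by positivity) (pow_le_one₀ (by norm_num) (by norm_num))
  have key : ∀ z ∈ Metric.ball x r, ENNReal.ofReal
      (Real.exp (γ * X ε z ω - γ * γ * k ε ε z z / 2 + γ * γ * k ε ε z y)) ≤
      ∑ n ∈ Finset.range (N + 1),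
        ENNReal.ofReal (Real.exp (γ * γ * (Real.log (2 * r * (1 / 2) ^ (n + 1))⁻¹ + c))) *
          (Metric.ball y (2 * r * (1 / 2) ^ n)).indicator w z := by
    intro z hz
    obtain ⟨n, hn, hn1, hn2⟩ : ∃ n ≤ N, dist z y < 2 * r * (1 / 2) ^ n ∧
        2 * r * (1 / 2) ^ (n + 1) ≤ max (dist z y) ε := by
      have h0 : dist z y < 2 * r * (1 / 2) ^ 0 := by
        have := dist_triangle_right z y x
        have h1 := Metric.mem_ball.1 hz
        have h2 := Metric.mem_ball.1 hy
        linarith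
      by_contra! hcon
      have : ∀ n ≤ N, dist z y < 2 * r * (1 / 2) ^ n := by
        intro n
        induction n with
        | zero => exact fun _ => h0
        | succ m ih =>
          intro hm
          exact (le_max_left _ _).trans_lt (hcon m (by omega) (ih (by omega)))
      exact absurd ((le_max_right _ _).trans_lt (hcon N le_rfl (this N le_rfl))) (not_lt.2 hN)
    refine le_trans ?_ (Finset.single_le_sum (fun _ _ => bot_le)
      (Finset.mem_range.2 (Nat.lt_succ_of_le hn)))
    rw [Set.indicator_of_mem (Metric.mem_ball.2 hn1), hw, ← ENNReal.ofReal_mul (by positivity),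
      ← Real.exp_add, add_comm]
    apply ENNReal.ofReal_le_ofReal
    have h1 := h.bounds.le hε (hρ (n + 1)) hn2
    rw [max_eq_left (Real.log_nonneg ((one_le_inv₀ (hρ _)).2 (hρ1 _)))] at h1
    have := mul_le_mul_of_nonneg_left h1 (mul_self_nonneg γ)
    gcongr
  calc _ ≤ ∫⁻ z in Metric.ball x r, ∑ n ∈ Finset.range (N + 1),
        ENNReal.ofReal (Real.exp (γ * γ * (Real.log (2 * r * (1 / 2) ^ (n + 1))⁻¹ + c))) *
          (Metric.ball y (2 * r * (1 / 2) ^ n)).indicator w z :=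
        setLIntegral_mono' measurableSet_ball key
    _ ≤ ∫⁻ z, ∑ n ∈ Finset.range (N + 1),
        ENNReal.ofReal (Real.exp (γ * γ * (Real.log (2 * r * (1 / 2) ^ (n + 1))⁻¹ + c))) *
          (Metric.ball y (2 * r * (1 / 2) ^ n)).indicator w z :=
        lintegral_mono' Measure.restrict_le_self le_rfl
    _ = _ := by
        rw [lintegral_finsetSum _ fun n _ => (hwm.indicator measurableSet_ball).const_mul _]
        refine Finset.sum_congr rfl fun n _ => ?_
        rw [lintegral_const_mul' _ _ ENNReal.ofReal_ne_top, lintegral_indicator measurableSet_ball]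
        rfl

/-- A moment bound of order `s` yields a moment bound of order `s + 1` in the subcritical range. -/
lemma hasMomentBound_add_one (h : IsLogField P X k c) (hs : 0 < s)
    (hR : R ≤ 1) (hsub : γ ^ 2 * (s + 1) < 2 * d) (hM : HasMomentBound P γ X k s R) :
    HasMomentBound P γ X k (s + 1) (R / 2) := by
  obtain ⟨C, hC, hM⟩ := hM
  set κ : ℝ := structExp d γ s - γ ^ 2 * s with hκ
  have hκ0 : 0 < κ := by
    have : κ = s * ((2 * d - γ ^ 2 * (s + 1)) / 2) := by rw [hκ, structExp]; ring
    rw [this]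
    exact mul_pos hs (by linarith)
  set L : ℝ := Real.log 2 with hL
  have hL0 : 0 < L := Real.log_pos (by norm_num)
  set τ : ℝ := Real.exp (-(κ / (2 * s) * L)) with hτ
  have hτ1 : τ < 1 := Real.exp_zero ▸ Real.exp_lt_exp.2 (by
    have := mul_pos (div_pos hκ0 (by positivity : 0 < 2 * s)) hL0
    linarith)
  set u : ℝ := Real.exp (-(κ / 2 * L)) with hu
  have hu1 : u < 1 := Real.exp_zero ▸ Real.exp_lt_exp.2 (by
    have := mul_pos (half_pos hκ0) hL0
    linarith)
  set t : ℝ≥0 := ⟨τ, (Real.exp_pos _).le⟩ with ht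
  have htt : (t : ℝ≥0∞) = ENNReal.ofReal τ := by
    rw [ENNReal.ofReal, Real.toNNReal_of_nonneg (Real.exp_pos _).le]
    rfl
  have ht0 : t ≠ 0 := fun h0 => (Real.exp_pos _).ne' (congrArg NNReal.toReal h0)
  set A : ℝ≥0∞ := (1 - (t : ℝ≥0∞))⁻¹ ^ s with hA
  have hAtop : A ≠ ⊤ := by
    refine ENNReal.rpow_ne_top_of_nonneg hs.le (ENNReal.inv_ne_top.2 ?_)
    rw [htt]
    exact (tsub_pos_of_lt (ENNReal.ofReal_lt_one.2 hτ1)).ne'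
  set K : ℝ := C * Real.exp (γ ^ 2 * s * c + γ ^ 2 * s * L + κ * L) with hK
  have hK0 : 0 ≤ K := mul_nonneg hC (Real.exp_pos _).le
  refine ⟨unitVol d * (A.toReal * (K * (1 - u)⁻¹)), ?_, fun ε r x hε hεr hr => ?_⟩
  · have := unitVol_pos (d := d)
    have : 0 ≤ (1 - u)⁻¹ := inv_nonneg.2 (by linarith)
    positivity
  have hr0 : 0 < r := hε.trans_le hεr
  have hεI : ε ∈ Set.Ioc (0 : ℝ) 1 := ⟨hε, by linarith⟩
  obtain ⟨N, hN1, hN2⟩ := exists_nat_pow_near_of_lt_one (x := ε / (2 * r)) (y := 1 / 2)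
    (by positivity) ((div_le_one (by positivity)).2 (by linarith)) (by norm_num) (by norm_num)
  rw [lt_div_iff₀' (by positivity)] at hN1
  rw [div_le_iff₀' (by positivity)] at hN2
  have hB : ∀ y z, γ * γ * k ε ε y z ≤ γ * γ * (Real.log ε⁻¹ + c) := fun y z => by
    have h1 := h.bounds.le (y := y) (z := z) hε hε (le_max_right _ _)
    rw [max_eq_left (Real.log_nonneg ((one_le_inv₀ hε).2 hεI.2))] at h1
    exact mul_le_mul_of_nonneg_left h1 (mul_self_nonneg γ)
  have hfin : IsFiniteMeasure (volume.restrict (Metric.ball x r)) :=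
    ⟨by rw [Measure.restrict_apply_univ]; exact measure_ball_lt_top⟩
  have hmain : ∀ y ∈ Metric.ball x r, ∫⁻ ω, (∫⁻ z in Metric.ball x r, ENNReal.ofReal
        (Real.exp (γ * X ε z ω - γ * γ * k ε ε z z / 2 + γ * γ * k ε ε z y))) ^ s ∂P ≤
      ENNReal.ofReal (A.toReal * (K * (1 - u)⁻¹) * r ^ κ) := by
    intro y hy
    have hterm : ∀ n ∈ Finset.range (N + 1), ∫⁻ ω, (((t : ℝ≥0∞) ^ n)⁻¹ * (ENNReal.ofReal
        (Real.exp (γ * γ * (Real.log (2 * r * (1 / 2) ^ (n + 1))⁻¹ + c))) *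
          chaos γ X k ε (Metric.ball y (2 * r * (1 / 2) ^ n)) ω)) ^ s ∂P ≤
        ENNReal.ofReal (K * r ^ κ * u ^ n) := by
      intro n hn
      have hn' : n ≤ N := Nat.lt_succ_iff.1 (Finset.mem_range.1 hn)
      have h1 : ((t : ℝ≥0∞) ^ n)⁻¹ = ENNReal.ofReal ((τ ^ n)⁻¹) := by
        rw [htt, ENNReal.ofReal_inv_of_pos (pow_pos (Real.exp_pos _) n),
          ENNReal.ofReal_pow (Real.exp_pos _).le]
      have hεn : ε ≤ 2 * r * (1 / 2) ^ n := hN2.trans (by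
        have := pow_le_pow_of_le_one (by norm_num : (0 : ℝ) ≤ 1 / 2) (by norm_num) hn'
        gcongr)
      have hnR : 2 * r * (1 / 2) ^ n ≤ R := by
        have : 2 * r * (1 / 2) ^ n ≤ 2 * r * 1 := by
          gcongr
          exact pow_le_one₀ (by norm_num) (by norm_num)
        linarith
      have h2 := hM ε _ y hε hεn hnR
      have hτn : 0 ≤ (τ ^ n)⁻¹ := (inv_pos.2 (pow_pos (Real.exp_pos _) n)).le
      calc _ = ∫⁻ ω, ENNReal.ofReal (((τ ^ n)⁻¹ * Real.exp (γ * γ *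
            (Real.log (2 * r * (1 / 2) ^ (n + 1))⁻¹ + c))) ^ s) *
            chaos γ X k ε (Metric.ball y (2 * r * (1 / 2) ^ n)) ω ^ s ∂P := by
            refine lintegral_congr fun ω => ?_
            rw [← mul_assoc, h1, ← ENNReal.ofReal_mul hτn, ENNReal.mul_rpow_of_nonneg _ _ hs.le,
              ENNReal.ofReal_rpow_of_nonneg (mul_nonneg hτn (Real.exp_pos _).le) hs.le]
        _ ≤ _ := by
            rw [lintegral_const_mul' _ _ ENNReal.ofReal_ne_top]
            refine (mul_le_mul_right h2 _).trans (le_of_eq ?_)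
            rw [← ENNReal.ofReal_mul (Real.rpow_nonneg (mul_nonneg hτn (Real.exp_pos _).le) _)]
            congr 1
            have hlog : ∀ m : ℕ, Real.log (2 * r * (1 / 2) ^ m) = L + Real.log r - m * L :=
              fun m => by
                rw [Real.log_mul (by positivity) (by positivity),
                  Real.log_mul (by norm_num) hr0.ne',
                  Real.log_pow, one_div, Real.log_inv]
                ring
            rw [Real.log_inv, hlog, Real.rpow_def_of_pos (by positivity : 0 < 2 * r * (1 / 2) ^ n),
              hlog, Real.rpow_def_of_pos hr0, hτ, hu, ← Real.exp_nat_mul, ← Real.exp_nat_mul,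
              ← Real.exp_neg, ← Real.exp_add, ← Real.exp_mul, hK, mul_left_comm]
            simp only [mul_assoc, ← Real.exp_add]
            congr 2
            push_cast
            field_simp
            rw [hκ]
            ring
    calc _ ≤ ∫⁻ ω, A * ∑ n ∈ Finset.range (N + 1), (((t : ℝ≥0∞) ^ n)⁻¹ * (ENNReal.ofReal
        (Real.exp (γ * γ * (Real.log (2 * r * (1 / 2) ^ (n + 1))⁻¹ + c))) *
          chaos γ X k ε (Metric.ball y (2 * r * (1 / 2) ^ n)) ω)) ^ s ∂P :=
          lintegral_mono fun ω => (ENNReal.rpow_le_rpow (h.lintegral_wick_mul_le_sum hε hεr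
            (by linarith) hy hN1.le ω) hs.le).trans (sum_rpow_le_geometric hs ht0 _ _)
      _ = A * ∑ n ∈ Finset.range (N + 1), ∫⁻ ω, (((t : ℝ≥0∞) ^ n)⁻¹ * (ENNReal.ofReal
        (Real.exp (γ * γ * (Real.log (2 * r * (1 / 2) ^ (n + 1))⁻¹ + c))) *
          chaos γ X k ε (Metric.ball y (2 * r * (1 / 2) ^ n)) ω)) ^ s ∂P := by
          rw [lintegral_const_mul' _ _ hAtop, lintegral_finsetSum]
          exact fun n _ => (((h.measurable_chaos γ hεI _).const_mul _).const_mul _).pow_const s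
      _ ≤ A * ∑ n ∈ Finset.range (N + 1), ENNReal.ofReal (K * r ^ κ * u ^ n) := by
          gcongr with n hn
          exact hterm n hn
      _ ≤ _ := by
          have hrκ : 0 ≤ K * r ^ κ := by positivity
          rw [← ENNReal.ofReal_sum_of_nonneg fun n _ =>
            mul_nonneg hrκ (pow_nonneg (Real.exp_pos _).le n), ← Finset.mul_sum,
            ← ENNReal.ofReal_toReal hAtop, ← ENNReal.ofReal_mul ENNReal.toReal_nonneg,
            ENNReal.ofReal_toReal hAtop]
          apply ENNReal.ofReal_le_ofReal
          rw [mul_assoc A.toReal, mul_right_comm K]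
          refine mul_le_mul_of_nonneg_left (mul_le_mul_of_nonneg_right
            (mul_le_mul_of_nonneg_left ?_ hK0) (Real.rpow_nonneg hr0.le _)) ENNReal.toReal_nonneg
          exact (Summable.sum_le_tsum _ (fun n _ => pow_nonneg (Real.exp_pos _).le n)
            (summable_geometric_of_lt_one (Real.exp_pos _).le hu1)).trans_eq
            (tsum_geometric_of_lt_one (Real.exp_pos _).le hu1)
  calc _ = _ := (h.field_eps γ hεI).lintegral_expMass_rpow_add_one
        (volume.restrict (Metric.ball x r)) hB hs.le
    _ ≤ ∫⁻ y in Metric.ball x r, ENNReal.ofReal (A.toReal * (K * (1 - u)⁻¹) * r ^ κ) :=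
        setLIntegral_mono' measurableSet_ball hmain
    _ = _ := by
        rw [lintegral_const, Measure.restrict_apply_univ, volume_ball_eq hr0,
          ← ENNReal.ofReal_mul' (by have := unitVol_pos (d := d); positivity)]
        congr 1
        have : structExp d γ (s + 1) = κ + d := by rw [hκ, structExp, structExp]; ring
        rw [this, Real.rpow_add hr0]
        ring

/-- Multifractal moment bounds in the whole subcritical range. -/
lemma exists_hasMomentBound (h : IsLogField P X k c) (hγ : 0 ≤ γ) (hs : 0 < s)
    (hsub : γ ^ 2 * s < 2 * d) : ∃ R, 0 < R ∧ R ≤ 1 ∧ HasMomentBound P γ X k s R := by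
  have key : ∀ (m : ℕ) (s : ℝ), 0 < s → s ≤ m + 1 → γ ^ 2 * s < 2 * d →
      ∃ R, 0 < R ∧ R ≤ 1 ∧ HasMomentBound P γ X k s R := by
    intro m
    induction m with
    | zero => exact fun s hs hs1 _ =>
        ⟨1, one_pos, le_rfl, h.hasMomentBound_of_le_one hγ hs (by simpa using hs1)⟩
    | succ m ih =>
      intro s hs hs1 hsub
      rcases le_or_gt s 1 with h1 | h1
      · exact ⟨1, one_pos, le_rfl, h.hasMomentBound_of_le_one hγ hs h1⟩
      push_cast at hs1
      obtain ⟨R, hR0, hR1, hR⟩ := ih (s - 1) (by linarith) (by linarith)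
        (lt_of_le_of_lt (mul_le_mul_of_nonneg_left (by linarith) (sq_nonneg γ)) hsub)
      have := h.hasMomentBound_add_one (s := s - 1) (by linarith) hR1 (by simpa using hsub) hR
      rw [sub_add_cancel] at this
      exact ⟨R / 2, by linarith, by linarith, this⟩
  obtain ⟨m, hm⟩ := exists_nat_ge s
  exact key m s hs (by linarith) hsub

end IsLogField

lemma setLIntegral_ball_eq {r : ℝ} (hr : 0 < r) (x : EuclideanSpace ℝ (Fin d))
    (F : EuclideanSpace ℝ (Fin d) → ℝ≥0∞) :
    ∫⁻ y in Metric.ball x r, F y =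
      ENNReal.ofReal (r ^ d) * ∫⁻ z in Metric.ball 0 1, F (x + r • z) := by
  have he : MeasurableEmbedding fun z : EuclideanSpace ℝ (Fin d) => x + r • z :=
    ((Homeomorph.smulOfNeZero r hr.ne').trans (Homeomorph.addLeft x)).measurableEmbedding
  have hmap : Measure.map (fun z : EuclideanSpace ℝ (Fin d) => x + r • z) volume =
      ENNReal.ofReal (r ^ d)⁻¹ • volume := by
    have : (fun z : EuclideanSpace ℝ (Fin d) => x + r • z) = (fun y => x + y) ∘ (r • ·) := rfl
    rw [this, ← Measure.map_map (by fun_prop) (by fun_prop),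
      Measure.map_addHaar_smul _ hr.ne', finrank_euclideanSpace, Fintype.card_fin,
      abs_of_pos (by positivity), Measure.map_smul, map_add_left_eq_self]
  have hpre : (fun z : EuclideanSpace ℝ (Fin d) => x + r • z) ⁻¹' Metric.ball x r =
      Metric.ball 0 1 := by
    ext z
    simp only [Set.mem_preimage, Metric.mem_ball, dist_self_add_left, dist_zero_right, norm_smul,
      Real.norm_of_nonneg hr.le]
    rw [mul_lt_iff_lt_one_right hr]
  have h1 : ∫⁻ z in Metric.ball 0 1, F (x + r • z) =
      ENNReal.ofReal (r ^ d)⁻¹ * ∫⁻ y in Metric.ball x r, F y := by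
    rw [← hpre, ← he.lintegral_map, ← he.restrict_map, hmap, Measure.restrict_smul,
      lintegral_smul_measure, smul_eq_mul]
  rw [h1, ← mul_assoc, ← ENNReal.ofReal_mul (by positivity), mul_inv_cancel₀ (by positivity),
    ENNReal.ofReal_one, one_mul]

lemma ennreal_mul_rpow {a : ℝ≥0∞} (h0 : a ≠ 0) (ht : a ≠ ⊤) (b : ℝ≥0∞) (s : ℝ) :
    (a * b) ^ s = a ^ s * b ^ s := by
  rw [ENNReal.mul_rpow_eq_ite]
  simp [h0, ht]

lemma chaos_ball_eq {Ω : Type*} {X : ℝ → EuclideanSpace ℝ (Fin d) → Ω → ℝ}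
    {k : ℝ → ℝ → EuclideanSpace ℝ (Fin d) → EuclideanSpace ℝ (Fin d) → ℝ} {γ ε r : ℝ} (hr : 0 < r)
    (x : EuclideanSpace ℝ (Fin d)) (ω : Ω) :
    chaos γ X k ε (Metric.ball x r) ω = ENNReal.ofReal (r ^ d) *
      expMass (volume.restrict (Metric.ball 0 1)) (fun z ω => γ * X ε (x + r • z) ω)
        (fun z z' => γ * γ * k ε ε (x + r • z) (x + r • z')) ω :=
  setLIntegral_ball_eq hr x _

namespace IsLogField

variable {Ω : Type*} [MeasurableSpace Ω] {P : Measure Ω}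
  {X : ℝ → EuclideanSpace ℝ (Fin d) → Ω → ℝ}
  {k : ℝ → ℝ → EuclideanSpace ℝ (Fin d) → EuclideanSpace ℝ (Fin d) → ℝ} {c γ ε r s R : ℝ}

/-- Comparison of the mass of a ball with the sum of two independent copies of smaller masses. -/
lemma exists_lintegral_chaos_rpow_le_add (h : IsLogField P X k c) (hd : 1 ≤ d) :
    ∃ D₀ : ℝ, 0 ≤ D₀ ∧ ∀ (s ε : ℝ) (x : EuclideanSpace ℝ (Fin d)), 0 ≤ s → 0 < ε → ε ≤ 1 →
      ∫⁻ ω, chaos γ X k (1 / 4 * ε) (Metric.ball x 1) ω ^ (-s) ∂P ≤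
        ENNReal.ofReal (Real.exp ((s ^ 2 + s) * D₀)) *
          ∫⁻ ω, (chaos γ X k ε (Metric.ball x 1) ω.1 + chaos γ X k ε (Metric.ball x 1) ω.2) ^ (-s)
            ∂(P.prod P) := by
  have hc := h.bounds.nonneg
  have hl4 : 0 ≤ Real.log 4 := Real.log_nonneg (by norm_num)
  set δ : ℝ := γ * γ * (Real.log 4 + c) with hδ
  have hδ0 : 0 ≤ δ := mul_nonneg (mul_self_nonneg γ) (by linarith)
  have hpi := Real.pi_pos
  refine ⟨3 * δ * (Real.pi / 2) + d * Real.log 4, by positivity, fun s ε x hs hε hε1 => ?_⟩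
  have hεI : ε ∈ Set.Ioc (0 : ℝ) 1 := ⟨hε, hε1⟩
  have hεI' : 1 / 4 * ε ∈ Set.Ioc (0 : ℝ) 1 := ⟨by positivity, by linarith⟩
  obtain ⟨e, he⟩ : ∃ e : EuclideanSpace ℝ (Fin d), ‖e‖ = 1 :=
    ⟨EuclideanSpace.single ⟨0, hd⟩ 1, by simp⟩
  set x₀ := x + (1 / 2 : ℝ) • e with hx₀
  set x₁ := x - (1 / 2 : ℝ) • e with hx₁
  have hd0 : dist x₀ x = 1 / 2 := by rw [hx₀, dist_self_add_left, norm_smul, he]; norm_num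
  have hd1 : dist x₁ x = 1 / 2 := by
    rw [hx₁, dist_eq_norm, sub_sub_cancel_left, norm_neg, norm_smul, he]
    norm_num
  have hd01 : dist x₀ x₁ = 1 := by
    have : x₀ - x₁ = e := by
      rw [hx₀, hx₁, add_sub_sub_cancel, ← add_smul]
      norm_num
    rw [dist_eq_norm, this, he]
  set A := Metric.ball x₀ (1 / 4) with hA
  set B := Metric.ball x₁ (1 / 4) with hB
  have hfar : ∀ y ∈ A, ∀ z ∈ B, 1 / 2 ≤ dist y z := fun y hy z hz => by
    have h1 := Metric.mem_ball.1 hy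
    have h2 := Metric.mem_ball.1 hz
    have h3 := dist_triangle x₀ y x₁
    have h4 := dist_triangle y z x₁
    rw [dist_comm] at h1
    linarith
  have hdisj : Disjoint A B := Set.disjoint_left.2 fun y hy hy' => by
    have := hfar y hy y hy'
    rw [dist_self] at this
    linarith
  have hsub : A ∪ B ⊆ Metric.ball x 1 := by
    refine Set.union_subset (fun y hy => ?_) fun y hy => ?_
    · have h1 := Metric.mem_ball.1 hy
      have h3 := dist_triangle y x₀ x
      exact Metric.mem_ball.2 (by linarith)
    · have h1 := Metric.mem_ball.1 hy
      have h3 := dist_triangle y x₁ x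
      exact Metric.mem_ball.2 (by linarith)
  have hmeas : ∀ x' : EuclideanSpace ℝ (Fin d), Measurable fun y : EuclideanSpace ℝ (Fin d) =>
      ((⟨ε, hεI⟩ : Set.Ioc (0 : ℝ) 1), x + (4 : ℝ) • (y - x')) := fun x' => by fun_prop
  have hZ := h.field_eps γ hεI'
  have hAm : MeasurableSet A := measurableSet_ball
  have hBm : MeasurableSet B := measurableSet_ball
  have hZ' := (h.field.pull (hmeas x₀)
    ((measurable_const (a := γ)).indicator hAm)).add
    (h.field.pull (hmeas x₁)
    ((measurable_const (a := γ)).indicator hBm))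
  dsimp only at hZ'
  have : IsFiniteMeasure (volume.restrict (A ∪ B)) :=
    ⟨by rw [Measure.restrict_apply_univ]
        exact (measure_mono hsub).trans_lt measure_ball_lt_top⟩
  have hS : volume.restrict (A ∪ B) (A ∪ B)ᶜ = 0 := by
    rw [Measure.restrict_apply' (measurableSet_ball.union measurableSet_ball), Set.compl_inter_self,
      measure_empty]
  have hsame : ∀ x' y z : EuclideanSpace ℝ (Fin d), |γ * γ * k (1 / 4 * ε) (1 / 4 * ε) y z -
      γ * γ * k ε ε (x + (4 : ℝ) • (y - x')) (x + (4 : ℝ) • (z - x'))| ≤ δ := fun x' y z => by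
    have h1 := h.bounds.scale (ε := ε) (ρ := 1 / 4) x' x ((4 : ℝ) • (y - x'))
      ((4 : ℝ) • (z - x')) hε (by norm_num)
    rw [smul_smul, smul_smul] at h1
    norm_num only [one_smul, add_sub_cancel] at h1
    rw [one_div, Real.log_inv, abs_neg, abs_of_nonneg hl4] at h1
    rw [← mul_sub, abs_mul, abs_of_nonneg (mul_self_nonneg γ)]
    refine mul_le_mul_of_nonneg_left ?_ (mul_self_nonneg γ)
    simpa using h1
  have hdiff : ∀ y z : EuclideanSpace ℝ (Fin d), 1 / 2 ≤ dist y z →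
      |γ * γ * k (1 / 4 * ε) (1 / 4 * ε) y z| ≤ δ := fun y z hyz => by
    have h1 := h.bounds.le (y := y) (z := z) hεI'.1 (by norm_num : (0 : ℝ) < 1 / 2)
      (hyz.trans (le_max_left _ _))
    have h2 := h.bounds.neg_le (y := y) (z := z) hεI'.1
    have h3 : Real.log (1 / 2)⁻¹ ≤ Real.log 4 := Real.log_le_log (by norm_num) (by norm_num)
    rw [abs_mul, abs_of_nonneg (mul_self_nonneg γ)]
    refine mul_le_mul_of_nonneg_left (abs_le.2 ⟨by linarith, ?_⟩) (mul_self_nonneg γ)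
    exact h1.trans (add_le_add (max_le h3 hl4) le_rfl)
  have hAA : ∀ y ∈ A, A.indicator (fun _ => γ) y = γ := fun y hy => Set.indicator_of_mem hy _
  have hBB : ∀ y ∈ B, B.indicator (fun _ => γ) y = γ := fun y hy => Set.indicator_of_mem hy _
  have hAB : ∀ y ∈ B, A.indicator (fun _ => γ) y = 0 := fun y hy =>
    Set.indicator_of_notMem (Set.disjoint_right.1 hdisj hy) _
  have hBA : ∀ y ∈ A, B.indicator (fun _ => γ) y = 0 := fun y hy =>
    Set.indicator_of_notMem (Set.disjoint_left.1 hdisj hy) _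
  have hcmp := hZ.lintegral_expMass_rpow_le hZ' (volume.restrict (A ∪ B)) hS hδ0
    (fun y hy z hz => by
      rcases hy with hy | hy <;> rcases hz with hz | hz
      · simpa only [hAA y hy, hAA z hz, hBA y hy, hBA z hz, zero_mul, add_zero] using hsame x₀ y z
      · simpa only [hAA y hy, hAB z hz, hBA y hy, hBB z hz, zero_mul, mul_zero, add_zero,
          sub_zero] using hdiff y z (hfar y hy z hz)
      · simpa only [hAB y hy, hAA z hz, hBB y hy, hBA z hz, zero_mul, mul_zero, add_zero,
          sub_zero] using hdiff y z (by rw [dist_comm]; exact hfar z hz y hy)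
      · simpa only [hAB y hy, hAB z hz, hBB y hy, hBB z hz, zero_mul, zero_add]
          using hsame x₁ y z) (-s)
  have hshift : ∀ (x' : EuclideanSpace ℝ (Fin d)) (ω : Ω), ∫⁻ y in Metric.ball x' (1 / 4),
      ENNReal.ofReal (Real.exp (γ * X ε (x + (4 : ℝ) • (y - x')) ω -
        γ * γ * k ε ε (x + (4 : ℝ) • (y - x')) (x + (4 : ℝ) • (y - x')) / 2)) =
      ENNReal.ofReal ((1 / 4) ^ d) * chaos γ X k ε (Metric.ball x 1) ω := fun x' ω => by
    rw [setLIntegral_ball_eq (by norm_num), chaos_ball_eq one_pos, one_pow, ENNReal.ofReal_one,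
      one_mul]
    congr 1
    refine lintegral_congr fun z => ?_
    rw [add_sub_cancel_left, smul_smul]
    norm_num
  have hmass : ∀ ω : Ω × Ω, expMass (volume.restrict (A ∪ B))
      (fun t (ω : Ω × Ω) => A.indicator (fun _ => γ) t * X ε (x + (4 : ℝ) • (t - x₀)) ω.1 +
        B.indicator (fun _ => γ) t * X ε (x + (4 : ℝ) • (t - x₁)) ω.2)
      (fun s t => A.indicator (fun _ => γ) s * A.indicator (fun _ => γ) t *
          k ε ε (x + (4 : ℝ) • (s - x₀)) (x + (4 : ℝ) • (t - x₀)) +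
        B.indicator (fun _ => γ) s * B.indicator (fun _ => γ) t *
          k ε ε (x + (4 : ℝ) • (s - x₁)) (x + (4 : ℝ) • (t - x₁))) ω =
      ENNReal.ofReal ((1 / 4) ^ d) * (chaos γ X k ε (Metric.ball x 1) ω.1 +
        chaos γ X k ε (Metric.ball x 1) ω.2) := fun ω => by
    unfold expMass
    rw [lintegral_union measurableSet_ball hdisj, mul_add, ← hshift x₀, ← hshift x₁]
    congr 1
    · refine setLIntegral_congr_fun measurableSet_ball fun y hy => ?_
      simp only [hAA y hy, hBA y hy, zero_mul, add_zero]
    · refine setLIntegral_congr_fun measurableSet_ball fun y hy => ?_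
      simp only [hAB y hy, hBB y hy, zero_mul, zero_add]
  have h4 : ENNReal.ofReal ((1 / 4) ^ d) ^ (-s) =
      ENNReal.ofReal (Real.exp (s * (d * Real.log 4))) := by
    rw [ENNReal.ofReal_rpow_of_pos (by positivity), Real.rpow_def_of_pos (by positivity),
      Real.log_pow, one_div, Real.log_inv]
    ring_nf
  calc _ ≤ ∫⁻ ω, expMass (volume.restrict (A ∪ B)) (fun y ω => γ * X (1 / 4 * ε) y ω)
        (fun y z => γ * γ * k (1 / 4 * ε) (1 / 4 * ε) y z) ω ^ (-s) ∂P :=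
        lintegral_mono fun ω => ennreal_rpow_le_rpow_of_nonpos (by linarith) (chaos_mono hsub ω)
    _ ≤ _ := hcmp
    _ = ENNReal.ofReal (Real.exp (((-s) ^ 2 + 3 * |(-s)|) * δ * (Real.pi / 2))) *
        ∫⁻ ω, ENNReal.ofReal (Real.exp (s * (d * Real.log 4))) *
          (chaos γ X k ε (Metric.ball x 1) ω.1 + chaos γ X k ε (Metric.ball x 1) ω.2) ^ (-s)
            ∂(P.prod P) := by
        congr 1
        refine lintegral_congr fun ω => ?_
        rw [hmass, ennreal_mul_rpow (by simp) ENNReal.ofReal_ne_top, h4]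
    _ ≤ _ := by
        rw [lintegral_const_mul' _ _ ENNReal.ofReal_ne_top, ← mul_assoc,
          ← ENNReal.ofReal_mul (Real.exp_pos _).le, ← Real.exp_add, abs_neg, abs_of_nonneg hs]
        refine mul_le_mul_left (ENNReal.ofReal_le_ofReal (Real.exp_le_exp.2 ?_)) _
        have h1 : 0 ≤ s ^ 2 * (δ * Real.pi) := by positivity
        have h2 : 0 ≤ s ^ 2 * (d * Real.log 4) := by positivity
        nlinarith

end IsLogField

/-- A Paley–Zygmund bound from a first moment and a moment of higher order. -/
lemma exists_measure_lt_le {Ω : Type*} [MeasurableSpace Ω] (P : Measure Ω) [IsProbabilityMeasure P]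
    {m s : ℝ} (hm : 0 < m) (hs : 1 < s) (Q : ℝ) :
    ∃ p : ℝ≥0∞, p < 1 ∧ ∀ f : Ω → ℝ≥0∞, Measurable f → ENNReal.ofReal m ≤ ∫⁻ ω, f ω ∂P →
      ∫⁻ ω, f ω ^ s ∂P ≤ ENNReal.ofReal Q → P {ω | f ω < ENNReal.ofReal (m / 4)} ≤ p := by
  have ht : Tendsto (fun T : ℝ => T ^ (-(s - 1)) * Q) atTop (𝓝 0) := by
    simpa using (tendsto_rpow_neg_atTop (y := s - 1) (by linarith)).mul_const Q
  obtain ⟨T, hT0, hT⟩ := ((eventually_gt_atTop (0 : ℝ)).and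
    (ht.eventually_le_const (by linarith : (0 : ℝ) < m / 4))).exists
  refine ⟨1 - ENNReal.ofReal (m / (2 * T)), ENNReal.sub_lt_self ENNReal.one_ne_top one_ne_zero
    (by simp only [ne_eq, ENNReal.ofReal_eq_zero, not_le]; positivity), fun f hf h1 h2 => ?_⟩
  set A : Set Ω := {ω | ENNReal.ofReal (m / 4) ≤ f ω} with hA
  have hAm : MeasurableSet A := measurableSet_le measurable_const hf
  have hAc : {ω | f ω < ENNReal.ofReal (m / 4)} = Aᶜ := by
    ext ω
    simp [hA]
  have hpt : ∀ ω, f ω ≤ ENNReal.ofReal (m / 4) + A.indicator (fun _ => ENNReal.ofReal T) ω +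
      ENNReal.ofReal (T ^ (-(s - 1))) * f ω ^ s := by
    intro ω
    by_cases hω : ω ∈ A
    · rw [Set.indicator_of_mem hω]
      rcases le_or_gt (f ω) (ENNReal.ofReal T) with hle | hlt
      · exact hle.trans ((self_le_add_left _ _).trans (self_le_add_right _ _))
      · refine le_trans ?_ (self_le_add_left _ _)
        rw [← ENNReal.ofReal_rpow_of_pos hT0]
        have h3 : ENNReal.ofReal T ^ (s - 1) ≤ f ω ^ (s - 1) :=
          ENNReal.rpow_le_rpow hlt.le (by linarith)
        have h4 : f ω ^ s = f ω ^ (s - 1) * f ω := by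
          conv_lhs => rw [show s = (s - 1) + 1 by ring]
          rw [ENNReal.rpow_add_of_nonneg _ _ (by linarith) zero_le_one, ENNReal.rpow_one]
        have hT1 : ENNReal.ofReal T ^ (s - 1) ≠ 0 := by
          rw [ENNReal.ofReal_rpow_of_pos hT0]
          simpa using Real.rpow_pos_of_pos hT0 _
        have hT2 : ENNReal.ofReal T ^ (s - 1) ≠ ⊤ :=
          ENNReal.rpow_ne_top_of_nonneg (by linarith) ENNReal.ofReal_ne_top
        rw [h4, ENNReal.rpow_neg, ← mul_assoc]
        calc f ω = (ENNReal.ofReal T ^ (s - 1))⁻¹ * ENNReal.ofReal T ^ (s - 1) * f ω := by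
              rw [ENNReal.inv_mul_cancel hT1 hT2, one_mul]
          _ ≤ _ := by gcongr
    · have : f ω < ENNReal.ofReal (m / 4) := by simpa [hA] using hω
      exact this.le.trans ((self_le_add_right _ _).trans (self_le_add_right _ _))
  have h3 : ENNReal.ofReal m ≤ ENNReal.ofReal (m / 4) + ENNReal.ofReal T * P A +
      ENNReal.ofReal (m / 4) := by
    refine h1.trans ((lintegral_mono hpt).trans ?_)
    rw [lintegral_add_right _ ((hf.pow_const s).const_mul _),
      lintegral_add_left measurable_const, lintegral_const, measure_univ, mul_one,
      lintegral_indicator_const hAm, lintegral_const_mul' _ _ ENNReal.ofReal_ne_top]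
    gcongr
    refine (mul_le_mul_right h2 _).trans ?_
    rw [← ENNReal.ofReal_mul (by positivity)]
    exact ENNReal.ofReal_le_ofReal hT
  have hPA : P A = ENNReal.ofReal (P A).toReal := (ENNReal.ofReal_toReal (measure_ne_top P A)).symm
  rw [hPA, ← ENNReal.ofReal_mul hT0.le, ← ENNReal.ofReal_add (by positivity) (by positivity),
    ← ENNReal.ofReal_add (by positivity) (by positivity),
    ENNReal.ofReal_le_ofReal_iff (by positivity)] at h3
  rw [hAc, prob_compl_eq_one_sub hAm, hPA]
  gcongr
  rw [div_le_iff₀ (by positivity)]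
  nlinarith

/-- Uniform bounds from a contracting recursion over the scales. -/
lemma le_of_scale_recursion {R : ℝ} (hR : 0 < R) {a : ℝ → ℝ≥0∞} {B Q p : ℝ≥0∞}
    (hbase : ∀ ε, R / 4 < ε → ε ≤ R → a ε ≤ B)
    (hrec : ∀ ε, 0 < ε → ε ≤ R → a (1 / 4 * ε) ≤ Q + p * a ε) (hB : Q + p * B ≤ B) {ε : ℝ}
    (hε : 0 < ε) (hεR : ε ≤ R) : a ε ≤ B := by
  have key : ∀ (n : ℕ) (ε : ℝ), ε ≤ R → R * (1 / 4) ^ (n + 1) < ε → a ε ≤ B := by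
    intro n
    induction n with
    | zero => exact fun ε h1 h2 => hbase ε (by linarith) h1
    | succ n ih =>
      intro ε h1 h2
      rcases lt_or_ge (R / 4) ε with h3 | h3
      · exact hbase ε h3 h1
      have h4 : R * (1 / 4) ^ (n + 1) < 4 * ε := by
        rw [pow_succ] at h2
        linarith
      have h5 : 0 < 4 * ε := lt_trans (by positivity) h4
      have := hrec (4 * ε) h5 (by linarith)
      rw [← mul_assoc, one_div, inv_mul_cancel₀ (by norm_num), one_mul] at this
      refine this.trans (le_trans ?_ hB)
      gcongr
      exact ih _ (by linarith) h4
  obtain ⟨n, hn⟩ := exists_pow_lt_of_lt_one (div_pos hε hR) (by norm_num : (1 / 4 : ℝ) < 1)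
  rw [lt_div_iff₀' hR] at hn
  refine key n ε hεR (lt_of_le_of_lt ?_ hn)
  rw [pow_succ]
  have : 0 < R * (1 / 4) ^ n := by positivity
  linarith

namespace IsLogField

variable {Ω : Type*} [MeasurableSpace Ω] {P : Measure Ω}
  {X : ℝ → EuclideanSpace ℝ (Fin d) → Ω → ℝ}
  {k : ℝ → ℝ → EuclideanSpace ℝ (Fin d) → EuclideanSpace ℝ (Fin d) → ℝ} {c γ ε r s R : ℝ}

/-- The mass of a unit ball is bounded below with uniformly positive probability. -/
lemma exists_measure_chaos_lt_le (h : IsLogField P X k c) (hγ : 0 ≤ γ) (hsub : γ ^ 2 < 2 * d) :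
    ∃ R c₁ : ℝ, ∃ p : ℝ≥0∞, 0 < R ∧ R ≤ 1 ∧ 0 < c₁ ∧ p < 1 ∧ ∀ ε x, 0 < ε → ε ≤ R →
      P {ω | chaos γ X k ε (Metric.ball x 1) ω < ENNReal.ofReal c₁} ≤ p := by
  have := h.field.isProbabilityMeasure
  obtain ⟨s, hs, hsub'⟩ : ∃ s : ℝ, 1 < s ∧ γ ^ 2 * s < 2 * d := by
    refine ⟨1 + (2 * d - γ ^ 2) / (2 * (γ ^ 2 + 1)), ?_, ?_⟩
    · have : 0 < (2 * d - γ ^ 2) / (2 * (γ ^ 2 + 1)) := div_pos (by linarith) (by positivity)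
      linarith
    · have h1 : γ ^ 2 * ((2 * d - γ ^ 2) / (2 * (γ ^ 2 + 1))) ≤ (2 * d - γ ^ 2) / 2 := by
        rw [← mul_div_assoc, div_le_div_iff₀ (by positivity) (by norm_num)]
        nlinarith
      nlinarith
  obtain ⟨R, hR0, hR1, C, hC0, hC⟩ := h.exists_hasMomentBound hγ (by linarith : 0 < s) hsub'
  have hm : 0 < R ^ (d : ℝ) * unitVol d := mul_pos (by positivity) unitVol_pos
  obtain ⟨p, hp, hP⟩ := exists_measure_lt_le P hm hs (C * R ^ structExp d γ s)
  refine ⟨R, R ^ (d : ℝ) * unitVol d / 4, p, hR0, hR1, by positivity, hp, fun ε x hε hεR => ?_⟩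
  have hεI : ε ∈ Set.Ioc (0 : ℝ) 1 := ⟨hε, hεR.trans hR1⟩
  refine (measure_mono fun ω hω => ?_).trans (hP (chaos γ X k ε (Metric.ball x R))
    (h.measurable_chaos γ hεI _) (by rw [h.lintegral_chaos γ hεI, volume_ball_eq hR0])
    (hC ε R x hε hεR le_rfl))
  exact (chaos_mono (Metric.ball_subset_ball hR1) ω).trans_lt hω

/-- Negative moments at a fixed scale. -/
lemma exists_lintegral_chaos_rpow_neg_le_of_le (h : IsLogField P X k c) {ε₀ : ℝ} (hε₀ : 0 < ε₀)
    (s : ℝ) : ∃ B : ℝ≥0∞, B ≠ ⊤ ∧ ∀ ε x, ε₀ ≤ ε → ε ≤ 1 →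
      ∫⁻ ω, chaos γ X k ε (Metric.ball x 1) ω ^ (-s) ∂P ≤ B := by
  have := h.field.isProbabilityMeasure
  set δ : ℝ := γ * γ * (|Real.log ε₀⁻¹| + c) with hδ
  have hc := h.bounds.nonneg
  have hδ0 : 0 ≤ δ := mul_nonneg (mul_self_nonneg γ) (by positivity)
  refine ⟨ENNReal.ofReal (Real.exp (((-s) ^ 2 + 3 * |-s|) * δ * (Real.pi / 2))) *
    ENNReal.ofReal (unitVol d) ^ (-s), ENNReal.mul_ne_top ENNReal.ofReal_ne_top ?_,
    fun ε x hε hε1 => ?_⟩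
  · rw [ENNReal.ofReal_rpow_of_pos unitVol_pos]
    exact ENNReal.ofReal_ne_top
  have hε0 := hε₀.trans_le hε
  have hεI : ε ∈ Set.Ioc (0 : ℝ) 1 := ⟨hε0, hε1⟩
  have hZ' : IsGaussField P (fun (_ : EuclideanSpace ℝ (Fin d)) _ => (0 : ℝ)) (fun _ _ => 0) := by
    simpa using h.field_eps 0 hεI
  have hfin : IsFiniteMeasure (volume.restrict (Metric.ball x 1)) :=
    ⟨by rw [Measure.restrict_apply_univ]; exact measure_ball_lt_top⟩
  refine ((h.field_eps γ hεI).lintegral_expMass_rpow_le hZ' (volume.restrict (Metric.ball x 1))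
    (S := Set.univ) (by simp) hδ0 (fun y _ z _ => ?_) (-s)).trans (le_of_eq ?_)
  · have h1 := h.bounds.le (y := y) (z := z) hε0 hε0 (le_max_right _ _)
    rw [max_eq_left (Real.log_nonneg ((one_le_inv₀ hε0).2 hε1))] at h1
    have h2 := h.bounds.neg_le (y := y) (z := z) hε0
    have h3 : Real.log ε⁻¹ ≤ Real.log ε₀⁻¹ := Real.log_le_log (by positivity) (by gcongr)
    have h4 := le_abs_self (Real.log ε₀⁻¹)
    have h5 := abs_nonneg (Real.log ε₀⁻¹)
    rw [sub_zero, abs_mul, abs_of_nonneg (mul_self_nonneg γ)]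
    exact mul_le_mul_of_nonneg_left (abs_le.2 ⟨by linarith, by linarith⟩) (mul_self_nonneg γ)
  · simp [expMass, volume_ball_eq one_pos]

/-- All negative moments of the mass of a unit ball are bounded uniformly in the cutoff. -/
lemma exists_lintegral_chaos_rpow_neg_le (h : IsLogField P X k c) (hd : 1 ≤ d) (hγ : 0 ≤ γ)
    (hsub : γ ^ 2 < 2 * d) : ∃ R : ℝ, 0 < R ∧ R ≤ 1 ∧ ∀ s : ℝ, 0 < s → ∃ B : ℝ≥0∞, B ≠ ⊤ ∧
      ∀ ε x, 0 < ε → ε ≤ R → ∫⁻ ω, chaos γ X k ε (Metric.ball x 1) ω ^ (-s) ∂P ≤ B := by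
  have := h.field.isProbabilityMeasure
  obtain ⟨R, c₁, p, hR0, hR1, hc₁, hp, hP⟩ := h.exists_measure_chaos_lt_le hγ hsub
  obtain ⟨D₀, hD₀, hD⟩ := h.exists_lintegral_chaos_rpow_le_add (γ := γ) hd
  refine ⟨R, hR0, hR1, ?_⟩
  have hm : ∀ {ε : ℝ} (x : EuclideanSpace ℝ (Fin d)) (s : ℝ), 0 < ε → ε ≤ R →
      Measurable fun ω => chaos γ X k ε (Metric.ball x 1) ω ^ s := fun x s h1 h2 =>
    (h.measurable_chaos γ ⟨h1, h2.trans hR1⟩ _).pow_const s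
  obtain ⟨s₀, hs₀, hs₀p⟩ : ∃ s₀ : ℝ, 0 < s₀ ∧
      ENNReal.ofReal (Real.exp ((s₀ ^ 2 + s₀) * D₀)) * p < 1 := by
    have ht : Tendsto (fun s : ℝ => ENNReal.ofReal (Real.exp ((s ^ 2 + s) * D₀)) * p) (𝓝[>] 0)
        (𝓝 (ENNReal.ofReal (Real.exp ((0 ^ 2 + 0) * D₀)) * p)) := by
      refine ENNReal.Tendsto.mul_const (ENNReal.tendsto_ofReal ?_) (Or.inl (by simp))
      exact ((by fun_prop :
        Continuous fun s : ℝ => Real.exp ((s ^ 2 + s) * D₀)).tendsto 0).mono_left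
        nhdsWithin_le_nhds
    obtain ⟨s₀, h1, h2⟩ := ((ht.eventually_lt_const (by simpa using hp)).and
      self_mem_nhdsWithin).exists
    exact ⟨s₀, h2, h1⟩
  have key : ∀ (n : ℕ), ∃ B : ℝ≥0∞, B ≠ ⊤ ∧ ∀ ε x, 0 < ε → ε ≤ R →
      ∫⁻ ω, chaos γ X k ε (Metric.ball x 1) ω ^ (-(s₀ * 2 ^ n)) ∂P ≤ B := by
    intro n
    induction n with
    | zero =>
      rw [pow_zero, mul_one]
      obtain ⟨B₀, hB₀, hbase⟩ := h.exists_lintegral_chaos_rpow_neg_le_of_le (γ := γ)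
        (div_pos hR0 (by norm_num : (0 : ℝ) < 4)) s₀
      set K := ENNReal.ofReal (Real.exp ((s₀ ^ 2 + s₀) * D₀)) with hK
      set Q := K * ENNReal.ofReal c₁ ^ (-s₀) with hQ
      have hQt : Q ≠ ⊤ := by
        rw [hQ, ENNReal.ofReal_rpow_of_pos hc₁]
        exact ENNReal.mul_ne_top ENNReal.ofReal_ne_top ENNReal.ofReal_ne_top
      have hp0 : 1 - K * p ≠ 0 := (tsub_pos_of_lt hs₀p).ne'
      have hp1 : 1 - K * p ≠ ⊤ := ENNReal.sub_ne_top ENNReal.one_ne_top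
      refine ⟨max B₀ (Q / (1 - K * p)), (max_lt hB₀.lt_top (ENNReal.div_ne_top hQt hp0).lt_top).ne,
        fun ε x hε hεR => ?_⟩
      refine le_of_scale_recursion (p := K * p) (Q := Q) hR0
        (a := fun ε => ∫⁻ ω, chaos γ X k ε (Metric.ball x 1) ω ^ (-s₀) ∂P)
        (fun ε h1 h2 => (hbase ε x h1.le (h2.trans hR1)).trans (le_max_left _ _))
        (fun ε h1 h2 => ?_) ?_ hε hεR
      · refine (hD s₀ ε x hs₀.le h1 (h2.trans hR1)).trans ?_
        rw [hQ, mul_assoc, ← mul_add]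
        gcongr
        set S := {ω | chaos γ X k ε (Metric.ball x 1) ω < ENNReal.ofReal c₁} with hS
        have hSm : MeasurableSet S :=
          measurableSet_lt (h.measurable_chaos γ ⟨h1, h2.trans hR1⟩ _) measurable_const
        have hSi : Measurable (S.indicator fun _ => (1 : ℝ≥0∞)) := measurable_const.indicator hSm
        calc _ ≤ ∫⁻ ω, (ENNReal.ofReal c₁ ^ (-s₀) + chaos γ X k ε (Metric.ball x 1) ω.1 ^ (-s₀) *
              S.indicator (fun _ => 1) ω.2) ∂(P.prod P) := by
              refine lintegral_mono fun ω => ?_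
              by_cases hω : ω.2 ∈ S
              · rw [Set.indicator_of_mem hω, mul_one]
                exact (ennreal_rpow_le_rpow_of_nonpos (by linarith) (self_le_add_right _ _)).trans
                  (self_le_add_left _ _)
              · have : ENNReal.ofReal c₁ ≤ chaos γ X k ε (Metric.ball x 1) ω.2 := by
                  simpa [hS] using hω
                exact (ennreal_rpow_le_rpow_of_nonpos (by linarith)
                  (this.trans (self_le_add_left _ _))).trans (self_le_add_right _ _)
          _ = ENNReal.ofReal c₁ ^ (-s₀) +
              (∫⁻ ω, chaos γ X k ε (Metric.ball x 1) ω ^ (-s₀) ∂P) * P S := by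
              rw [lintegral_add_left measurable_const, lintegral_const, measure_univ, mul_one,
                lintegral_prod_mul (hm x _ h1 h2).aemeasurable hSi.aemeasurable,
                lintegral_indicator_const hSm, one_mul]
          _ ≤ _ := by
              rw [mul_comm p]
              gcongr
              exact hP ε x h1 h2
      · have h1 : Q ≤ (1 - K * p) * max B₀ (Q / (1 - K * p)) := by
          calc Q = (1 - K * p) * (Q / (1 - K * p)) := (ENNReal.mul_div_cancel hp0 hp1).symm
            _ ≤ _ := by gcongr; exact le_max_right _ _
        calc _ ≤ (1 - K * p) * max B₀ (Q / (1 - K * p)) + K * p * max B₀ (Q / (1 - K * p)) := by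
              gcongr
          _ = _ := by rw [← add_mul, tsub_add_cancel_of_le hs₀p.le, one_mul]
    | succ n ih =>
      obtain ⟨B, hB, ih⟩ := ih
      set s := s₀ * 2 ^ n with hs
      have hs0 : 0 < s := by positivity
      have hs2 : s₀ * 2 ^ (n + 1) = 2 * s := by rw [hs, pow_succ]; ring
      rw [hs2]
      obtain ⟨B₀, hB₀, hbase⟩ := h.exists_lintegral_chaos_rpow_neg_le_of_le (γ := γ)
        (div_pos hR0 (by norm_num : (0 : ℝ) < 4)) (2 * s)
      set K := ENNReal.ofReal (Real.exp (((2 * s) ^ 2 + 2 * s) * D₀)) with hK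
      refine ⟨max B₀ (K * (B * B)), (max_lt hB₀.lt_top (ENNReal.mul_ne_top ENNReal.ofReal_ne_top
        (ENNReal.mul_ne_top hB hB)).lt_top).ne, fun ε x hε hεR => ?_⟩
      refine le_of_scale_recursion (p := 0) (Q := K * (B * B)) hR0
        (a := fun ε => ∫⁻ ω, chaos γ X k ε (Metric.ball x 1) ω ^ (-(2 * s)) ∂P)
        (fun ε h1 h2 => (hbase ε x h1.le (h2.trans hR1)).trans (le_max_left _ _))
        (fun ε h1 h2 => ?_) (by rw [zero_mul, add_zero]; exact le_max_right _ _) hε hεR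
      rw [zero_mul, add_zero]
      refine (hD (2 * s) ε x (by positivity) h1 (h2.trans hR1)).trans ?_
      gcongr
      calc _ ≤ ∫⁻ ω, chaos γ X k ε (Metric.ball x 1) ω.1 ^ (-s) *
            chaos γ X k ε (Metric.ball x 1) ω.2 ^ (-s) ∂(P.prod P) := by
            refine lintegral_mono fun ω => ?_
            have e : ∀ y : ℝ≥0∞, y ^ (-(2 * s)) = y ^ (-s) * y ^ (-s) := fun y => by
              rw [show -(2 * s) = -s * 2 by ring, ENNReal.rpow_mul, ENNReal.rpow_two, sq]
            rw [e]
            exact mul_le_mul' (ennreal_rpow_le_rpow_of_nonpos (by linarith) (self_le_add_right _ _))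
              (ennreal_rpow_le_rpow_of_nonpos (by linarith) (self_le_add_left _ _))
        _ = _ := lintegral_prod_mul (hm x _ h1 h2).aemeasurable (hm x _ h1 h2).aemeasurable
        _ ≤ _ := mul_le_mul' (ih ε x h1 h2) (ih ε x h1 h2)
  intro s hs
  obtain ⟨n, hn⟩ := pow_unbounded_of_one_lt (s / s₀) (by norm_num : (1 : ℝ) < 2)
  rw [div_lt_iff₀' hs₀] at hn
  obtain ⟨B, hB, hBle⟩ := key n
  refine ⟨1 + B, ENNReal.add_ne_top.2 ⟨ENNReal.one_ne_top, hB⟩, fun ε x hε hεR => ?_⟩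
  calc _ ≤ ∫⁻ ω, (1 + chaos γ X k ε (Metric.ball x 1) ω ^ (-(s₀ * 2 ^ n))) ∂P := by
        refine lintegral_mono fun ω => ?_
        rcases le_total 1 (chaos γ X k ε (Metric.ball x 1) ω) with h1 | h1
        · refine le_trans ?_ (self_le_add_right _ _)
          simpa using ennreal_rpow_le_rpow_of_nonpos (q := -s) (by linarith) h1
        · refine le_trans ?_ (self_le_add_left _ _)
          rw [ENNReal.rpow_neg, ENNReal.rpow_neg]
          exact ENNReal.inv_le_inv.2 (ENNReal.rpow_le_rpow_of_exponent_ge h1 hn.le)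
    _ ≤ _ := by
        rw [lintegral_add_left measurable_const, lintegral_const, measure_univ, mul_one]
        gcongr
        exact hBle ε x hε hεR

end IsLogField

namespace IsLogField

variable {Ω : Type*} [MeasurableSpace Ω] {P : Measure Ω}
  {X : ℝ → EuclideanSpace ℝ (Fin d) → Ω → ℝ}
  {k : ℝ → ℝ → EuclideanSpace ℝ (Fin d) → EuclideanSpace ℝ (Fin d) → ℝ} {c γ ε r q : ℝ}

lemma field_ball (h : IsLogField P X k c) (γ : ℝ) (hε : ε ∈ Set.Ioc (0 : ℝ) 1)
    (hr : r ∈ Set.Ioc (0 : ℝ) 1) (x : EuclideanSpace ℝ (Fin d)) :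
    IsGaussField P (fun z ω => γ * X (r * ε) (x + r • z) ω)
      (fun z z' => γ * γ * k (r * ε) (r * ε) (x + r • z) (x + r • z')) :=
  h.field_comp γ ⟨mul_pos hr.1 hε.1, mul_le_one₀ hr.2 hε.1.le hε.2⟩ (by fun_prop)

/-- Moments of the rescaled mass of a small ball are bounded uniformly in the cutoff. -/
lemma exists_lintegral_expMass_rpow_le (h : IsLogField P X k c) (hd : 1 ≤ d) (hγ : 0 < γ)
    (hsub : γ ^ 2 < 2 * d) (hq : q < 2 * d / γ ^ 2) (x : EuclideanSpace ℝ (Fin d)) :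
    ∃ r₁ ∈ Set.Ioc (0 : ℝ) 1, ∀ r ∈ Set.Ioc 0 r₁, ∃ B : ℝ≥0∞, B ≠ ⊤ ∧ ∃ ε₁ ∈ Set.Ioc (0 : ℝ) 1,
      ∀ ε ∈ Set.Ioc 0 ε₁, ∫⁻ ω, expMass (volume.restrict (Metric.ball 0 1))
        (fun z ω => γ * X (r * ε) (x + r • z) ω)
        (fun z z' => γ * γ * k (r * ε) (r * ε) (x + r • z) (x + r • z')) ω ^ q ∂P ≤ B := by
  have := h.field.isProbabilityMeasure
  rcases lt_trichotomy q 0 with hq0 | rfl | hq0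
  · obtain ⟨R, hR0, hR1, hR⟩ := h.exists_lintegral_chaos_rpow_neg_le hd hγ.le hsub
    obtain ⟨B, hB, hB'⟩ := hR (-q) (by linarith)
    rw [neg_neg] at hB'
    refine ⟨1, ⟨one_pos, le_rfl⟩, fun r hr => ?_⟩
    have hc := h.bounds.nonneg
    set δ : ℝ := γ * γ * (|Real.log r| + c) with hδ
    have hδ0 : 0 ≤ δ := mul_nonneg (mul_self_nonneg γ) (by positivity)
    refine ⟨ENNReal.ofReal (Real.exp ((q ^ 2 + 3 * |q|) * δ * (Real.pi / 2))) * B,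
      ENNReal.mul_ne_top ENNReal.ofReal_ne_top hB, R, ⟨hR0, hR1⟩, fun ε hε => ?_⟩
    have hεI : ε ∈ Set.Ioc (0 : ℝ) 1 := ⟨hε.1, hε.2.trans hR1⟩
    have hfin : IsFiniteMeasure (volume.restrict (Metric.ball (0 : EuclideanSpace ℝ (Fin d)) 1)) :=
      ⟨by rw [Measure.restrict_apply_univ]; exact measure_ball_lt_top⟩
    refine ((h.field_ball γ hεI hr x).lintegral_expMass_rpow_le (h.field_eps γ hεI)
      (volume.restrict (Metric.ball 0 1)) (S := Set.univ) (by simp) hδ0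
      (fun y _ z _ => ?_) q).trans ?_
    · have := h.bounds.scale (ε := ε) (ρ := r) x 0 y z hε.1 hr.1
      rw [zero_add, zero_add] at this
      rw [← mul_sub, abs_mul, abs_of_nonneg (mul_self_nonneg γ)]
      exact mul_le_mul_of_nonneg_left this (mul_self_nonneg γ)
    · gcongr
      exact hB' ε 0 hε.1 hε.2
  · exact ⟨1, ⟨one_pos, le_rfl⟩, fun r hr => ⟨1, ENNReal.one_ne_top, 1, ⟨one_pos, le_rfl⟩,
      fun ε hε => by simp⟩⟩
  · obtain ⟨R, hR0, hR1, C, hC0, hC⟩ := h.exists_hasMomentBound hγ.le hq0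
      (by rwa [lt_div_iff₀' (by positivity)] at hq)
    refine ⟨R, ⟨hR0, hR1⟩, fun r hr => ?_⟩
    have hr0 : 0 < r ^ d := pow_pos hr.1 d
    have h0 : ENNReal.ofReal (r ^ d)⁻¹ ≠ 0 := by simpa using hr0
    refine ⟨ENNReal.ofReal (r ^ d)⁻¹ ^ q * ENNReal.ofReal (C * r ^ structExp d γ q),
      ENNReal.mul_ne_top (ENNReal.rpow_ne_top_of_nonneg hq0.le ENNReal.ofReal_ne_top)
        ENNReal.ofReal_ne_top, 1, ⟨one_pos, le_rfl⟩, fun ε hε => ?_⟩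
    have e : ∀ ω, expMass (volume.restrict (Metric.ball 0 1))
        (fun z ω => γ * X (r * ε) (x + r • z) ω)
        (fun z z' => γ * γ * k (r * ε) (r * ε) (x + r • z) (x + r • z')) ω =
        ENNReal.ofReal (r ^ d)⁻¹ * chaos γ X k (r * ε) (Metric.ball x r) ω := fun ω => by
      rw [chaos_ball_eq hr.1, ← mul_assoc, ← ENNReal.ofReal_mul (by positivity),
        inv_mul_cancel₀ hr0.ne', ENNReal.ofReal_one, one_mul]
    simp only [e, ennreal_mul_rpow h0 ENNReal.ofReal_ne_top]
    rw [lintegral_const_mul' _ _ (ENNReal.rpow_ne_top_of_nonneg hq0.le ENNReal.ofReal_ne_top)]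
    gcongr
    exact hC (r * ε) r x (mul_pos hr.1 hε.1) (mul_le_of_le_one_right hr.1.le hε.2) hr.2

end IsLogField

/-- Regularized moments converge under almost sure convergence. -/
lemma tendsto_lintegral_reg {Ω : Type*} [MeasurableSpace Ω] {P : Measure Ω}
    [IsProbabilityMeasure P] {a q : ℝ} (ha : a ∈ Set.Ioo (0 : ℝ) 1) {U : Ω → ℝ≥0∞}
    {u : ℕ → Ω → ℝ≥0∞} (hu : ∀ n, Measurable (u n))
    (huU : ∀ᵐ ω ∂P, Tendsto (fun n => (u n ω).toReal) atTop (𝓝 (U ω).toReal)) :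
    Tendsto (fun n => ∫⁻ ω, ENNReal.ofReal (reg a q (u n ω).toReal) ∂P) atTop
      (𝓝 (∫⁻ ω, ENNReal.ofReal (reg a q (U ω).toReal) ∂P)) := by
  refine tendsto_lintegral_of_dominated_convergence (fun _ => ENNReal.ofReal (a⁻¹ ^ |q|))
    (fun n => (measurable_reg.comp (hu n).ennreal_toReal).ennreal_ofReal) (fun n => ?_)
    (by simp) ?_
  · exact ae_of_all _ fun ω => ENNReal.ofReal_le_ofReal
      ((le_abs_self _).trans (abs_reg_le ha.1 ha.2 ENNReal.toReal_nonneg))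
  · filter_upwards [huU] with ω hω
    exact ENNReal.tendsto_ofReal ((hasDerivAt_reg ha.1
      ENNReal.toReal_nonneg).continuousAt.tendsto.comp hω)

/-- Passing to the limit in a comparison of regularized moments. -/
lemma lintegral_rpow_le_of_tendsto {Ω Ω' : Type*} [MeasurableSpace Ω] [MeasurableSpace Ω']
    {P : Measure Ω} {P' : Measure Ω'} [IsProbabilityMeasure P] [IsProbabilityMeasure P'] {q : ℝ}
    {U : Ω → ℝ≥0∞} {V : Ω' → ℝ≥0∞} {u : ℕ → Ω → ℝ≥0∞} {v : ℕ → Ω' → ℝ≥0∞}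
    (hU : Measurable U) (hV : Measurable V) (hu : ∀ n, Measurable (u n))
    (hv : ∀ n, Measurable (v n)) (hUt : ∀ᵐ ω ∂P, U ω ≠ ⊤) (hVt : ∀ᵐ ω ∂P', V ω ≠ ⊤)
    (huU : ∀ᵐ ω ∂P, Tendsto (fun n => (u n ω).toReal) atTop (𝓝 (U ω).toReal))
    (hvV : ∀ᵐ ω ∂P', Tendsto (fun n => (v n ω).toReal) atTop (𝓝 (V ω).toReal))
    {K : ℝ≥0∞} (hK0 : K ≠ 0) (hK : K ≠ ⊤)
    (h : ∀ n, ∀ a ∈ Set.Ioo (0 : ℝ) 1, ∫⁻ ω, ENNReal.ofReal (reg a q (u n ω).toReal) ∂P ≤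
      K * ∫⁻ ω, ENNReal.ofReal (reg a q (v n ω).toReal) ∂P') :
    ∫⁻ ω, U ω ^ q ∂P ≤ K * ∫⁻ ω, V ω ^ q ∂P' := by
  refine lintegral_rpow_le_of_reg hU hV hUt hVt hK0 hK fun a ha => ?_
  exact le_of_tendsto_of_tendsto' (tendsto_lintegral_reg ha hu huU)
    (ENNReal.Tendsto.const_mul (tendsto_lintegral_reg ha hv hvV) (Or.inr hK)) fun n => h n a ha

/-- Fatou's lemma for moments under almost sure convergence. -/
lemma lintegral_rpow_le_of_tendsto_of_le {Ω : Type*} [MeasurableSpace Ω] {P : Measure Ω} {q : ℝ}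
    {U : Ω → ℝ≥0∞} {u : ℕ → Ω → ℝ≥0∞} (hu : ∀ n, Measurable (u n))
    (hUt : ∀ᵐ ω ∂P, U ω ≠ ⊤) (hut : ∀ n, ∀ᵐ ω ∂P, u n ω ≠ ⊤)
    (huU : ∀ᵐ ω ∂P, Tendsto (fun n => (u n ω).toReal) atTop (𝓝 (U ω).toReal)) {B : ℝ≥0∞}
    (hB : ∀ᶠ n in atTop, ∫⁻ ω, u n ω ^ q ∂P ≤ B) : ∫⁻ ω, U ω ^ q ∂P ≤ B := by
  calc _ ≤ ∫⁻ ω, liminf (fun n => u n ω ^ q) atTop ∂P := by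
        refine lintegral_mono_ae ?_
        filter_upwards [hUt, ae_all_iff.2 hut, huU] with ω h1 h2 h3
        have h4 : Tendsto (fun n => u n ω) atTop (𝓝 (U ω)) :=
          (ENNReal.tendsto_toReal_iff h2 h1).1 h3
        exact ((ENNReal.continuous_rpow_const.tendsto _).comp h4).liminf_eq.ge
    _ ≤ liminf (fun n => ∫⁻ ω, u n ω ^ q ∂P) atTop :=
        lintegral_liminf_le fun n => (hu n).pow_const q
    _ ≤ B := liminf_le_of_frequently_le' hB.frequently

/-- Comparison of regularized moments of the masses of two fields with close covariances and
comparable weights. -/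
lemma IsGaussField.lintegral_reg_expMass_withDensity_le {T Ω Ω' : Type*} [MeasurableSpace T]
    [MeasurableSpace Ω] [MeasurableSpace Ω'] {P : Measure Ω} {P' : Measure Ω'} {Z : T → Ω → ℝ}
    {Z' : T → Ω' → ℝ} {C C' : T → T → ℝ} (hZ : IsGaussField P Z C) (hZ' : IsGaussField P' Z' C')
    (μ : Measure T) [IsFiniteMeasure μ] {S : Set T} (hS : μ Sᶜ = 0)
    {δ : ℝ} (hδ0 : 0 ≤ δ)
    (hδ : ∀ s ∈ S, ∀ t ∈ S, |C s t - C' s t| ≤ δ) {w w' : T → ℝ} (hw : Measurable w)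
    (hw' : Measurable w') {B η : ℝ} (hwB : ∀ t, w t ≤ B) (hwB' : ∀ t, w' t ≤ B)
    (hη : 1 ≤ η) (hww' : ∀ t ∈ S, w t ≤ η * w' t)
    (hw'w : ∀ t ∈ S, w' t ≤ η * w t) {a : ℝ} (ha : 0 < a) (ha1 : a < 1) (q : ℝ) :
    ∫⁻ ω, ENNReal.ofReal
        (reg a q (expMass (μ.withDensity fun t => ENNReal.ofReal (w t)) Z C ω).toReal) ∂P ≤
      ENNReal.ofReal (Real.exp ((q ^ 2 + 3 * |q|) * δ * (Real.pi / 2)) * η ^ |q|) *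
        ∫⁻ ω, ENNReal.ofReal
          (reg a q (expMass (μ.withDensity fun t => ENNReal.ofReal (w' t)) Z' C' ω).toReal)
          ∂P' := by
  have hη0 : 0 ≤ η := by linarith
  have hfin : ∀ {w : T → ℝ}, (∀ t, w t ≤ B) →
      IsFiniteMeasure (μ.withDensity fun t => ENNReal.ofReal (w t)) := fun {w} hwB => by
    refine isFiniteMeasure_withDensity (ne_of_lt ?_)
    refine (lintegral_mono fun t => ENNReal.ofReal_le_ofReal (hwB t)).trans_lt ?_
    rw [lintegral_const]
    exact ENNReal.mul_lt_top ENNReal.ofReal_lt_top (measure_lt_top _ _)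
  have := hfin hwB
  have := hfin hwB'
  have hle : ∀ {v v' : T → ℝ}, Measurable v → Measurable v' → (∀ t ∈ S, v t ≤ η * v' t) → ∀ ω,
      expMass (μ.withDensity fun t => ENNReal.ofReal (v t)) Z' C' ω ≤
        ENNReal.ofReal η * expMass (μ.withDensity fun t => ENNReal.ofReal (v' t)) Z' C' ω := by
    intro v v' hv hv' hvv' ω
    have hm : Measurable fun t => ENNReal.ofReal (Real.exp (Z' t ω - C' t t / 2)) :=
      (hZ'.measurable_wick.comp (measurable_prodMk_right (y := ω))).ennreal_ofReal
    unfold expMass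
    rw [lintegral_withDensity_eq_lintegral_mul _ hv.ennreal_ofReal hm,
      lintegral_withDensity_eq_lintegral_mul _ hv'.ennreal_ofReal hm,
      ← lintegral_const_mul' _ _ ENNReal.ofReal_ne_top]
    refine lintegral_mono_ae ?_
    filter_upwards [mem_ae_iff.2 hS] with t ht
    simp only [Pi.mul_apply]
    rw [← mul_assoc, ← ENNReal.ofReal_mul hη0]
    gcongr
    exact hvv' t ht
  refine (hZ.lintegral_reg_expMass_le hZ' (μ.withDensity fun t => ENNReal.ofReal (w t))
    (withDensity_absolutelyContinuous _ _ hS) hδ0 hδ ha ha1 q).trans ?_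
  rw [ENNReal.ofReal_mul (Real.exp_pos _).le, mul_assoc (ENNReal.ofReal _)]
  refine mul_le_mul_right ?_ _
  rw [← lintegral_const_mul' _ _ ENNReal.ofReal_ne_top]
  refine lintegral_mono_ae ?_
  filter_upwards [hZ'.ae_expMass_ne_top (μ.withDensity fun t => ENNReal.ofReal (w t)),
    hZ'.ae_expMass_ne_top (μ.withDensity fun t => ENNReal.ofReal (w' t))] with ω h1 h2
  rw [← ENNReal.ofReal_mul (by positivity)]
  refine ENNReal.ofReal_le_ofReal (reg_le_mul ha ha1 ENNReal.toReal_nonneg ENNReal.toReal_nonneg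
    hη ?_ ?_)
  · rw [← ENNReal.toReal_ofReal hη0, ← ENNReal.toReal_mul]
    exact ENNReal.toReal_mono (ENNReal.mul_ne_top ENNReal.ofReal_ne_top h2) (hle hw hw' hww' ω)
  · rw [← ENNReal.toReal_ofReal hη0, ← ENNReal.toReal_mul]
    exact ENNReal.toReal_mono (ENNReal.mul_ne_top ENNReal.ofReal_ne_top h1) (hle hw' hw hw'w ω)

/-- A constant Gaussian field. -/
lemma isGaussField_gaussianReal {T : Type*} [MeasurableSpace T] (γ : ℝ) (v : ℝ≥0) :
    IsGaussField (gaussianReal 0 v) (fun (_ : T) y => γ * y) (fun _ _ => γ * γ * v) where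
  meas := by
    unfold Function.uncurry
    fun_prop
  symm _ _ := rfl
  mgf {ι} _ t l := by
    have h1 : ∀ y : ℝ, ∑ i, l i * (γ * y) = ((∑ i, l i) * γ) * y := fun y => by
      rw [← Finset.sum_mul, mul_assoc]
    have h2 : ∑ i, ∑ j, l i * l j * (γ * γ * (v : ℝ)) = v * ((∑ i, l i) * γ) ^ 2 := by
      simp only [← Finset.sum_mul, ← Finset.mul_sum]
      ring
    rw [h2]
    simp only [h1]
    rw [← ofReal_integral_eq_lintegral_ofReal (integrable_exp_mul_gaussianReal _)
      (ae_of_all _ fun _ => (Real.exp_pos _).le)]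
    have := congrFun (mgf_fun_id_gaussianReal (μ := 0) (v := v)) ((∑ i, l i) * γ)
    simp only [ProbabilityTheory.mgf, zero_mul, zero_add] at this
    rw [this]

lemma expMass_add_const_mul {T Ω : Type*} [MeasurableSpace T]
    (μ : Measure T) (Z : T → Ω → ℝ) (C : T → T → ℝ) (γ : ℝ) (v : ℝ≥0) (ω : Ω × ℝ) :
    expMass μ (fun t ω => Z t ω.1 + γ * ω.2) (fun s t => C s t + γ * γ * v) ω =
      ENNReal.ofReal (Real.exp (γ * ω.2 - γ * γ * v / 2)) * expMass μ Z C ω.1 := by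
  unfold expMass
  rw [← lintegral_const_mul' _ _ ENNReal.ofReal_ne_top]
  refine lintegral_congr fun t => ?_
  rw [← ENNReal.ofReal_mul (Real.exp_pos _).le, ← Real.exp_add]
  congr 2
  ring

/-- Moments of a lognormal variable. -/
lemma lintegral_rpow_exp_gaussianReal (γ q : ℝ) (v : ℝ≥0) :
    ∫⁻ y, ENNReal.ofReal (Real.exp (γ * y - γ * γ * v / 2)) ^ q ∂gaussianReal 0 v =
      ENNReal.ofReal (Real.exp (γ ^ 2 * (q ^ 2 - q) / 2 * v)) := by
  have h : ∀ y : ℝ, ENNReal.ofReal (Real.exp (γ * y - γ * γ * v / 2)) ^ q =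
      ENNReal.ofReal (Real.exp (-(q * (γ * γ * v / 2)))) *
        ENNReal.ofReal (Real.exp (q * (γ * y))) := fun y => by
    rw [ENNReal.ofReal_rpow_of_pos (Real.exp_pos _), ← Real.exp_mul,
      ← ENNReal.ofReal_mul (Real.exp_pos _).le, ← Real.exp_add]
    congr 2
    ring
  simp only [h]
  rw [lintegral_const_mul' _ _ ENNReal.ofReal_ne_top,
    (isGaussField_gaussianReal (T := Unit) γ v).lintegral_exp () q,
    ← ENNReal.ofReal_mul (Real.exp_pos _).le, ← Real.exp_add]
  congr 2
  ring

/-- A function on `(0, ∞)` with vanishing oscillation at zero has a limit at zero. -/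
lemma exists_tendsto_nhdsGT_zero_of_osc {φ : ℝ → ℝ}
    (h : ∀ η > 0, ∃ r₀ > 0, ∀ r ∈ Set.Ioc 0 r₀, ∀ r' ∈ Set.Ioc 0 r₀, |φ r - φ r'| ≤ η) :
    ∃ L, Tendsto φ (𝓝[>] 0) (𝓝 L) := by
  refine cauchy_map_iff_exists_tendsto.1 (Metric.cauchy_iff.2 ⟨inferInstance, fun η hη => ?_⟩)
  obtain ⟨r₀, hr₀, hr⟩ := h (η / 2) (half_pos hη)
  refine ⟨φ '' Set.Ioc 0 r₀, image_mem_map (Ioc_mem_nhdsGT hr₀), ?_⟩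
  rintro _ ⟨r, h1, rfl⟩ _ ⟨r', h2, rfl⟩
  rw [Real.dist_eq]
  linarith [hr r h1 r' h2]

/-- The rescaled approximate mass of the ball of center `x` and radius `r`. -/
def ballMass {Ω : Type*} (γ : ℝ) (X : ℝ → EuclideanSpace ℝ (Fin d) → Ω → ℝ)
    (k : ℝ → ℝ → EuclideanSpace ℝ (Fin d) → EuclideanSpace ℝ (Fin d) → ℝ)
    (f : EuclideanSpace ℝ (Fin d) → ℝ) (x : EuclideanSpace ℝ (Fin d)) (r ε : ℝ) (ω : Ω) : ℝ≥0∞ :=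
  expMass ((volume.restrict (Metric.ball 0 1)).withDensity fun z => ENNReal.ofReal (f (x + r • z)))
    (fun z ω => γ * X (r * ε) (x + r • z) ω)
    (fun z z' => γ * γ * k (r * ε) (r * ε) (x + r • z) (x + r • z')) ω

lemma isFiniteMeasure_withDensity_ofReal {T : Type*} [MeasurableSpace T] (μ : Measure T)
    [IsFiniteMeasure μ] {w : T → ℝ} {B : ℝ} (hw : ∀ t, w t ≤ B) :
    IsFiniteMeasure (μ.withDensity fun t => ENNReal.ofReal (w t)) := by
  refine isFiniteMeasure_withDensity (ne_of_lt ?_)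
  refine (lintegral_mono fun t => ENNReal.ofReal_le_ofReal (hw t)).trans_lt ?_
  rw [lintegral_const]
  exact ENNReal.mul_lt_top ENNReal.ofReal_lt_top (measure_lt_top _ _)

namespace IsLogField

variable {Ω : Type*} [MeasurableSpace Ω] {P : Measure Ω}
  {X : ℝ → EuclideanSpace ℝ (Fin d) → Ω → ℝ}
  {k : ℝ → ℝ → EuclideanSpace ℝ (Fin d) → EuclideanSpace ℝ (Fin d) → ℝ} {c γ r r' ε q : ℝ}
  {f : EuclideanSpace ℝ (Fin d) → ℝ} {x : EuclideanSpace ℝ (Fin d)}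

lemma measurable_ballMass (h : IsLogField P X k c) (hε : ε ∈ Set.Ioc (0 : ℝ) 1)
    (hr : r ∈ Set.Ioc (0 : ℝ) 1) : Measurable (ballMass γ X k f x r ε) :=
  (h.field_ball γ hε hr x).measurable_expMass _

lemma ae_ballMass_ne_top (h : IsLogField P X k c) (hε : ε ∈ Set.Ioc (0 : ℝ) 1)
    (hr : r ∈ Set.Ioc (0 : ℝ) 1) {B : ℝ} (hf : ∀ y, f y ≤ B) :
    ∀ᵐ ω ∂P, ballMass γ X k f x r ε ω ≠ ⊤ :=
  have : IsFiniteMeasure (volume.restrict (Metric.ball (0 : EuclideanSpace ℝ (Fin d)) 1)) :=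
    isFiniteMeasure_restrict.2 measure_ball_lt_top.ne
  have := isFiniteMeasure_withDensity_ofReal (volume.restrict (Metric.ball 0 1))
    fun z => hf (x + r • z)
  (h.field_ball γ hε hr x).ae_expMass_ne_top _

lemma ballMass_eq_lintegral (h : IsLogField P X k c) (hf : Measurable f)
    (hε : ε ∈ Set.Ioc (0 : ℝ) 1) (hr : r ∈ Set.Ioc (0 : ℝ) 1) (ω : Ω) :
    ballMass γ X k f x r ε ω = ∫⁻ z in Metric.ball 0 1, ENNReal.ofReal (f (x + r • z)) *
      ENNReal.ofReal (Real.exp (γ * X (r * ε) (x + r • z) ω -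
        γ * γ * k (r * ε) (r * ε) (x + r • z) (x + r • z) / 2)) := by
  have hm : Measurable fun z => ENNReal.ofReal (Real.exp (γ * X (r * ε) (x + r • z) ω -
      γ * γ * k (r * ε) (r * ε) (x + r • z) (x + r • z) / 2)) :=
    ((h.field_ball γ hε hr x).measurable_wick.comp
      (measurable_prodMk_right (y := ω))).ennreal_ofReal
  have hf' : Measurable fun z : EuclideanSpace ℝ (Fin d) => ENNReal.ofReal (f (x + r • z)) :=
    (hf.comp (by fun_prop)).ennreal_ofReal
  unfold ballMass expMass
  rw [lintegral_withDensity_eq_lintegral_mul _ hf' hm]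
  rfl

/-- The approximate mass of a small ball in terms of its rescaling. -/
lemma setIntegral_ball_eq (h : IsLogField P X k c) (hf : Measurable f) (hf0 : ∀ y, 0 ≤ f y)
    (hε : ε ∈ Set.Ioc (0 : ℝ) 1) (hr : r ∈ Set.Ioc (0 : ℝ) 1) (ω : Ω) :
    ∫ y in Metric.ball x r, Real.exp (γ * X (r * ε) y ω -
      γ ^ 2 / 2 * k (r * ε) (r * ε) y y) * f y = r ^ d * (ballMass γ X k f x r ε ω).toReal := by
  have hm : Measurable fun y => Real.exp (γ * X (r * ε) y ω -
      γ ^ 2 / 2 * k (r * ε) (r * ε) y y) * f y := by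
    refine Measurable.mul ?_ hf
    convert (h.field_eps γ ⟨mul_pos hr.1 hε.1, mul_le_one₀ hr.2 hε.1.le hε.2⟩).measurable_wick.comp
      (measurable_prodMk_right (y := ω)) using 2 with y
    simp only [Function.comp_apply]
    congr 1
    ring
  rw [integral_eq_lintegral_of_nonneg_ae
    (ae_of_all _ fun y => mul_nonneg (Real.exp_pos _).le (hf0 y)) hm.aestronglyMeasurable,
    setLIntegral_ball_eq hr.1, ENNReal.toReal_mul, ENNReal.toReal_ofReal (pow_pos hr.1 d).le,
    h.ballMass_eq_lintegral hf hε hr]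
  congr 2
  refine lintegral_congr fun z => ?_
  rw [← ENNReal.ofReal_mul (hf0 _), mul_comm]
  congr 4
  ring

/-- The moments of the limiting rescaled masses of two concentric balls are comparable up to the
lognormal factor coming from the logarithmic divergence of the covariance. -/
lemma lintegral_rpow_comparable [IsProbabilityMeasure P] (h : IsLogField P X k c)
    (hf : Measurable f) {B η δ : ℝ} (hfB : ∀ y, f y ≤ B) (hδ0 : 0 ≤ δ) (hη : 1 ≤ η)
    (hr : r ∈ Set.Ioc (0 : ℝ) 1) (hr' : r' ∈ Set.Ioc (0 : ℝ) 1) (hrr' : r' ≤ r)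
    (hδ : ∀ ε ∈ Set.Ioc (0 : ℝ) 1, ∀ z ∈ Metric.ball (0 : EuclideanSpace ℝ (Fin d)) 1,
      ∀ z' ∈ Metric.ball (0 : EuclideanSpace ℝ (Fin d)) 1,
      |k (r * ε) (r * ε) (x + r • z) (x + r • z') + Real.log (r / r') -
        k (r' * ε) (r' * ε) (x + r' • z) (x + r' • z')| ≤ δ)
    (hfη : ∀ z ∈ Metric.ball (0 : EuclideanSpace ℝ (Fin d)) 1,
      f (x + r • z) ≤ η * f (x + r' • z) ∧ f (x + r' • z) ≤ η * f (x + r • z))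
    {ε : ℕ → ℝ} (hε : ∀ n, ε n ∈ Set.Ioc (0 : ℝ) 1) {U U' : Ω → ℝ≥0∞} (hU : Measurable U)
    (hU' : Measurable U') (hUt : ∀ᵐ ω ∂P, U ω ≠ ⊤) (hUt' : ∀ᵐ ω ∂P, U' ω ≠ ⊤)
    (hlim : ∀ᵐ ω ∂P, Tendsto (fun n => (ballMass γ X k f x r (ε n) ω).toReal) atTop
      (𝓝 (U ω).toReal))
    (hlim' : ∀ᵐ ω ∂P, Tendsto (fun n => (ballMass γ X k f x r' (ε n) ω).toReal) atTop
      (𝓝 (U' ω).toReal)) (q : ℝ) :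
    ENNReal.ofReal ((r / r') ^ (γ ^ 2 * (q ^ 2 - q) / 2)) * ∫⁻ ω, U ω ^ q ∂P ≤
        ENNReal.ofReal (Real.exp ((q ^ 2 + 3 * |q|) * (γ * γ * δ) * (Real.pi / 2)) * η ^ |q|) *
          ∫⁻ ω, U' ω ^ q ∂P ∧
      ∫⁻ ω, U' ω ^ q ∂P ≤
        ENNReal.ofReal (Real.exp ((q ^ 2 + 3 * |q|) * (γ * γ * δ) * (Real.pi / 2)) * η ^ |q|) *
          (ENNReal.ofReal ((r / r') ^ (γ ^ 2 * (q ^ 2 - q) / 2)) * ∫⁻ ω, U ω ^ q ∂P) := by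
  have hrr : 1 ≤ r / r' := (one_le_div hr'.1).2 hrr'
  set v : ℝ≥0 := ⟨Real.log (r / r'), Real.log_nonneg hrr⟩ with hv
  have hv' : (v : ℝ) = Real.log (r / r') := rfl
  set K : ℝ≥0∞ := ENNReal.ofReal
    (Real.exp ((q ^ 2 + 3 * |q|) * (γ * γ * δ) * (Real.pi / 2)) * η ^ |q|) with hK
  have hK0 : K ≠ 0 := by
    rw [hK, Ne, ENNReal.ofReal_eq_zero, not_le]
    positivity
  have hKt : K ≠ ⊤ := ENNReal.ofReal_ne_top
  set μ : Measure (EuclideanSpace ℝ (Fin d)) := volume.restrict (Metric.ball 0 1) with hμ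
  have : IsFiniteMeasure μ := isFiniteMeasure_restrict.2 measure_ball_lt_top.ne
  have hμ0 : μ (Metric.ball 0 1)ᶜ = 0 := by
    rw [hμ, Measure.restrict_apply Metric.isOpen_ball.measurableSet.compl]
    simp
  have hfm : ∀ ρ : ℝ, Measurable fun z => f (x + ρ • z) := fun ρ => hf.comp (by fun_prop)
  have hZ1 := fun n => (h.field_ball γ (hε n) hr x).add (isGaussField_gaussianReal γ v)
  have hZ2 := fun n => h.field_ball γ (hε n) hr' x
  have hcov : ∀ n, ∀ z ∈ Metric.ball (0 : EuclideanSpace ℝ (Fin d)) 1,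
      ∀ z' ∈ Metric.ball (0 : EuclideanSpace ℝ (Fin d)) 1,
      |γ * γ * k (r * ε n) (r * ε n) (x + r • z) (x + r • z') + γ * γ * v -
        γ * γ * k (r' * ε n) (r' * ε n) (x + r' • z) (x + r' • z')| ≤ γ * γ * δ :=
    fun n z hz z' hz' => by
      rw [← mul_add, ← mul_sub, abs_mul, abs_of_nonneg (mul_self_nonneg γ)]
      exact mul_le_mul_of_nonneg_left (hδ _ (hε n) z hz z' hz') (mul_self_nonneg γ)
  have hδγ : 0 ≤ γ * γ * δ := mul_nonneg (mul_self_nonneg γ) hδ0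
  set V : Ω × ℝ → ℝ≥0∞ := fun ω =>
    ENNReal.ofReal (Real.exp (γ * ω.2 - γ * γ * v / 2)) * U ω.1 with hV
  set V' : ℕ → Ω × ℝ → ℝ≥0∞ := fun n ω =>
    ENNReal.ofReal (Real.exp (γ * ω.2 - γ * γ * v / 2)) * ballMass γ X k f x r (ε n) ω.1 with hV'
  have hem : Measurable fun ω : Ω × ℝ =>
      ENNReal.ofReal (Real.exp (γ * ω.2 - γ * γ * v / 2)) := by fun_prop
  have hVm : Measurable V := hem.mul (hU.comp measurable_fst)
  have hVm' : ∀ n, Measurable (V' n) := fun n =>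
    hem.mul ((h.measurable_ballMass (hε n) hr).comp measurable_fst)
  have hVt : ∀ᵐ ω ∂P.prod (gaussianReal 0 v), V ω ≠ ⊤ := by
    filter_upwards [Measure.quasiMeasurePreserving_fst.ae hUt] with ω hω
    exact ENNReal.mul_ne_top ENNReal.ofReal_ne_top hω
  have hVlim : ∀ᵐ ω ∂P.prod (gaussianReal 0 v),
      Tendsto (fun n => (V' n ω).toReal) atTop (𝓝 (V ω).toReal) := by
    filter_upwards [Measure.quasiMeasurePreserving_fst.ae hlim] with ω hω
    simp only [hV, hV', ENNReal.toReal_mul]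
    exact hω.const_mul _
  have hVint : ∫⁻ ω, V ω ^ q ∂P.prod (gaussianReal 0 v) =
      ENNReal.ofReal ((r / r') ^ (γ ^ 2 * (q ^ 2 - q) / 2)) * ∫⁻ ω, U ω ^ q ∂P := by
    have e1 : ∀ ω, V ω ^ q = U ω.1 ^ q *
        ENNReal.ofReal (Real.exp (γ * ω.2 - γ * γ * v / 2)) ^ q := fun ω => by
      rw [hV, ennreal_mul_rpow (by simp [Real.exp_pos]) ENNReal.ofReal_ne_top, mul_comm]
    have hem2 : Measurable fun y : ℝ =>
        ENNReal.ofReal (Real.exp (γ * y - γ * γ * v / 2)) ^ q := by fun_prop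
    simp only [e1]
    rw [lintegral_prod_mul (hU.pow_const q).aemeasurable hem2.aemeasurable,
      lintegral_rpow_exp_gaussianReal, mul_comm, Real.rpow_def_of_pos (by linarith), hv', mul_comm
        (Real.log _)]
  have hmass : ∀ n ω, V' n ω = expMass (μ.withDensity fun z => ENNReal.ofReal (f (x + r • z)))
      (fun t ω => γ * X (r * ε n) (x + r • t) ω.1 + γ * ω.2)
      (fun z z' => γ * γ * k (r * ε n) (r * ε n) (x + r • z) (x + r • z') + γ * γ * v) ω :=
    fun n ω => (expMass_add_const_mul _ (fun z ω => γ * X (r * ε n) (x + r • z) ω)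
      _ γ v ω).symm
  rw [← hVint]
  constructor
  · refine lintegral_rpow_le_of_tendsto hVm hU' hVm'
      (fun n => h.measurable_ballMass (hε n) hr') hVt hUt' hVlim hlim' hK0 hKt fun n a ha => ?_
    simp only [hmass]
    exact (hZ1 n).lintegral_reg_expMass_withDensity_le (hZ2 n) μ hμ0 hδγ (hcov n) (hfm r) (hfm r')
      (fun _ => hfB _) (fun _ => hfB _) hη (fun z hz => (hfη z hz).1) (fun z hz => (hfη z hz).2)
      ha.1 ha.2 q
  · refine lintegral_rpow_le_of_tendsto hU' hVm
      (fun n => h.measurable_ballMass (hε n) hr') hVm' hUt' hVt hlim' hVlim hK0 hKt fun n a ha => ?_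
    simp only [hmass]
    exact (hZ2 n).lintegral_reg_expMass_withDensity_le (hZ1 n) μ hμ0 hδγ
      (fun z hz z' hz' => by rw [abs_sub_comm]; exact hcov n z hz z' hz') (hfm r') (hfm r)
      (fun _ => hfB _) (fun _ => hfB _) hη (fun z hz => (hfη z hz).2) (fun z hz => (hfη z hz).1)
      ha.1 ha.2 q

end IsLogField

/-- Two sequences converging in measure converge almost surely along a common subsequence. -/
lemma exists_strictMono_tendsto_ae_and {Ω : Type*} [MeasurableSpace Ω] {P : Measure Ω}
    {u v : ℕ → Ω → ℝ} {U V : Ω → ℝ} (hu : TendstoInMeasure P u atTop U)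
    (hv : TendstoInMeasure P v atTop V) :
    ∃ ns : ℕ → ℕ, StrictMono ns ∧ (∀ᵐ ω ∂P, Tendsto (fun n => u (ns n) ω) atTop (𝓝 (U ω))) ∧
      ∀ᵐ ω ∂P, Tendsto (fun n => v (ns n) ω) atTop (𝓝 (V ω)) := by
  obtain ⟨ns, hns, h1⟩ := hu.exists_seq_tendsto_ae
  have hv' : TendstoInMeasure P (fun n => v (ns n)) atTop V :=
    fun δ hδ => (hv δ hδ).comp hns.tendsto_atTop
  obtain ⟨ms, hms, h2⟩ := hv'.exists_seq_tendsto_ae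
  refine ⟨ns ∘ ms, hns.comp hms, ?_, h2⟩
  filter_upwards [h1] with ω hω using hω.comp hms.tendsto_atTop

lemma abs_log_sub_log_le {a b K κ : ℝ} (ha : 0 < a) (hb : 0 < b) (hK : 0 < K)
    (hKκ : Real.log K ≤ κ) (h1 : a ≤ K * b) (h2 : b ≤ K * a) :
    |Real.log a - Real.log b| ≤ κ := by
  have l1 := Real.log_le_log ha h1
  have l2 := Real.log_le_log hb h2
  rw [Real.log_mul hK.ne' hb.ne'] at l1
  rw [Real.log_mul hK.ne' ha.ne'] at l2
  rw [abs_le]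
  constructor <;> linarith

lemma log_exp_mul_rpow_le {A κ : ℝ} (hA : 0 ≤ A) (hκ : 0 ≤ κ) (q : ℝ) :
    Real.log (Real.exp (A * (κ / (2 * (A + 1)))) *
      (Real.exp (κ / (4 * (|q| + 1))) * Real.exp (κ / (4 * (|q| + 1)))) ^ |q|) ≤ κ := by
  have e1 : (Real.exp (κ / (4 * (|q| + 1))) * Real.exp (κ / (4 * (|q| + 1)))) ^ |q| =
      Real.exp (κ / 2 * (|q| / (|q| + 1))) := by
    rw [← Real.exp_add, ← Real.exp_mul]
    congr 1
    field_simp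
    ring
  have e2 : A * (κ / (2 * (A + 1))) = κ / 2 * (A / (A + 1)) := by
    have : A + 1 ≠ 0 := by positivity
    field_simp
  rw [e1, e2, ← Real.exp_add, Real.log_exp]
  have e3 : |q| / (|q| + 1) ≤ 1 := (div_le_one (by positivity)).2 (by linarith)
  have e4 : A / (A + 1) ≤ 1 := (div_le_one (by positivity)).2 (by linarith)
  have := mul_le_mul_of_nonneg_left e3 (div_nonneg hκ zero_le_two)
  have := mul_le_mul_of_nonneg_left e4 (div_nonneg hκ zero_le_two)
  linarith

namespace IsLogField

variable {Ω : Type*} [MeasurableSpace Ω] {P : Measure Ω}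
  {X : ℝ → EuclideanSpace ℝ (Fin d) → Ω → ℝ}
  {k : ℝ → ℝ → EuclideanSpace ℝ (Fin d) → EuclideanSpace ℝ (Fin d) → ℝ} {c γ r r' ε q : ℝ}
  {f : EuclideanSpace ℝ (Fin d) → ℝ} {x : EuclideanSpace ℝ (Fin d)}

/-- The moments of the limiting rescaled mass of a small ball are finite. -/
lemma exists_lintegral_rpow_lt_top (h : IsLogField P X k c) (hd : 1 ≤ d) (hγ : 0 < γ)
    (hsub : γ ^ 2 < 2 * d) (hq : q < 2 * d / γ ^ 2) (hf : Continuous f) {B : ℝ}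
    (hfB : ∀ y, f y ≤ B) (hfx : 0 < f x) :
    ∃ r₁ ∈ Set.Ioc (0 : ℝ) 1, ∀ r ∈ Set.Ioc 0 r₁, ∀ (ε : ℕ → ℝ) (U : Ω → ℝ≥0∞),
      (∀ n, ε n ∈ Set.Ioc (0 : ℝ) 1) → Tendsto ε atTop (𝓝 0) → (∀ᵐ ω ∂P, U ω ≠ ⊤) →
      (∀ᵐ ω ∂P, Tendsto (fun n => (ballMass γ X k f x r (ε n) ω).toReal) atTop
        (𝓝 (U ω).toReal)) → ∫⁻ ω, U ω ^ q ∂P < ⊤ := by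
  obtain ⟨r₁, hr₁, H⟩ := h.exists_lintegral_expMass_rpow_le hd hγ hsub hq x
  have hB : 0 < B := hfx.trans_le (hfB x)
  obtain ⟨ρ, hρ, hfρ⟩ := Metric.eventually_nhds_iff_ball.1
    ((hf.tendsto x).eventually (lt_mem_nhds (half_lt_self hfx)))
  refine ⟨min r₁ ρ, ⟨lt_min hr₁.1 hρ, (min_le_left _ _).trans hr₁.2⟩,
    fun r hr ε U hε hε0 hUt hlim => ?_⟩
  have hr1 : r ∈ Set.Ioc 0 r₁ := ⟨hr.1, hr.2.trans (min_le_left _ _)⟩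
  have hrI : r ∈ Set.Ioc (0 : ℝ) 1 := ⟨hr.1, hr1.2.trans hr₁.2⟩
  obtain ⟨A, hA, ε₁, hε₁, hAε⟩ := H r hr1
  have hKt : ENNReal.ofReal B ^ q + ENNReal.ofReal (f x / 2) ^ q ≠ ⊤ :=
    ENNReal.add_ne_top.2 ⟨ENNReal.rpow_ne_top_of_ne_zero (by simpa using hB) ENNReal.ofReal_ne_top,
      ENNReal.rpow_ne_top_of_ne_zero (by simpa using hfx) ENNReal.ofReal_ne_top⟩
  have hbd : ∀ n ω, ballMass γ X k f x r (ε n) ω ^ q ≤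
      (ENNReal.ofReal B ^ q + ENNReal.ofReal (f x / 2) ^ q) *
        expMass (volume.restrict (Metric.ball 0 1))
        (fun z ω => γ * X (r * ε n) (x + r • z) ω)
        (fun z z' => γ * γ * k (r * ε n) (r * ε n) (x + r • z) (x + r • z')) ω ^ q := by
    intro n ω
    rw [h.ballMass_eq_lintegral hf.measurable (hε n) hrI]
    rcases le_or_gt 0 q with hq0 | hq0
    · refine le_trans (ENNReal.rpow_le_rpow (z := q) ?_ hq0) (le_trans (ennreal_mul_rpow
        (a := ENNReal.ofReal B) (by simpa using hB) ENNReal.ofReal_ne_top _ q).le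
        (mul_le_mul_left (self_le_add_right _ _) _))
      unfold expMass
      rw [← lintegral_const_mul' _ _ ENNReal.ofReal_ne_top]
      refine lintegral_mono fun z => ?_
      gcongr
      exact hfB _
    · refine le_trans (ennreal_rpow_le_rpow_of_nonpos hq0.le ?_) (le_trans (ennreal_mul_rpow
        (a := ENNReal.ofReal (f x / 2)) (by simpa using hfx) ENNReal.ofReal_ne_top _ q).le
        (mul_le_mul_left (self_le_add_left _ _) _))
      unfold expMass
      rw [← lintegral_const_mul' _ _ ENNReal.ofReal_ne_top]
      refine setLIntegral_mono' Metric.isOpen_ball.measurableSet fun z hz => ?_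
      gcongr
      refine (hfρ _ ?_).le
      rw [mem_ball_iff_norm, add_sub_cancel_left, norm_smul, Real.norm_of_nonneg hr.1.le]
      rw [mem_ball_zero_iff] at hz
      nlinarith [hr.1, hr.2.trans (min_le_right _ _)]
  have hev : ∀ᶠ n in atTop, ∫⁻ ω, ballMass γ X k f x r (ε n) ω ^ q ∂P ≤
      (ENNReal.ofReal B ^ q + ENNReal.ofReal (f x / 2) ^ q) * A := by
    filter_upwards [hε0.eventually (gt_mem_nhds hε₁.1)] with n hn
    refine (lintegral_mono fun ω => hbd n ω).trans ?_
    rw [lintegral_const_mul' _ _ hKt]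
    exact mul_le_mul_right (hAε _ ⟨(hε n).1, hn.le⟩) _
  exact (lintegral_rpow_le_of_tendsto_of_le (fun n => h.measurable_ballMass (hε n) hrI) hUt
    (fun n => h.ae_ballMass_ne_top (hε n) hrI hfB) hlim hev).trans_lt
    (ENNReal.mul_lt_top hKt.lt_top hA.lt_top)

/-- Power asymptotics of the moments of the limiting rescaled mass of small balls. -/
lemma exists_tendsto_lintegral_rpow [IsProbabilityMeasure P] (h : IsLogField P X k c)
    (hd : 1 ≤ d) (hγ : 0 < γ) (hsub : γ ^ 2 < 2 * d) (hq : q < 2 * d / γ ^ 2) (hf : Continuous f)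
    {B : ℝ} (hfB : ∀ y, f y ≤ B) (hfx : 0 < f x)
    (hscale : ∀ δ > 0, ∃ r₀ ∈ Set.Ioc (0 : ℝ) 1, ∀ r ∈ Set.Ioc 0 r₀, ∀ r' ∈ Set.Ioc 0 r₀,
      ∀ ε ∈ Set.Ioc (0 : ℝ) 1, ∀ z ∈ Metric.ball (0 : EuclideanSpace ℝ (Fin d)) 1,
      ∀ z' ∈ Metric.ball (0 : EuclideanSpace ℝ (Fin d)) 1,
      |k (r * ε) (r * ε) (x + r • z) (x + r • z') + Real.log (r / r') -
        k (r' * ε) (r' * ε) (x + r' • z) (x + r' • z')| ≤ δ)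
    {U : ℝ → Ω → ℝ≥0∞} {r₁ : ℝ} (hr₁ : 0 < r₁) (hU : ∀ r ∈ Set.Ioc 0 r₁, Measurable (U r))
    (hUt : ∀ r ∈ Set.Ioc 0 r₁, ∀ᵐ ω ∂P, U r ω ≠ ⊤)
    (hlim : ∀ r ∈ Set.Ioc 0 r₁, ∀ r' ∈ Set.Ioc 0 r₁, ∃ ε : ℕ → ℝ,
      (∀ n, ε n ∈ Set.Ioc (0 : ℝ) 1) ∧ Tendsto ε atTop (𝓝 0) ∧
      (∀ᵐ ω ∂P, Tendsto (fun n => (ballMass γ X k f x r (ε n) ω).toReal) atTop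
        (𝓝 (U r ω).toReal)) ∧
      ∀ᵐ ω ∂P, Tendsto (fun n => (ballMass γ X k f x r' (ε n) ω).toReal) atTop
        (𝓝 (U r' ω).toReal)) :
    ∃ C : ℝ, 0 < C ∧ Tendsto (fun r : ℝ => (∫⁻ ω, U r ω ^ q ∂P).toReal *
      r ^ (γ ^ 2 * (q ^ 2 - q) / 2)) (𝓝[>] 0) (𝓝 C) := by
  obtain ⟨r₂, hr₂, H₂⟩ := h.exists_lintegral_rpow_lt_top hd hγ hsub hq hf hfB hfx
  have hneg : (-1 : ℝ) < 2 * d / γ ^ 2 :=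
    (neg_one_lt_zero).trans_le (by positivity)
  obtain ⟨r₃, hr₃, H₃⟩ := h.exists_lintegral_rpow_lt_top hd hγ hsub hneg hf hfB hfx
  set ψ := γ ^ 2 * (q ^ 2 - q) / 2 with hψ
  set b : ℝ → ℝ := fun r => (∫⁻ ω, U r ω ^ q ∂P).toReal with hb
  set ρ := min (min r₁ r₂) r₃ with hρ
  have hρ0 : 0 < ρ := lt_min (lt_min hr₁ hr₂.1) hr₃.1
  have hρ1 : ρ ≤ r₁ := (min_le_left _ _).trans (min_le_left _ _)
  have hρ2 : ρ ≤ r₂ := (min_le_left _ _).trans (min_le_right _ _)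
  have hρ3 : ρ ≤ r₃ := min_le_right _ _
  have hfin : ∀ r ∈ Set.Ioc 0 ρ, ∫⁻ ω, U r ω ^ q ∂P ≠ ⊤ := fun r hr => by
    have hr1 : r ∈ Set.Ioc 0 r₁ := ⟨hr.1, hr.2.trans hρ1⟩
    obtain ⟨ε, h1, h2, h3, -⟩ := hlim r hr1 r hr1
    exact (H₂ r ⟨hr.1, hr.2.trans hρ2⟩ ε (U r) h1 h2 (hUt r hr1) h3).ne
  have hne0 : ∀ r ∈ Set.Ioc 0 ρ, ∫⁻ ω, U r ω ^ q ∂P ≠ 0 := fun r hr => by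
    have hr1 : r ∈ Set.Ioc 0 r₁ := ⟨hr.1, hr.2.trans hρ1⟩
    obtain ⟨ε, h1, h2, h3, -⟩ := hlim r hr1 r hr1
    have h4 := ae_lt_top ((hU r hr1).pow_const (-1 : ℝ))
      (H₃ r ⟨hr.1, hr.2.trans hρ3⟩ ε (U r) h1 h2 (hUt r hr1) h3).ne
    intro h0
    rw [lintegral_eq_zero_iff ((hU r hr1).pow_const q)] at h0
    obtain ⟨ω, h5, h6, h7⟩ := (h0.and (h4.and (hUt r hr1))).exists
    refine (ENNReal.rpow_pos (p := q) (pos_iff_ne_zero.2 fun h8 => ?_) h7).ne' h5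
    rw [h8, ENNReal.zero_rpow_of_neg neg_one_lt_zero] at h6
    exact h6.ne rfl
  have hbpos : ∀ r ∈ Set.Ioc 0 ρ, 0 < b r := fun r hr =>
    ENNReal.toReal_pos (hne0 r hr) (hfin r hr)
  have hHpos : ∀ r ∈ Set.Ioc 0 ρ, 0 < b r * r ^ ψ := fun r hr =>
    mul_pos (hbpos r hr) (Real.rpow_pos_of_pos hr.1 _)
  obtain ⟨L, hL⟩ := exists_tendsto_nhdsGT_zero_of_osc (φ := fun r => Real.log (b r * r ^ ψ)) (by
    intro κ hκ
    set A := (q ^ 2 + 3 * |q|) * (γ * γ) * (Real.pi / 2) with hA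
    have hA0 : 0 ≤ A := by positivity
    set s := Real.exp (κ / (4 * (|q| + 1))) with hs
    have hs1 : 1 < s := Real.one_lt_exp_iff.2 (by positivity)
    obtain ⟨r₄, hr₄, H₄⟩ := hscale (κ / (2 * (A + 1))) (by positivity)
    obtain ⟨r₅, hr₅, H₅⟩ := Metric.eventually_nhds_iff_ball.1
      (((hf.tendsto x).eventually (gt_mem_nhds (lt_mul_of_one_lt_left hfx hs1))).and
        ((hf.tendsto x).eventually (lt_mem_nhds (div_lt_self hfx hs1))))
    refine ⟨min ρ (min r₄ r₅), lt_min hρ0 (lt_min hr₄.1 hr₅), ?_⟩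
    have key : ∀ r ∈ Set.Ioc 0 (min ρ (min r₄ r₅)), ∀ r' ∈ Set.Ioc 0 (min ρ (min r₄ r₅)),
        r' ≤ r → |Real.log (b r * r ^ ψ) - Real.log (b r' * r' ^ ψ)| ≤ κ := by
      intro r hr r' hr' hrr'
      have mem : ∀ {r}, r ∈ Set.Ioc 0 (min ρ (min r₄ r₅)) → r ∈ Set.Ioc 0 ρ ∧ r ∈ Set.Ioc 0 r₁ ∧
          r ∈ Set.Ioc (0 : ℝ) 1 ∧ r ∈ Set.Ioc 0 r₄ ∧ r ≤ r₅ := fun {r} hr => by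
        have := le_min_iff.1 hr.2
        have h4 := le_min_iff.1 this.2
        exact ⟨⟨hr.1, this.1⟩, ⟨hr.1, this.1.trans hρ1⟩, ⟨hr.1, h4.1.trans hr₄.2⟩,
          ⟨hr.1, h4.1⟩, h4.2⟩
      have hball : ∀ {r}, r ∈ Set.Ioc 0 (min ρ (min r₄ r₅)) →
          ∀ z ∈ Metric.ball (0 : EuclideanSpace ℝ (Fin d)) 1, x + r • z ∈ Metric.ball x r₅ :=
        fun {r} hr z hz => by
          rw [mem_ball_iff_norm, add_sub_cancel_left, norm_smul, Real.norm_of_nonneg hr.1.le]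
          rw [mem_ball_zero_iff] at hz
          nlinarith [hr.1, (mem hr).2.2.2.2]
      have hs0 : 0 < s := by linarith
      have hfs : ∀ y ∈ Metric.ball x r₅, ∀ y' ∈ Metric.ball x r₅, f y ≤ s * s * f y' := by
        intro y hy y' hy'
        have h1 := (H₅ y hy).1
        have h2 := (div_lt_iff₀' hs0).1 (H₅ y' hy').2
        nlinarith
      obtain ⟨ε, hε, -, hl, hl'⟩ := hlim r (mem hr).2.1 r' (mem hr').2.1
      obtain ⟨c1, c2⟩ := h.lintegral_rpow_comparable hf.measurable hfB
        (δ := κ / (2 * (A + 1))) (by positivity) (η := s * s) (by nlinarith) (mem hr).2.2.1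
        (mem hr').2.2.1 hrr' (fun ε hε => H₄ r (mem hr).2.2.2.1 r' (mem hr').2.2.2.1 ε hε)
        (fun z hz => ⟨hfs _ (hball hr z hz) _ (hball hr' z hz),
          hfs _ (hball hr' z hz) _ (hball hr z hz)⟩) hε (hU r (mem hr).2.1)
        (hU r' (mem hr').2.1) (hUt r (mem hr).2.1) (hUt r' (mem hr').2.1) hl hl' q
      set K := Real.exp ((q ^ 2 + 3 * |q|) * (γ * γ * (κ / (2 * (A + 1)))) * (Real.pi / 2)) *
        (s * s) ^ |q| with hK
      have hK0 : 0 < K := by positivity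
      have hKκ : Real.log K ≤ κ := by
        have e : (q ^ 2 + 3 * |q|) * (γ * γ * (κ / (2 * (A + 1)))) * (Real.pi / 2) =
            A * (κ / (2 * (A + 1))) := by
          rw [hA]
          ring
        rw [hK, e]
        exact log_exp_mul_rpow_le hA0 hκ.le q
      have hpow : (r / r') ^ ψ * r' ^ ψ = r ^ ψ := by
        rw [← Real.mul_rpow (div_nonneg hr.1.le hr'.1.le) hr'.1.le, div_mul_cancel₀ _ hr'.1.ne']
      have hψ0 : 0 ≤ (r / r') ^ ψ := Real.rpow_nonneg (div_nonneg hr.1.le hr'.1.le) _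
      have hp' : 0 < r' ^ ψ := Real.rpow_pos_of_pos hr'.1 _
      have d1 : (r / r') ^ ψ * b r ≤ K * b r' := by
        have := ENNReal.toReal_mono (ENNReal.mul_ne_top ENNReal.ofReal_ne_top
          (hfin r' (mem hr').1)) c1
        rwa [ENNReal.toReal_mul, ENNReal.toReal_mul, ENNReal.toReal_ofReal hψ0,
          ENNReal.toReal_ofReal hK0.le] at this
      have d2 : b r' ≤ K * ((r / r') ^ ψ * b r) := by
        have := ENNReal.toReal_mono (ENNReal.mul_ne_top ENNReal.ofReal_ne_top
          (ENNReal.mul_ne_top ENNReal.ofReal_ne_top (hfin r (mem hr).1))) c2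
        rwa [ENNReal.toReal_mul, ENNReal.toReal_mul, ENNReal.toReal_ofReal hψ0,
          ENNReal.toReal_ofReal hK0.le] at this
      refine abs_log_sub_log_le (hHpos r (mem hr).1) (hHpos r' (mem hr').1) hK0 hKκ ?_ ?_
      · calc b r * r ^ ψ = (r / r') ^ ψ * b r * r' ^ ψ := by rw [← hpow]; ring
          _ ≤ K * b r' * r' ^ ψ := mul_le_mul_of_nonneg_right d1 hp'.le
          _ = _ := mul_assoc _ _ _
      · calc b r' * r' ^ ψ ≤ K * ((r / r') ^ ψ * b r) * r' ^ ψ :=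
              mul_le_mul_of_nonneg_right d2 hp'.le
          _ = K * (b r * r ^ ψ) := by rw [← hpow]; ring
    intro r hr r' hr'
    rcases le_total r' r with hle | hle
    · exact key r hr r' hr' hle
    · rw [abs_sub_comm]
      exact key r' hr' r hr hle)
  refine ⟨Real.exp L, Real.exp_pos _, ((Real.continuous_exp.tendsto L).comp hL).congr' ?_⟩
  filter_upwards [Ioc_mem_nhdsGT hρ0] with r hr
  exact Real.exp_log (hHpos r hr)

end IsLogField

/-- **Multifractal scaling.** Let `γ ∈ (0, √(2d))`, `g` continuous, `f : D → [0,∞)` bounded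
continuous, and `M` the Gaussian multiplicative chaos measure on `D`. For every `x ∈ D` with
`f x > 0` and every `q < 2d/γ²` there is a constant `C_x > 0` such that
`E[M(B(x,r))^q] / r^{ζ(q)} → C_x` as `r → 0⁺`, where `ζ(q) = (d + γ²/2) q - γ² q² / 2`. -/
theorem gmc_multifractal_scaling (hd : 1 ≤ d)
    (g : EuclideanSpace ℝ (Fin d) → EuclideanSpace ℝ (Fin d) → ℝ) (hg : IsBoundedMeasurable g)
    (hgcont : Continuous (Function.uncurry g))
    (θ : EuclideanSpace ℝ (Fin d) → ℝ) (hθ : IsMollifier θ)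
    {Ω : Type*} [MeasurableSpace Ω] (P : Measure Ω) [IsProbabilityMeasure P]
    (X : ℝ → EuclideanSpace ℝ (Fin d) → Ω → ℝ)
    (hX : IsGaussianFamily P X (mollifiedCov (logKernel g) θ θ))
    (γ : ℝ) (hγ0 : 0 < γ) (hγ2 : γ < Real.sqrt (2 * d))
    (D : Set (EuclideanSpace ℝ (Fin d))) (hD : IsOpen D) (hDne : D.Nonempty)
    (f : EuclideanSpace ℝ (Fin d) → ℝ) (hf0 : ∀ x, 0 ≤ f x) (hfcont : Continuous f)
    (hfbdd : ∃ C, ∀ x, f x ≤ C)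
    (M : Ω → Measure (EuclideanSpace ℝ (Fin d)))
    (hM : IsGMCMeasure P γ X (mollifiedCov (logKernel g) θ θ) f D M) :
    ∀ x ∈ D, 0 < f x → ∀ q : ℝ, q < 2 * d / γ ^ 2 →
      ∃ C : ℝ, 0 < C ∧
        Tendsto
          (fun r : ℝ => (∫⁻ ω, (M ω (Metric.ball x r)) ^ q ∂P).toReal /
            r ^ ((d + γ ^ 2 / 2) * q - γ ^ 2 * q ^ 2 / 2))
          (𝓝[>] (0 : ℝ)) (𝓝 C) := by
  intro x hx hfx q hq
  obtain ⟨B, hB⟩ := hfbdd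
  obtain ⟨R, c₀, hν⟩ := hθ.exists_isLogMollifier hd
  obtain ⟨c, hc⟩ := exists_hasLogBounds hg hθ hν
  have h : IsLogField P X (fieldCov g θ) c := ⟨hX.isGaussField, hc⟩
  have hsub : γ ^ 2 < 2 * d := (Real.lt_sqrt hγ0.le).1 hγ2
  obtain ⟨ρ, hρ, hρD⟩ := Metric.isOpen_iff.1 hD x hx
  set r₁ := min (ρ / 2) 1 with hr₁
  have hr₁0 : 0 < r₁ := lt_min (half_pos hρ) one_pos
  have hI : ∀ {r}, r ∈ Set.Ioc 0 r₁ → r ∈ Set.Ioc (0 : ℝ) 1 := fun hr =>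
    ⟨hr.1, hr.2.trans (min_le_right _ _)⟩
  have hcl : ∀ {r}, r ∈ Set.Ioc 0 r₁ → IsCompact (closure (Metric.ball x r)) ∧
      closure (Metric.ball x r) ⊆ D := fun {r} hr =>
    ⟨(isCompact_closedBall x r).of_isClosed_subset isClosed_closure
      Metric.closure_ball_subset_closedBall,
      Metric.closure_ball_subset_closedBall.trans ((Metric.closedBall_subset_ball
        (by linarith [hr.2.trans (min_le_left (ρ / 2) 1)])).trans hρD)⟩
  set U : ℝ → Ω → ℝ≥0∞ := fun r ω => (ENNReal.ofReal (r ^ d))⁻¹ * M ω (Metric.ball x r) with hU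
  have happrox : ∀ {r ε}, r ∈ Set.Ioc 0 r₁ → ε ∈ Set.Ioc (0 : ℝ) 1 → ∀ ω,
      (ballMass γ X (fieldCov g θ) f x r ε ω).toReal =
        (r ^ d)⁻¹ * approxGMC γ X (mollifiedCov (logKernel g) θ θ) f (r * ε) ω
          (Metric.ball x r) := fun {r ε} hr hε ω => by
    have := h.setIntegral_ball_eq (γ := γ) (x := x) hfcont.measurable hf0 hε (hI hr) ω
    simp only [fieldCov_self] at this
    rw [approxGMC, this, inv_mul_cancel_left₀ (pow_pos hr.1 d).ne']
  have hmeas : ∀ {r}, r ∈ Set.Ioc 0 r₁ → TendstoInMeasure P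
      (fun (n : ℕ) ω => approxGMC γ X (mollifiedCov (logKernel g) θ θ) f (r * (1 / ((n : ℝ) + 1))) ω
        (Metric.ball x r)) atTop fun ω => (M ω (Metric.ball x r)).toReal := fun {r} hr => by
    have ht : Tendsto (fun n : ℕ => r * (1 / ((n : ℝ) + 1))) atTop (𝓝[Set.Ioc (0 : ℝ) 1] 0) := by
      refine tendsto_nhdsWithin_iff.2 ⟨?_, Eventually.of_forall fun n => ?_⟩
      · simpa using (tendsto_one_div_add_atTop_nhds_zero_nat (𝕜 := ℝ)).const_mul r
      · exact ⟨mul_pos hr.1 Nat.one_div_pos_of_nat, mul_le_one₀ (hI hr).2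
          Nat.one_div_pos_of_nat.le (by simpa using Nat.one_div_le_one_div (α := ℝ) n.zero_le)⟩
    exact fun δ hδ => (hM.2.2 _ Metric.isOpen_ball.measurableSet (hcl hr).1 (hcl hr).2 δ hδ).comp ht
  obtain ⟨C, hC0, hC⟩ := h.exists_tendsto_lintegral_rpow hd hγ0 hsub hq hfcont hB hfx
    (fun δ hδ => exists_fieldCov_scaling hg hgcont hθ hν x hδ) hr₁0 (U := U)
    (fun r _ => (hM.1 _ Metric.isOpen_ball.measurableSet).const_mul _)
    (fun r hr => ae_of_all _ fun ω => ENNReal.mul_ne_top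
      (ENNReal.inv_ne_top.2 (by simpa using pow_pos hr.1 d))
      (hM.2.1 ω _ (hcl hr).1 (hcl hr).2))
    (fun r hr r' hr' => by
      obtain ⟨ns, hns, h1, h2⟩ := exists_strictMono_tendsto_ae_and (hmeas hr) (hmeas hr')
      have hε : ∀ n, 1 / ((ns n : ℝ) + 1) ∈ Set.Ioc (0 : ℝ) 1 := fun n =>
        ⟨Nat.one_div_pos_of_nat, by simpa using Nat.one_div_le_one_div (α := ℝ) (ns n).zero_le⟩
      have hUr : ∀ {r}, r ∈ Set.Ioc 0 r₁ → ∀ ω,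
          (U r ω).toReal = (r ^ d)⁻¹ * (M ω (Metric.ball x r)).toReal := fun {r} hr ω => by
        rw [hU, ENNReal.toReal_mul, ENNReal.toReal_inv, ENNReal.toReal_ofReal (pow_pos hr.1 d).le]
      refine ⟨fun n => 1 / ((ns n : ℝ) + 1), hε,
        (tendsto_one_div_add_atTop_nhds_zero_nat (𝕜 := ℝ)).comp hns.tendsto_atTop, ?_, ?_⟩
      · filter_upwards [h1] with ω hω
        simp only [happrox hr (hε _), hUr hr]
        exact hω.const_mul _
      · filter_upwards [h2] with ω hω
        simp only [happrox hr' (hε _), hUr hr']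
        exact hω.const_mul _)
  refine ⟨C, hC0, hC.congr' ?_⟩
  filter_upwards [Ioc_mem_nhdsGT hr₁0] with r hr
  have hrd : 0 < r ^ d := pow_pos hr.1 d
  have hrd' : ENNReal.ofReal (r ^ d) ≠ 0 := by simpa using hrd
  have e : ∀ ω, M ω (Metric.ball x r) ^ q = ENNReal.ofReal (r ^ d) ^ q * U r ω ^ q := fun ω => by
    rw [← ennreal_mul_rpow hrd' ENNReal.ofReal_ne_top, hU, ← mul_assoc,
      ENNReal.mul_inv_cancel hrd' ENNReal.ofReal_ne_top, one_mul]
  simp only [e]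
  rw [lintegral_const_mul' _ _ (ENNReal.rpow_ne_top_of_ne_zero hrd' ENNReal.ofReal_ne_top),
    ENNReal.toReal_mul, ← ENNReal.toReal_rpow, ENNReal.toReal_ofReal hrd.le,
    mul_comm ((r ^ d) ^ q), mul_div_assoc (ENNReal.toReal _)]
  congr 1
  rw [← Real.rpow_natCast r d, ← Real.rpow_mul hr.1.le, ← Real.rpow_sub hr.1]
  congr 1
  ring

end
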